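/- For every constant C₀ > 0 there exists a constant C > 0, depending only on Ω and C₀, such that the following holds: for every λ > 0 and every Neumann eigenfunction φ of Ω with eigenvalue λ² which satisfies the asymptotic Schiffer condition ∫₀^ℓ (d/ds φ(q(s)))² ds ≥ e^{−2C₀λ} · ∫₀^ℓ φ(q(s))² ds, the set of boundary critical points {s ∈ [0, ℓ) : d/ds φ(q(s)) = 0} is finite and has cardinality at most C·λ. -/

import Mathlib

open MeasureTheory Real
open scoped RealInnerProductSpace

noncomputable section

abbrev E2 : Type := EuclideanSpace ℝ (Fin 2)

/-- The Euclidean Laplacian `∂²/∂x₁² + ∂²/∂x₂²` on `ℝ²`. -/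
def lap (φ : E2 → ℝ) (x : E2) : ℝ :=
  ∑ i : Fin 2,
    fderiv ℝ (fun y => fderiv ℝ φ y (EuclideanSpace.single i 1)) x (EuclideanSpace.single i 1)

/-- A bounded open connected planar domain. -/
structure IsPlaneDomain (Ω : Set E2) : Prop where
  isOpen : IsOpen Ω
  isBounded : Bornology.IsBounded Ω
  isConnected : IsConnected Ω

/-- An arc-length parametrization `q` of the boundary of `Ω` (periodic with period `len`,
injective on `[0, len)`, unit speed, image equal to the frontier of `Ω`), together with the
unit normal `ν` along the boundary, pointing into `Ω`. -/
structure BoundaryParam (Ω : Set E2) where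
  len : ℝ
  len_pos : 0 < len
  q : ℝ → E2
  qd : ℝ → E2
  hasDerivAt : ∀ s, HasDerivAt q (qd s) s
  periodic : Function.Periodic q len
  injOn : Set.InjOn q (Set.Ico 0 len)
  unitSpeed : ∀ s, ‖qd s‖ = 1
  range_eq : Set.range q = frontier Ω
  ν : ℝ → E2
  ν_unit : ∀ s, ‖ν s‖ = 1
  ν_orth : ∀ s, ⟪ν s, qd s⟫ = 0
  ν_inward : ∀ s, ∃ δ > 0, ∀ t ∈ Set.Ioo (0 : ℝ) δ, q s + t • ν s ∈ Ω

/-- The boundary parametrization is real-analytic. -/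
def BoundaryParam.IsAnalytic {Ω : Set E2} (B : BoundaryParam Ω) : Prop :=
  AnalyticOnNhd ℝ B.q Set.univ

/-- `φ` is a Neumann eigenfunction of `Ω` with eigenvalue `lam²`: it is real-analytic on an
open neighborhood of the closure of `Ω`, not identically zero on `Ω`, satisfies
`Δφ = -lam² φ` on `Ω` and has vanishing normal derivative along the boundary. -/
structure IsNeumannEigenfunction {Ω : Set E2} (B : BoundaryParam Ω) (lam : ℝ)
    (φ : E2 → ℝ) : Prop where
  analytic : ∃ U : Set E2, IsOpen U ∧ closure Ω ⊆ U ∧ AnalyticOnNhd ℝ φ U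
  nontrivial : ∃ x ∈ Ω, φ x ≠ 0
  eigen : ∀ x ∈ Ω, lap φ x = -lam ^ 2 * φ x
  neumann : ∀ s : ℝ, ⟪gradient φ (B.q s), B.ν s⟫ = 0

namespace NeumannBoundary

open Set Filter Topology
open scoped ContDiff

/-- The partial derivative in the direction of the real axis. -/
def dx (f : ℂ → ℝ) (z : ℂ) : ℝ := fderiv ℝ f z 1

/-- The partial derivative in the direction of the imaginary axis. -/
def dy (f : ℂ → ℝ) (z : ℂ) : ℝ := fderiv ℝ f z Complex.I

lemma contDiffOn_dx {f : ℂ → ℝ} {W : Set ℂ} (hW : IsOpen W) (hf : ContDiffOn ℝ ∞ f W) :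
    ContDiffOn ℝ ∞ (dx f) W :=
  (hf.fderiv_of_isOpen hW (m := ∞) (by norm_cast)).clm_apply contDiffOn_const

lemma contDiffOn_dy {f : ℂ → ℝ} {W : Set ℂ} (hW : IsOpen W) (hf : ContDiffOn ℝ ∞ f W) :
    ContDiffOn ℝ ∞ (dy f) W :=
  (hf.fderiv_of_isOpen hW (m := ∞) (by norm_cast)).clm_apply contDiffOn_const

lemma contDiffOn_dx_iterate {f : ℂ → ℝ} {W : Set ℂ} (hW : IsOpen W) (hf : ContDiffOn ℝ ∞ f W)
    (k : ℕ) : ContDiffOn ℝ ∞ (dx^[k] f) W := by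
  induction k with
  | zero => simpa using hf
  | succ k ih => rw [Function.iterate_succ_apply']; exact contDiffOn_dx hW ih

lemma differentiableAt_of_contDiffOn {f : ℂ → ℝ} {W : Set ℂ} (hW : IsOpen W)
    (hf : ContDiffOn ℝ ∞ f W) {z : ℂ} (hz : z ∈ W) : DifferentiableAt ℝ f z :=
  (hf.differentiableOn (by simp)).differentiableAt (hW.mem_nhds hz)

lemma fderiv_fderiv_apply {f : ℂ → ℝ} {W : Set ℂ} (hW : IsOpen W) (hf : ContDiffOn ℝ ∞ f W)
    {z : ℂ} (hz : z ∈ W) (u v : ℂ) :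
    fderiv ℝ (fun w => fderiv ℝ f w u) z v = fderiv ℝ (fderiv ℝ f) z v u := by
  have h1 : DifferentiableAt ℝ (fderiv ℝ f) z :=
    ((hf.fderiv_of_isOpen hW (m := ∞) (by norm_cast)).differentiableOn
      (by simp)).differentiableAt (hW.mem_nhds hz)
  rw [fderiv_clm_apply h1 (differentiableAt_const _)]
  simp

lemma dx_dy_comm {f : ℂ → ℝ} {W : Set ℂ} (hW : IsOpen W) (hf : ContDiffOn ℝ ∞ f W)
    {z : ℂ} (hz : z ∈ W) : dx (dy f) z = dy (dx f) z := by
  have h := (hf.contDiffAt (hW.mem_nhds hz)).isSymmSndFDerivAt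
    (by simpa using (by norm_cast : (2 : WithTop ℕ∞) ≤ ∞))
  have h1 := fderiv_fderiv_apply hW hf hz Complex.I 1
  have h2 := fderiv_fderiv_apply hW hf hz 1 Complex.I
  unfold dx dy
  rw [h1, h2]
  exact h 1 Complex.I

lemma dx_congr {f g : ℂ → ℝ} {W : Set ℂ} (hW : IsOpen W) (h : EqOn f g W) :
    EqOn (dx f) (dx g) W := by
  intro z hz
  unfold dx
  rw [(h.eventuallyEq_of_mem (hW.mem_nhds hz)).fderiv_eq]

lemma dy_congr {f g : ℂ → ℝ} {W : Set ℂ} (hW : IsOpen W) (h : EqOn f g W) :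
    EqOn (dy f) (dy g) W := by
  intro z hz
  unfold dy
  rw [(h.eventuallyEq_of_mem (hW.mem_nhds hz)).fderiv_eq]

lemma dx_iterate_congr {f g : ℂ → ℝ} {W : Set ℂ} (hW : IsOpen W) (h : EqOn f g W) (k : ℕ) :
    EqOn (dx^[k] f) (dx^[k] g) W := by
  induction k with
  | zero => simpa using h
  | succ k ih => simp only [Function.iterate_succ_apply']; exact dx_congr hW ih

lemma dy_dx_iterate_comm {f : ℂ → ℝ} {W : Set ℂ} (hW : IsOpen W) (hf : ContDiffOn ℝ ∞ f W)
    (k : ℕ) : EqOn (dy (dx^[k] f)) (dx^[k] (dy f)) W := by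
  induction k with
  | zero => intro z _; rfl
  | succ k ih =>
    intro z hz
    simp only [Function.iterate_succ_apply']
    rw [← dx_dy_comm hW (contDiffOn_dx_iterate hW hf k) hz]
    exact dx_congr hW ih hz

lemma dx_add {f g : ℂ → ℝ} {z : ℂ} (hf : DifferentiableAt ℝ f z) (hg : DifferentiableAt ℝ g z) :
    dx (fun w => f w + g w) z = dx f z + dx g z := by
  unfold dx
  rw [fderiv_fun_add hf hg]
  rfl

lemma dy_add {f g : ℂ → ℝ} {z : ℂ} (hf : DifferentiableAt ℝ f z) (hg : DifferentiableAt ℝ g z) :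
    dy (fun w => f w + g w) z = dy f z + dy g z := by
  unfold dy
  rw [fderiv_fun_add hf hg]
  rfl

lemma dx_iterate_add {f g : ℂ → ℝ} {W : Set ℂ} (hW : IsOpen W) (hf : ContDiffOn ℝ ∞ f W)
    (hg : ContDiffOn ℝ ∞ g W) (k : ℕ) :
    EqOn (dx^[k] (fun z => f z + g z)) (fun z => dx^[k] f z + dx^[k] g z) W := by
  induction k with
  | zero => intro z _; rfl
  | succ k ih =>
    intro z hz
    simp only [Function.iterate_succ_apply']
    rw [dx_congr hW ih hz]
    exact dx_add (differentiableAt_of_contDiffOn hW (contDiffOn_dx_iterate hW hf k) hz)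
      (differentiableAt_of_contDiffOn hW (contDiffOn_dx_iterate hW hg k) hz)

lemma hasDerivAt_horizontal (y x : ℝ) :
    HasDerivAt (fun t : ℝ => (t : ℂ) + y * Complex.I) 1 x :=
  (Complex.ofRealCLM.hasDerivAt (x := x)).add_const _

lemma hasDerivAt_vertical (x y : ℝ) :
    HasDerivAt (fun t : ℝ => (x : ℂ) + t * Complex.I) Complex.I y := by
  simpa using ((Complex.ofRealCLM.hasDerivAt (x := y)).mul_const Complex.I).const_add (x : ℂ)

lemma hasDerivAt_comp_horizontal {f : ℂ → ℝ} {x y : ℝ}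
    (hf : DifferentiableAt ℝ f (x + y * Complex.I)) :
    HasDerivAt (fun t : ℝ => f (t + y * Complex.I)) (dx f (x + y * Complex.I)) x :=
  hf.hasFDerivAt.comp_hasDerivAt x (hasDerivAt_horizontal y x)

lemma hasDerivAt_comp_vertical {f : ℂ → ℝ} {x y : ℝ}
    (hf : DifferentiableAt ℝ f (x + y * Complex.I)) :
    HasDerivAt (fun t : ℝ => f (x + t * Complex.I)) (dy f (x + y * Complex.I)) y :=
  hf.hasFDerivAt.comp_hasDerivAt y (hasDerivAt_vertical x y)

lemma dx_mul {f g : ℂ → ℝ} {z : ℂ} (hf : DifferentiableAt ℝ f z) (hg : DifferentiableAt ℝ g z) :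
    dx (fun w => f w * g w) z = dx f z * g z + f z * dx g z := by
  unfold dx
  rw [fderiv_fun_mul hf hg]
  simp; ring

lemma dy_mul {f g : ℂ → ℝ} {z : ℂ} (hf : DifferentiableAt ℝ f z) (hg : DifferentiableAt ℝ g z) :
    dy (fun w => f w * g w) z = dy f z * g z + f z * dy g z := by
  unfold dy
  rw [fderiv_fun_mul hf hg]
  simp; ring

/-- The open strip `a < Im z < b`. -/
def strip (a b : ℝ) : Set ℂ := {z | a < z.im ∧ z.im < b}

lemma isOpen_strip (a b : ℝ) : IsOpen (strip a b) :=
  (isOpen_lt continuous_const Complex.continuous_im).inter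
    (isOpen_lt Complex.continuous_im continuous_const)

lemma mem_strip_add {a b x y : ℝ} : ((x : ℂ) + y * Complex.I) ∈ strip a b ↔ a < y ∧ y < b := by
  simp [strip]

lemma iteratedDeriv_horizontal {f : ℂ → ℝ} {a b : ℝ} (hf : ContDiffOn ℝ ∞ f (strip a b))
    {y : ℝ} (hy : a < y ∧ y < b) (k : ℕ) (x : ℝ) :
    iteratedDeriv k (fun t : ℝ => f (t + y * Complex.I)) x = dx^[k] f (x + y * Complex.I) := by
  induction k generalizing x with
  | zero => simp
  | succ k ih =>
    rw [iteratedDeriv_succ, funext ih, Function.iterate_succ_apply']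
    exact (hasDerivAt_comp_horizontal (differentiableAt_of_contDiffOn (isOpen_strip a b)
      (contDiffOn_dx_iterate (isOpen_strip a b) hf k) (mem_strip_add.2 hy))).deriv

lemma contDiff_horizontal {f : ℂ → ℝ} {a b : ℝ} (hf : ContDiffOn ℝ ∞ f (strip a b))
    {y : ℝ} (hy : a < y ∧ y < b) : ContDiff ℝ ∞ (fun t : ℝ => f (t + y * Complex.I)) := by
  rw [contDiff_iff_contDiffAt]
  intro x
  have h : ContDiffAt ℝ ∞ f ((x : ℂ) + y * Complex.I) :=
    hf.contDiffAt ((isOpen_strip a b).mem_nhds (mem_strip_add.2 hy))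
  refine h.comp x (ContDiffAt.add ?_ contDiffAt_const)
  exact Complex.ofRealCLM.contDiff.contDiffAt

lemma dx_iterate_mul {f g : ℂ → ℝ} {a b : ℝ} (hf : ContDiffOn ℝ ∞ f (strip a b))
    (hg : ContDiffOn ℝ ∞ g (strip a b)) {x y : ℝ} (hy : a < y ∧ y < b) (k : ℕ) :
    dx^[k] (fun z => f z * g z) (x + y * Complex.I) =
      ∑ j ∈ Finset.range (k + 1), (k.choose j : ℝ) * dx^[j] f (x + y * Complex.I) *
        dx^[k - j] g (x + y * Complex.I) := by
  rw [← iteratedDeriv_horizontal (hf.mul hg) hy k x,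
    iteratedDeriv_fun_mul ((contDiff_horizontal hf hy).contDiffAt.of_le (by exact_mod_cast le_top))
      ((contDiff_horizontal hg hy).contDiffAt.of_le (by exact_mod_cast le_top))]
  refine Finset.sum_congr rfl fun j _ => ?_
  rw [iteratedDeriv_horizontal hf hy, iteratedDeriv_horizontal hg hy]

/-- The integral of `w` over one period on the horizontal line of height `y`. -/
def slice (ℓ : ℝ) (w : ℂ → ℝ) (y : ℝ) : ℝ := ∫ x in (0 : ℝ)..ℓ, w (x + y * Complex.I)

lemma continuous_horizontal {w : ℂ → ℝ} {a b : ℝ} (hw : ContinuousOn w (strip a b)) {y : ℝ}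
    (hy : a < y ∧ y < b) : Continuous (fun x : ℝ => w (x + y * Complex.I)) := by
  refine hw.comp_continuous (by fun_prop) fun x => mem_strip_add.2 hy

lemma continuousOn_slice {w : ℂ → ℝ} {a b : ℝ} (hw : ContinuousOn w (strip a b)) (ℓ : ℝ) :
    ContinuousOn (slice ℓ w) (Ioo a b) := by
  rw [continuousOn_iff_continuous_domRestrict]
  refine intervalIntegral.continuous_parametric_intervalIntegral_of_continuous'
    (f := fun (y : Ioo a b) (x : ℝ) => w (x + (y : ℝ) * Complex.I)) ?_ 0 ℓ
  refine hw.comp_continuous (by fun_prop) fun p => mem_strip_add.2 p.1.2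

lemma hasDerivAt_slice {w : ℂ → ℝ} {a b : ℝ} (hw : ContDiffOn ℝ ∞ w (strip a b)) (ℓ : ℝ) {y : ℝ}
    (hy : y ∈ Ioo a b) : HasDerivAt (slice ℓ w) (slice ℓ (dy w) y) y := by
  have hdy := (contDiffOn_dy (isOpen_strip a b) hw).continuousOn
  obtain ⟨c, d, hcd, hsub⟩ : ∃ c d, y ∈ Ioo c d ∧ Icc c d ⊆ Ioo a b := by
    refine ⟨(a + y) / 2, (y + b) / 2, ⟨by linarith [hy.1], by linarith [hy.2]⟩, fun t ht => ?_⟩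
    exact ⟨by linarith [ht.1, hy.1], by linarith [ht.2, hy.2]⟩
  obtain ⟨C, hC⟩ := (isCompact_uIcc (a := (0 : ℝ)) (b := ℓ)).prod (isCompact_Icc (a := c) (b := d))
    |>.exists_bound_of_continuousOn (f := fun p : ℝ × ℝ => dy w (p.1 + p.2 * Complex.I))
      (hdy.comp (by fun_prop) fun p hp => mem_strip_add.2 (hsub hp.2))
  refine (intervalIntegral.hasDerivAt_integral_of_dominated_loc_of_deriv_le
    (F := fun (t x : ℝ) => w ((x : ℂ) + t * Complex.I))
    (F' := fun (t x : ℝ) => dy w ((x : ℂ) + t * Complex.I)) (bound := fun _ => C)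
    (Ioo_mem_nhds hcd.1 hcd.2) ?_ ?_ ?_ ?_ ?_ ?_).2
  · filter_upwards [Ioo_mem_nhds hy.1 hy.2] with t ht
    exact (continuous_horizontal hw.continuousOn ht).aestronglyMeasurable
  · exact (continuous_horizontal hw.continuousOn hy).intervalIntegrable _ _
  · exact (continuous_horizontal hdy hy).aestronglyMeasurable
  · refine ae_of_all _ fun x hx t ht => ?_
    exact hC (x, t) ⟨uIoc_subset_uIcc hx, Ioo_subset_Icc_self ht⟩
  · exact intervalIntegrable_const
  · refine ae_of_all _ fun x hx t ht => ?_
    exact hasDerivAt_comp_vertical (differentiableAt_of_contDiffOn (isOpen_strip a b) hw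
      (mem_strip_add.2 (hsub (Ioo_subset_Icc_self ht))))

lemma slice_dx {w : ℂ → ℝ} {a b ℓ : ℝ} (hw : ContDiffOn ℝ ∞ w (strip a b))
    (hper : ∀ z, w (z + ℓ) = w z) {y : ℝ} (hy : y ∈ Ioo a b) : slice ℓ (dx w) y = 0 := by
  unfold slice
  rw [intervalIntegral.integral_eq_sub_of_hasDerivAt
    (f := fun x : ℝ => w (x + y * Complex.I))
    (fun x _ => hasDerivAt_comp_horizontal (differentiableAt_of_contDiffOn (isOpen_strip a b) hw
      (mem_strip_add.2 hy)))
    ((continuous_horizontal (contDiffOn_dx (isOpen_strip a b) hw).continuousOn hy).intervalIntegrable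
      _ _)]
  have := hper ((0 : ℝ) + y * Complex.I)
  rw [sub_eq_zero, ← this]
  congr 1
  push_cast
  ring

lemma dx_periodic {w : ℂ → ℝ} {ℓ : ℝ} (hper : ∀ z, w (z + ℓ) = w z) (z : ℂ) :
    dx w (z + ℓ) = dx w z := by
  unfold dx
  rw [← fderiv_comp_add_right, funext hper]

lemma dy_periodic {w : ℂ → ℝ} {ℓ : ℝ} (hper : ∀ z, w (z + ℓ) = w z) (z : ℂ) :
    dy w (z + ℓ) = dy w z := by
  unfold dy
  rw [← fderiv_comp_add_right, funext hper]

lemma dx_iterate_periodic {w : ℂ → ℝ} {ℓ : ℝ} (hper : ∀ z, w (z + ℓ) = w z) (k : ℕ) (z : ℂ) :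
    dx^[k] w (z + ℓ) = dx^[k] w z := by
  induction k generalizing z with
  | zero => exact hper z
  | succ k ih => rw [Function.iterate_succ_apply']; exact dx_periodic ih z

lemma slice_nonneg {w : ℂ → ℝ} {ℓ : ℝ} (hℓ : 0 ≤ ℓ) (hw : ∀ z, 0 ≤ w z) (y : ℝ) :
    0 ≤ slice ℓ w y :=
  intervalIntegral.integral_nonneg hℓ fun _ _ => hw _

lemma slice_mono {v w : ℂ → ℝ} {a b ℓ : ℝ} (hℓ : 0 ≤ ℓ) (hv : ContinuousOn v (strip a b))
    (hw : ContinuousOn w (strip a b)) {y : ℝ} (hy : y ∈ Ioo a b)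
    (h : ∀ x : ℝ, v (x + y * Complex.I) ≤ w (x + y * Complex.I)) : slice ℓ v y ≤ slice ℓ w y :=
  intervalIntegral.integral_mono_on hℓ ((continuous_horizontal hv hy).intervalIntegrable _ _)
    ((continuous_horizontal hw hy).intervalIntegrable _ _) fun x _ => h x

lemma slice_add {v w : ℂ → ℝ} {a b : ℝ} (ℓ : ℝ) (hv : ContinuousOn v (strip a b))
    (hw : ContinuousOn w (strip a b)) {y : ℝ} (hy : y ∈ Ioo a b) :
    slice ℓ (fun z => v z + w z) y = slice ℓ v y + slice ℓ w y :=
  intervalIntegral.integral_add ((continuous_horizontal hv hy).intervalIntegrable _ _)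
    ((continuous_horizontal hw hy).intervalIntegrable _ _)

lemma slice_const_mul (ℓ c : ℝ) (w : ℂ → ℝ) (y : ℝ) :
    slice ℓ (fun z => c * w z) y = c * slice ℓ w y :=
  intervalIntegral.integral_const_mul _ _

/-- A one-dimensional Caccioppoli inequality for a function with vanishing derivative at `0`. -/
lemma caccioppoli_one_dim {J J₁ J₂ E Φ : ℝ → ℝ} {r δ : ℝ} (hr : 0 ≤ r) (hδ : 0 < δ)
    (hJc : ContinuousOn J (Icc 0 (r + 2 * δ))) (hJ₁c : ContinuousOn J₁ (Icc 0 (r + 2 * δ)))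
    (hJ₂c : ContinuousOn J₂ (Icc 0 (r + 2 * δ)))
    (hEc : ContinuousOn E (Icc 0 (r + 2 * δ))) (hΦc : ContinuousOn Φ (Icc 0 (r + 2 * δ)))
    (hJ : ∀ t ∈ Ioo 0 (r + 2 * δ), HasDerivAt J (J₁ t) t)
    (hJ₁ : ∀ t ∈ Ioo 0 (r + 2 * δ), HasDerivAt J₁ (J₂ t) t) (h0 : J₁ 0 = 0)
    (hJn : ∀ t, 0 ≤ J t) (hEn : ∀ t, 0 ≤ E t) (hΦn : ∀ t, 0 ≤ Φ t)
    (hle : ∀ t ∈ Ioo 0 (r + 2 * δ), 2 * E t - J t / δ ^ 2 - δ ^ 2 * Φ t ≤ J₂ t) :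
    ∫ t in (0 : ℝ)..r, E t ≤ (∫ t in (0 : ℝ)..(r + 2 * δ), J t) / δ ^ 2 +
      δ ^ 2 * ∫ t in (0 : ℝ)..(r + 2 * δ), Φ t := by
  set ρ := r + 2 * δ with hρ
  have int : ∀ {f : ℝ → ℝ}, ContinuousOn f (Icc 0 ρ) → ∀ {s t : ℝ}, 0 ≤ s → s ≤ t → t ≤ ρ →
      IntervalIntegrable f volume s t := fun hf s t h1 h2 h3 =>
    (hf.mono (Icc_subset_Icc h1 h3)).intervalIntegrable_of_Icc h2
  set P := ∫ t in (0 : ℝ)..ρ, J t with hP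
  set Q := ∫ t in (0 : ℝ)..ρ, Φ t with hQ
  set e := ∫ t in (0 : ℝ)..r, E t with he
  have mono : ∀ {f : ℝ → ℝ}, ContinuousOn f (Icc 0 ρ) → (∀ t, 0 ≤ f t) → ∀ {s t : ℝ}, 0 ≤ s →
      s ≤ t → t ≤ ρ → ∫ x in (0 : ℝ)..s, f x ≤ ∫ x in (0 : ℝ)..t, f x := by
    intro f hf hf0 s t h1 h2 h3
    exact intervalIntegral.integral_mono_interval le_rfl h1 h2 (ae_of_all _ hf0)
      (int hf le_rfl (h1.trans h2) h3)
  set κ := 2 * e - P / δ ^ 2 - δ ^ 2 * Q with hκ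
  have key : ∀ t ∈ Icc r ρ, κ ≤ J₁ t := by
    intro t ht
    have h1 : ∫ x in (0 : ℝ)..t, J₂ x = J₁ t - J₁ 0 :=
      intervalIntegral.integral_eq_sub_of_hasDerivAt_of_le (hr.trans ht.1)
        (hJ₁c.mono (Icc_subset_Icc le_rfl ht.2))
        (fun x hx => hJ₁ x ⟨hx.1, hx.2.trans_le ht.2⟩) (int hJ₂c le_rfl (hr.trans ht.1) ht.2)
    have iE := int hEc le_rfl (hr.trans ht.1) ht.2
    have iJ := int hJc le_rfl (hr.trans ht.1) ht.2
    have iΦ := int hΦc le_rfl (hr.trans ht.1) ht.2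
    have h2 : ∫ x in (0 : ℝ)..t, (2 * E x - J x / δ ^ 2 - δ ^ 2 * Φ x) ≤
        ∫ x in (0 : ℝ)..t, J₂ x := by
      refine intervalIntegral.integral_mono_on_of_le_Ioo (hr.trans ht.1)
        (((iE.const_mul 2).sub (iJ.div_const _)).sub (iΦ.const_mul _))
        (int hJ₂c le_rfl (hr.trans ht.1) ht.2) fun x hx => hle x ⟨hx.1, hx.2.trans_le ht.2⟩
    rw [intervalIntegral.integral_sub ((iE.const_mul 2).sub (iJ.div_const _)) (iΦ.const_mul _),
      intervalIntegral.integral_sub (iE.const_mul 2) (iJ.div_const _),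
      intervalIntegral.integral_const_mul, intervalIntegral.integral_const_mul,
      intervalIntegral.integral_div, h1, h0] at h2
    have h3 := mono hEc hEn hr ht.1 ht.2
    have h4 := mono hJc hJn (hr.trans ht.1) ht.2 le_rfl
    have h5 := mono hΦc hΦn (hr.trans ht.1) ht.2 le_rfl
    have h6 : (∫ x in (0 : ℝ)..t, J x) / δ ^ 2 ≤ P / δ ^ 2 := by gcongr
    have h7 : δ ^ 2 * (∫ x in (0 : ℝ)..t, Φ x) ≤ δ ^ 2 * Q := by gcongr
    linarith
  have low : ∀ t ∈ Icc r ρ, κ * (t - r) ≤ J t := by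
    intro t ht
    have h1 : ∫ x in r..t, J₁ x = J t - J r :=
      intervalIntegral.integral_eq_sub_of_hasDerivAt_of_le ht.1
        (hJc.mono (Icc_subset_Icc hr ht.2))
        (fun x hx => hJ x ⟨hr.trans_lt hx.1, hx.2.trans_le ht.2⟩) (int hJ₁c hr ht.1 ht.2)
    have h2 : ∫ x in r..t, κ ≤ ∫ x in r..t, J₁ x :=
      intervalIntegral.integral_mono_on ht.1 intervalIntegrable_const (int hJ₁c hr ht.1 ht.2)
        fun x hx => key x ⟨hx.1, hx.2.trans ht.2⟩
    rw [intervalIntegral.integral_const, smul_eq_mul, h1] at h2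
    linarith [hJn r]
  have hrρ : r ≤ ρ := by rw [hρ]; linarith
  have h1 : ∫ t in r..ρ, κ * (t - r) ≤ ∫ t in r..ρ, J t :=
    intervalIntegral.integral_mono_on hrρ (by apply Continuous.intervalIntegrable; fun_prop)
      (int hJc hr hrρ le_rfl) low
  have h2 : ∫ t in r..ρ, κ * (t - r) = 2 * κ * δ ^ 2 := by
    rw [intervalIntegral.integral_const_mul, intervalIntegral.integral_comp_sub_right (fun x => x)]
    simp [hρ]; ring
  have h3 : ∫ t in r..ρ, J t ≤ P := by
    have := intervalIntegral.integral_add_adjacent_intervals (int hJc le_rfl hr hrρ)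
      (int hJc hr hrρ le_rfl)
    have h4 : 0 ≤ ∫ t in (0 : ℝ)..r, J t := intervalIntegral.integral_nonneg hr fun t _ => hJn t
    linarith
  have h4 : κ ≤ P / δ ^ 2 / 2 := by
    rw [div_div, le_div_iff₀ (by positivity)]
    linarith
  have hP0 : 0 ≤ P / δ ^ 2 :=
    div_nonneg (intervalIntegral.integral_nonneg (hr.trans hrρ) fun t _ => hJn t) (by positivity)
  have hQ0 : 0 ≤ δ ^ 2 * Q :=
    mul_nonneg (by positivity) (intervalIntegral.integral_nonneg (hr.trans hrρ) fun t _ => hΦn t)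
  linarith

lemma energy_estimate {w F : ℂ → ℝ} {ε R ℓ r δ : ℝ} (hε : 0 < ε) (hℓ : 0 ≤ ℓ)
    (hw : ContDiffOn ℝ ∞ w (strip (-ε) R)) (hF : ContDiffOn ℝ ∞ F (strip (-ε) R))
    (hper : ∀ z, w (z + ℓ) = w z) (hN : ∀ x : ℝ, dy w x = 0)
    (heq : ∀ z ∈ strip 0 R, dx (dx w) z + dy (dy w) z = F z)
    (hr : 0 ≤ r) (hδ : 0 < δ) (hrR : r + 2 * δ < R) :
    ∫ t in (0 : ℝ)..r, slice ℓ (fun z => dx w z ^ 2 + dy w z ^ 2) t ≤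
      (∫ t in (0 : ℝ)..(r + 2 * δ), slice ℓ (fun z => w z ^ 2) t) / δ ^ 2 +
      δ ^ 2 * ∫ t in (0 : ℝ)..(r + 2 * δ), slice ℓ (fun z => F z ^ 2) t := by
  have hopen := isOpen_strip (-ε) R
  have hwx := contDiffOn_dx hopen hw
  have hwy := contDiffOn_dy hopen hw
  have hwwy : ContDiffOn ℝ ∞ (fun z => w z * dy w z) (strip (-ε) R) := hw.mul hwy
  have hwwx : ContDiffOn ℝ ∞ (fun z => w z * dx w z) (strip (-ε) R) := hw.mul hwx
  have hsub : Icc 0 (r + 2 * δ) ⊆ Ioo (-ε) R := fun t ht =>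
    ⟨by linarith [ht.1], by linarith [ht.2]⟩
  have hww : ContDiffOn ℝ ∞ (fun z => w z * w z) (strip (-ε) R) := hw.mul hw
  have cE : ContinuousOn (fun z => dx w z ^ 2 + dy w z ^ 2) (strip (-ε) R) :=
    (hwx.continuousOn.pow 2).add (hwy.continuousOn.pow 2)
  have cJ : ContinuousOn (fun z => w z ^ 2) (strip (-ε) R) := hw.continuousOn.pow 2
  have cΦ : ContinuousOn (fun z => F z ^ 2) (strip (-ε) R) := hF.continuousOn.pow 2
  refine caccioppoli_one_dim (J := slice ℓ (fun z => w z ^ 2))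
    (J₁ := fun t => 2 * slice ℓ (fun z => w z * dy w z) t)
    (J₂ := fun t => 2 * slice ℓ (dy (fun z => w z * dy w z)) t) hr hδ
    ((continuousOn_slice cJ ℓ).mono hsub)
    (((continuousOn_slice hwwy.continuousOn ℓ).mono hsub).const_smul (2 : ℝ))
    (((continuousOn_slice (contDiffOn_dy hopen hwwy).continuousOn ℓ).mono hsub).const_smul (2 : ℝ))
    ((continuousOn_slice cE ℓ).mono hsub)
    ((continuousOn_slice cΦ ℓ).mono hsub) ?_ ?_ ?_ ?_ ?_ ?_ ?_
  · intro t ht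
    have h := hasDerivAt_slice hww ℓ (hsub (Ioo_subset_Icc_self ht))
    have h2 : slice ℓ (dy fun z => w z * w z) t = 2 * slice ℓ (fun z => w z * dy w z) t := by
      rw [← slice_const_mul]
      refine intervalIntegral.integral_congr fun x _ => ?_
      have hd := differentiableAt_of_contDiffOn hopen hw
        (mem_strip_add.2 (hsub (Ioo_subset_Icc_self ht)) : (x : ℂ) + t * Complex.I ∈ _)
      simp only [dy_mul hd hd]
      ring
    rw [h2] at h
    convert h using 2
    ext z; ring
  · intro t ht
    exact (hasDerivAt_slice hwwy ℓ (hsub (Ioo_subset_Icc_self ht))).const_mul 2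
  · simp [slice, hN]
  · exact fun t => slice_nonneg hℓ (fun z => sq_nonneg _) t
  · exact fun t => slice_nonneg hℓ (fun z => by positivity) t
  · exact fun t => slice_nonneg hℓ (fun z => sq_nonneg _) t
  · intro t ht
    have hts := hsub (Ioo_subset_Icc_self ht)
    have h0 := slice_dx hwwx (fun z => by rw [hper, dx_periodic hper]) hts
    have cdy := (contDiffOn_dy hopen hwwy).continuousOn
    have cdx := (contDiffOn_dx hopen hwwx).continuousOn
    have h1 : slice ℓ (dy fun z => w z * dy w z) t =
        slice ℓ (fun z => dy (fun z => w z * dy w z) z + dx (fun z => w z * dx w z) z) t := by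
      rw [slice_add ℓ cdy cdx hts, h0, add_zero]
    have cE2 : ContinuousOn (fun z => 2 * (dx w z ^ 2 + dy w z ^ 2)) (strip (-ε) R) :=
      continuousOn_const.mul cE
    have cJ2 : ContinuousOn (fun z => -(δ ^ 2)⁻¹ * w z ^ 2) (strip (-ε) R) :=
      continuousOn_const.mul cJ
    have cΦ2 : ContinuousOn (fun z => -δ ^ 2 * F z ^ 2) (strip (-ε) R) :=
      continuousOn_const.mul cΦ
    have cJΦ : ContinuousOn (fun z => -(δ ^ 2)⁻¹ * w z ^ 2 + -δ ^ 2 * F z ^ 2) (strip (-ε) R) :=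
      cJ2.add cΦ2
    have cL : ContinuousOn (fun z => 2 * (dx w z ^ 2 + dy w z ^ 2) +
        (-(δ ^ 2)⁻¹ * w z ^ 2 + -δ ^ 2 * F z ^ 2)) (strip (-ε) R) := cE2.add cJΦ
    have cU : ContinuousOn (fun z => 2 * (dy (fun z => w z * dy w z) z +
        dx (fun z => w z * dx w z) z)) (strip (-ε) R) := continuousOn_const.mul (cdy.add cdx)
    have h2 : slice ℓ (fun z => 2 * (dx w z ^ 2 + dy w z ^ 2) +
        (-(δ ^ 2)⁻¹ * w z ^ 2 + -δ ^ 2 * F z ^ 2)) t ≤ slice ℓ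
        (fun z => 2 * (dy (fun z => w z * dy w z) z + dx (fun z => w z * dx w z) z)) t := by
      refine slice_mono hℓ cL cU hts fun x => ?_
      have hz : (x : ℂ) + t * Complex.I ∈ strip (-ε) R := mem_strip_add.2 hts
      have hd := differentiableAt_of_contDiffOn hopen hw hz
      rw [dy_mul hd (differentiableAt_of_contDiffOn hopen hwy hz),
        dx_mul hd (differentiableAt_of_contDiffOn hopen hwx hz)]
      have he := heq (x + t * Complex.I) (mem_strip_add.2 ⟨ht.1, hts.2⟩)
      generalize (x : ℂ) + t * Complex.I = z at *
      have : dy (dy w) z = F z - dx (dx w) z := by linarith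
      rw [this]
      have h5 : 0 ≤ (δ⁻¹ * w z + δ * F z) ^ 2 := sq_nonneg _
      have h6 : (δ⁻¹ * w z + δ * F z) ^ 2 = (δ ^ 2)⁻¹ * w z ^ 2 + 2 * (w z * F z) +
          δ ^ 2 * F z ^ 2 := by field_simp; ring
      nlinarith
    rw [slice_add ℓ cE2 cJΦ hts, slice_add ℓ cJ2 cΦ2 hts] at h2
    simp only [slice_const_mul] at h2
    rw [h1]
    refine le_trans (le_of_eq ?_) h2
    rw [div_eq_inv_mul]
    ring

lemma le_average_add_integral {v v' D : ℝ → ℝ} {r a : ℝ} (hr : 0 < r) (ha : a ∈ Icc 0 r)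
    (hv : ∀ t ∈ Icc 0 r, HasDerivAt v (v' t) t) (hv' : ContinuousOn v' (Icc 0 r))
    (hD : ContinuousOn D (Icc 0 r)) (hle : ∀ t ∈ Icc 0 r, |v' t| ≤ D t) :
    v a ≤ (∫ t in (0 : ℝ)..r, v t) / r + ∫ t in (0 : ℝ)..r, D t := by
  have hvc : ContinuousOn v (Icc 0 r) := fun t ht => (hv t ht).continuousAt.continuousWithinAt
  have key : ∀ t ∈ Icc 0 r, v a - (∫ s in (0 : ℝ)..r, D s) ≤ v t := by
    intro t ht
    have hsub : uIcc t a ⊆ Icc 0 r := uIcc_subset_Icc ht ha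
    have h1 : ∫ s in t..a, v' s = v a - v t :=
      intervalIntegral.integral_eq_sub_of_hasDerivAt (fun s hs => hv s (hsub hs))
        (hv'.mono hsub).intervalIntegrable
    have h2 : ‖∫ s in t..a, v' s‖ ≤ |∫ s in t..a, D s| :=
      intervalIntegral.norm_integral_le_abs_of_norm_le
        (ae_restrict_of_forall_mem measurableSet_uIoc fun s hs =>
          hle s (hsub (uIoc_subset_uIcc hs)))
        (hD.mono hsub).intervalIntegrable
    have h3 : |∫ s in t..a, D s| ≤ |∫ s in (0 : ℝ)..r, D s| := by
      refine intervalIntegral.abs_integral_mono_interval ?_ ?_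
        (hD.mono (by rw [uIcc_of_le hr.le])).intervalIntegrable
      · rw [uIoc_of_le hr.le]
        intro s hs
        rw [mem_uIoc] at hs
        rcases hs with hs | hs
        · exact ⟨ht.1.trans_lt hs.1, hs.2.trans ha.2⟩
        · exact ⟨ha.1.trans_lt hs.1, hs.2.trans ht.2⟩
      · refine (ae_restrict_of_forall_mem measurableSet_uIoc fun s hs => ?_)
        rw [uIoc_of_le hr.le] at hs
        exact (abs_nonneg _).trans (hle s (Ioc_subset_Icc_self hs))
    have h4 : 0 ≤ ∫ s in (0 : ℝ)..r, D s :=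
      intervalIntegral.integral_nonneg hr.le fun s hs => (abs_nonneg _).trans (hle s hs)
    rw [abs_of_nonneg h4] at h3
    rw [h1, Real.norm_eq_abs] at h2
    linarith [le_abs_self (v a - v t)]
  have h1 := intervalIntegral.integral_mono_on hr.le (intervalIntegrable_const (μ := volume))
    (hvc.mono (by rw [uIcc_of_le hr.le])).intervalIntegrable key
  rw [intervalIntegral.integral_const, smul_eq_mul, sub_zero, ← le_div_iff₀' hr] at h1
  linarith

/-- The `L²` norm squared of `w` over a period of the strip `0 < im z < r`. -/
def mass (ℓ : ℝ) (w : ℂ → ℝ) (r : ℝ) : ℝ := ∫ t in (0 : ℝ)..r, slice ℓ (fun z => w z ^ 2) t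

lemma mass_nonneg {ℓ r : ℝ} (hℓ : 0 ≤ ℓ) (hr : 0 ≤ r) (w : ℂ → ℝ) : 0 ≤ mass ℓ w r :=
  intervalIntegral.integral_nonneg hr fun t _ => slice_nonneg hℓ (fun _ => sq_nonneg _) t

lemma intervalIntegrable_slice {w : ℂ → ℝ} {ε R r : ℝ} (hε : 0 < ε) (ℓ : ℝ)
    (hw : ContinuousOn w (strip (-ε) R)) (hr : 0 ≤ r) (hrR : r < R) :
    IntervalIntegrable (slice ℓ w) volume 0 r := by
  refine ((continuousOn_slice hw ℓ).mono fun t ht => ?_).intervalIntegrable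
  rw [uIcc_of_le hr] at ht
  exact ⟨by linarith [ht.1], by linarith [ht.2]⟩

lemma integral_slice_mono {v w : ℂ → ℝ} {ε R ℓ r : ℝ} (hε : 0 < ε) (hℓ : 0 ≤ ℓ)
    (hv : ContinuousOn v (strip (-ε) R)) (hw : ContinuousOn w (strip (-ε) R))
    (hr : 0 ≤ r) (hrR : r < R) (h : ∀ z : ℂ, 0 ≤ z.im → z.im < R → v z ≤ w z) :
    ∫ t in (0 : ℝ)..r, slice ℓ v t ≤ ∫ t in (0 : ℝ)..r, slice ℓ w t := by
  refine intervalIntegral.integral_mono_on hr (intervalIntegrable_slice hε ℓ hv hr hrR)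
    (intervalIntegrable_slice hε ℓ hw hr hrR) fun t ht => ?_
  refine slice_mono hℓ hv hw ⟨by linarith [ht.1], by linarith [ht.2]⟩ fun x => ?_
  exact h _ (by simpa using ht.1) (by simpa using ht.2.trans_lt hrR)

lemma mass_mono {w : ℂ → ℝ} {ε R ℓ r s : ℝ} (hε : 0 < ε) (hℓ : 0 ≤ ℓ)
    (hw : ContinuousOn w (strip (-ε) R)) (hr : 0 ≤ r) (hrs : r ≤ s) (hsR : s < R) :
    mass ℓ w r ≤ mass ℓ w s :=
  intervalIntegral.integral_mono_interval le_rfl hr hrs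
    (ae_of_all _ fun t => slice_nonneg hℓ (fun _ => sq_nonneg _) t)
    (intervalIntegrable_slice hε ℓ (hw.pow 2) (hr.trans hrs) hsR)

lemma integral_slice_sum {ι : Type*} (s : Finset ι) {w : ι → ℂ → ℝ} {ε R r : ℝ} (hε : 0 < ε)
    (ℓ : ℝ) (hw : ∀ i ∈ s, ContinuousOn (w i) (strip (-ε) R)) (c : ι → ℝ) (hr : 0 ≤ r)
    (hrR : r < R) :
    ∫ t in (0 : ℝ)..r, slice ℓ (fun z => ∑ i ∈ s, c i * w i z) t =
      ∑ i ∈ s, c i * ∫ t in (0 : ℝ)..r, slice ℓ (w i) t := by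
  have h1 : ∀ t ∈ Icc 0 r, slice ℓ (fun z => ∑ i ∈ s, c i * w i z) t =
      ∑ i ∈ s, c i * slice ℓ (w i) t := by
    intro t ht
    unfold slice
    rw [intervalIntegral.integral_finsetSum]
    · simp
    · intro i hi
      exact ((continuous_horizontal (hw i hi) ⟨by linarith [ht.1], by linarith [ht.2]⟩).const_smul
        (c i)).intervalIntegrable _ _
  rw [intervalIntegral.integral_congr (g := fun t => ∑ i ∈ s, c i * slice ℓ (w i) t)
    fun t ht => h1 t (by rwa [uIcc_of_le hr] at ht), intervalIntegral.integral_finsetSum]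
  · simp
  · intro i hi
    exact (intervalIntegrable_slice hε ℓ (hw i hi) hr hrR).const_mul _

lemma sq_sum_range_le (k : ℕ) (a : ℕ → ℝ) :
    (∑ j ∈ Finset.range (k + 1), a j) ^ 2 ≤ ∑ j ∈ Finset.range (k + 1), 2 * 2 ^ j * a j ^ 2 := by
  have h := Finset.sum_sq_le_sum_mul_sum_of_sq_le_mul (Finset.range (k + 1)) (r := a)
    (f := fun j => (2⁻¹ : ℝ) ^ j) (g := fun j => 2 ^ j * a j ^ 2) (fun _ _ => by positivity)
    (fun _ _ => by positivity) (fun j _ => by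
      rw [← mul_assoc, ← mul_pow]; norm_num)
  refine h.trans ?_
  simp only [mul_assoc]
  rw [← Finset.mul_sum]
  refine mul_le_mul_of_nonneg_right ?_ (Finset.sum_nonneg fun _ _ => by positivity)
  have := geom_sum_Ico_le_of_lt_one (x := (2⁻¹ : ℝ)) (m := 0) (n := k + 1) (by norm_num)
    (by norm_num)
  rw [← Finset.range_eq_Ico] at this
  norm_num at this ⊢
  exact this

lemma choose_mul_factorial_le (k j : ℕ) : ((k.choose j : ℝ)) * j.factorial ≤ (k : ℝ) ^ j := by
  have h := Nat.descFactorial_le_pow k j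
  rw [Nat.descFactorial_eq_factorial_mul_choose] at h
  rw [mul_comm]
  exact_mod_cast h

/-- Pointwise bound for the derivatives of a product with an analytic potential. -/
lemma sq_dx_iterate_mul_le {g V : ℂ → ℝ} {ε R lam A : ℝ}
    (hg : ContDiffOn ℝ ∞ g (strip (-ε) R)) (hV : ContDiffOn ℝ ∞ V (strip (-ε) R)) (hA : 0 ≤ A)
    (hε : 0 < ε)
    (hVA : ∀ j (z : ℂ), 0 ≤ z.im → z.im < R →
      |dx^[j] V z| ≤ lam ^ 2 * A ^ (j + 1) * j.factorial)
    (k : ℕ) (z : ℂ) (hz0 : 0 ≤ z.im) (hzR : z.im < R) :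
    (dx^[k] (fun z => V z * g z) z) ^ 2 ≤ ∑ j ∈ Finset.range (k + 1),
      (2 * lam ^ 4 * A ^ 2 * (2 * (k * A) ^ 2) ^ j) * (dx^[k - j] g z) ^ 2 := by
  have hz : z ∈ strip (-ε) R := ⟨by linarith, hzR⟩
  have h1 : dx^[k] (fun z => V z * g z) z = ∑ j ∈ Finset.range (k + 1),
      (k.choose j : ℝ) * dx^[j] V z * dx^[k - j] g z := by
    have := dx_iterate_mul hV hg (x := z.re) (y := z.im) hz k
    simpa only [Complex.re_add_im] using this
  rw [h1]
  refine (sq_sum_range_le k _).trans (Finset.sum_le_sum fun j _ => ?_)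
  have h2 : |(k.choose j : ℝ) * dx^[j] V z| ≤ lam ^ 2 * A * (k * A) ^ j := by
    rw [abs_mul, abs_of_nonneg (by positivity : (0 : ℝ) ≤ k.choose j)]
    calc (k.choose j : ℝ) * |dx^[j] V z|
        ≤ k.choose j * (lam ^ 2 * A ^ (j + 1) * j.factorial) := by gcongr; exact hVA j z hz0 hzR
      _ = lam ^ 2 * A ^ (j + 1) * ((k.choose j : ℝ) * j.factorial) := by ring
      _ ≤ lam ^ 2 * A ^ (j + 1) * (k : ℝ) ^ j := by
        gcongr; exact choose_mul_factorial_le k j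
      _ = lam ^ 2 * A * (k * A) ^ j := by rw [mul_pow]; ring
  have h3 := pow_le_pow_left₀ (abs_nonneg _) h2 2
  rw [sq_abs] at h3
  calc 2 * 2 ^ j * ((k.choose j : ℝ) * dx^[j] V z * dx^[k - j] g z) ^ 2
      = 2 * 2 ^ j * ((k.choose j : ℝ) * dx^[j] V z) ^ 2 * (dx^[k - j] g z) ^ 2 := by ring
    _ ≤ 2 * 2 ^ j * (lam ^ 2 * A * (k * A) ^ j) ^ 2 * (dx^[k - j] g z) ^ 2 := by gcongr
    _ = _ := by rw [mul_pow (2 : ℝ)]; ring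

lemma dy_dx_iterate_real {g : ℂ → ℝ} {ε R : ℝ} (hε : 0 < ε) (hR : 0 < R)
    (hg : ContDiffOn ℝ ∞ g (strip (-ε) R)) (hN : ∀ x : ℝ, dy g x = 0) (k : ℕ) (x : ℝ) :
    dy (dx^[k] g) x = 0 := by
  have h0 : -ε < (0 : ℝ) ∧ (0 : ℝ) < R := ⟨by linarith, hR⟩
  have hx : (x : ℂ) ∈ strip (-ε) R := by simpa [strip] using ⟨hε, hR⟩
  rw [dy_dx_iterate_comm (isOpen_strip _ _) hg k hx]
  have := iteratedDeriv_horizontal (contDiffOn_dy (isOpen_strip _ _) hg) h0 k x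
  simp only [Complex.ofReal_zero, zero_mul, add_zero] at this
  rw [← this]
  simp [hN]

lemma laplacian_dx_iterate {g F : ℂ → ℝ} {ε R : ℝ} (hε : 0 < ε)
    (hg : ContDiffOn ℝ ∞ g (strip (-ε) R))
    (heq : ∀ z ∈ strip 0 R, dx (dx g) z + dy (dy g) z = F z) (k : ℕ) :
    ∀ z ∈ strip 0 R, dx (dx (dx^[k] g)) z + dy (dy (dx^[k] g)) z = dx^[k] F z := by
  intro z hz
  have hsub : strip 0 R ⊆ strip (-ε) R := fun w hw => ⟨by linarith [hw.1], hw.2⟩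
  have hO := isOpen_strip 0 R
  have hg' := hg.mono hsub
  have hgy := contDiffOn_dy hO hg'
  rw [← dx_iterate_congr hO heq k hz,
    dx_iterate_add hO (contDiffOn_dx hO (contDiffOn_dx hO hg')) (contDiffOn_dy hO hgy) k hz,
    ← Function.iterate_succ_apply' dx, ← Function.iterate_succ_apply' dx,
    Function.iterate_succ_apply, Function.iterate_succ_apply,
    dy_congr hO (dy_dx_iterate_comm hO hg' k) hz, dy_dx_iterate_comm hO hgy k hz]

lemma sum_geometric_le (k : ℕ) {q c : ℝ} (hq : 0 ≤ q) (hq2 : q ≤ 1 / 2) (hc : 0 ≤ c) :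
    ∑ j ∈ Finset.range (k + 1), c * q ^ j ≤ 2 * c := by
  rw [← Finset.mul_sum, mul_comm 2 c]
  refine mul_le_mul_of_nonneg_left ?_ hc
  have := geom_sum_Ico_le_of_lt_one (x := q) (m := 0) (n := k + 1) hq (by linarith)
  rw [← Finset.range_eq_Ico, pow_zero] at this
  refine this.trans ?_
  rw [div_le_iff₀ (by linarith)]
  linarith

/-- `L²` bounds for the tangential derivatives on shrinking strips. -/
lemma energy_dx_iterate_le {g V : ℂ → ℝ} {ε R ℓ lam A R' δ : ℝ} {n : ℕ} (hε : 0 < ε)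
    (hℓ : 0 ≤ ℓ) (hA : 0 ≤ A) (hlam : 0 < lam) (hR'R : R' < R)
    (hg : ContDiffOn ℝ ∞ g (strip (-ε) R)) (hV : ContDiffOn ℝ ∞ V (strip (-ε) R))
    (hper : ∀ z, g (z + ℓ) = g z) (hN : ∀ x : ℝ, dy g x = 0)
    (heq : ∀ z ∈ strip 0 R, dx (dx g) z + dy (dy g) z = V z * g z)
    (hVA : ∀ j (z : ℂ), 0 ≤ z.im → z.im < R →
      |dx^[j] V z| ≤ lam ^ 2 * A ^ (j + 1) * j.factorial)
    (hδ : 0 < δ) (hδl : δ * lam ≤ 1) (hδn : n * δ ≤ 1 / 4) (hδR : 2 * (n + 1) * δ ≤ R' ) :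
    ∀ k ≤ n, ∫ t in (0 : ℝ)..(R' - 2 * (k + 1) * δ),
      slice ℓ (fun z => dx (dx^[k] g) z ^ 2 + dy (dx^[k] g) z ^ 2) t ≤
        mass ℓ g R' * ((1 + 2 * A) / δ) ^ (2 * (k + 1)) := by
  have hopen := isOpen_strip (-ε) R
  have hVg : ContDiffOn ℝ ∞ (fun z => V z * g z) (strip (-ε) R) := hV.mul hg
  have hR : 0 < R := by
    have : 0 < 2 * ((n : ℝ) + 1) * δ := by positivity
    linarith
  have hgk := fun k => (contDiffOn_dx_iterate hopen hg k).continuousOn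
  set P : ℝ := ((1 + 2 * A) / δ) with hP
  have hP0 : 0 ≤ P := by positivity
  have hM0 : 0 ≤ mass ℓ g R' := mass_nonneg hℓ (le_trans (by positivity) hδR) g
  intro k
  induction k using Nat.strong_induction_on with
  | _ k ih =>
  intro hkn
  have hkn' : (k : ℝ) ≤ n := by exact_mod_cast hkn
  have hr : 0 ≤ R' - 2 * (k + 1) * δ := by
    have : 2 * ((k : ℝ) + 1) * δ ≤ 2 * (n + 1) * δ := by gcongr
    linarith
  set r := R' - 2 * (k + 1) * δ with hr_def
  have hr2 : r + 2 * δ = R' - 2 * k * δ := by rw [hr_def]; ring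
  have hr0 : 0 ≤ r + 2 * δ := by positivity
  have hrR : r + 2 * δ < R := by
    rw [hr2]; have : 0 ≤ 2 * (k : ℝ) * δ := by positivity
    linarith
  have hmass : ∀ i ≤ k, mass ℓ (dx^[i] g) (r + 2 * δ) ≤ mass ℓ g R' * P ^ (2 * i) := by
    intro i hi
    have hik : (i : ℝ) ≤ k := by exact_mod_cast hi
    have h1 : r + 2 * δ ≤ R' - 2 * i * δ := by
      rw [hr2]
      have : 2 * (i : ℝ) * δ ≤ 2 * k * δ := by gcongr
      linarith
    have h2 : R' - 2 * i * δ < R := by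
      have : 0 ≤ 2 * (i : ℝ) * δ := by positivity
      linarith
    refine (mass_mono hε hℓ (hgk i) hr0 h1 h2).trans ?_
    cases i with
    | zero => simp
    | succ i =>
      refine le_trans ?_ (ih i (by omega) (by omega))
      have hc := contDiffOn_dx_iterate hopen hg i
      have h3 := h1.trans' hr0
      push_cast at h3 h2 ⊢
      refine integral_slice_mono hε hℓ ((hgk (i + 1)).pow 2)
        (((contDiffOn_dx hopen hc).continuousOn.pow 2).add
          ((contDiffOn_dy hopen hc).continuousOn.pow 2)) h3 h2 fun z _ _ => ?_
      rw [Function.iterate_succ_apply']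
      exact le_add_of_nonneg_right (sq_nonneg _)
  have hforce : ∫ t in (0 : ℝ)..(r + 2 * δ),
      slice ℓ (fun z => (dx^[k] (fun z => V z * g z) z) ^ 2) t ≤
        2 * (2 * lam ^ 4 * A ^ 2 * (mass ℓ g R' * P ^ (2 * k))) := by
    have hgk2 : ∀ j, ContinuousOn (fun z => (dx^[k - j] g z) ^ 2) (strip (-ε) R) :=
      fun j => (hgk (k - j)).pow 2
    have hcs : ContinuousOn (fun z => ∑ j ∈ Finset.range (k + 1),
        (2 * lam ^ 4 * A ^ 2 * (2 * (k * A) ^ 2) ^ j) * (dx^[k - j] g z) ^ 2) (strip (-ε) R) :=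
      continuousOn_finsetSum _ fun j _ => continuousOn_const.mul (hgk2 j)
    refine (integral_slice_mono hε hℓ
      ((contDiffOn_dx_iterate hopen hVg k).continuousOn.pow 2) hcs hr0 hrR
      fun z hz0 hzR => sq_dx_iterate_mul_le hg hV hA hε hVA k z hz0 hzR).trans ?_
    rw [integral_slice_sum _ hε ℓ (fun j _ => hgk2 j) _ hr0 hrR]
    have hkA : k * A ≤ P / 8 := by
      have h1 : k * δ ≤ 1 / 4 := le_trans (by gcongr) hδn
      rw [hP, div_div, le_div_iff₀ (by positivity)]
      nlinarith
    have hkA0 : 0 ≤ k * A := by positivity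
    refine le_trans ?_ (sum_geometric_le k (q := 1 / 2) (by norm_num) le_rfl (by positivity))
    refine Finset.sum_le_sum fun j hj => ?_
    have hjk : j ≤ k := Nat.lt_succ_iff.1 (Finset.mem_range.1 hj)
    calc 2 * lam ^ 4 * A ^ 2 * (2 * (k * A) ^ 2) ^ j * mass ℓ (dx^[k - j] g) (r + 2 * δ)
        ≤ 2 * lam ^ 4 * A ^ 2 * (P ^ 2 * (1 / 2)) ^ j *
          (mass ℓ g R' * P ^ (2 * (k - j))) := by
          refine mul_le_mul (mul_le_mul_of_nonneg_left (pow_le_pow_left₀ (by positivity) ?_ j)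
            (by positivity)) (hmass _ (by omega)) (mass_nonneg hℓ hr0 _) (by positivity)
          nlinarith
      _ = 2 * lam ^ 4 * A ^ 2 * (mass ℓ g R' * (P ^ (2 * j) * P ^ (2 * (k - j)))) *
          (1 / 2) ^ j := by rw [mul_pow, ← pow_mul]; ring
      _ = _ := by rw [← pow_add]; congr 5; omega
  have henergy := energy_estimate hε hℓ (contDiffOn_dx_iterate hopen hg k)
    (contDiffOn_dx_iterate hopen hVg k) (dx_iterate_periodic hper k)
    (dy_dx_iterate_real hε hR hg hN k) (laplacian_dx_iterate hε hg heq k) hr hδ hrR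
  refine henergy.trans ?_
  have h1 := hmass k le_rfl
  have hδ2 : δ ^ 2 * lam ^ 4 ≤ 1 / δ ^ 2 := by
    rw [le_div_iff₀ (by positivity)]
    calc δ ^ 2 * lam ^ 4 * δ ^ 2 = (δ * lam) ^ 4 := by ring
      _ ≤ 1 := pow_le_one₀ (by positivity) hδl
  set X := mass ℓ g R' * P ^ (2 * k) with hX
  have hX0 : 0 ≤ X := by positivity
  calc mass ℓ (dx^[k] g) (r + 2 * δ) / δ ^ 2 + δ ^ 2 * _
      ≤ X / δ ^ 2 + δ ^ 2 * (2 * (2 * lam ^ 4 * A ^ 2 * X)) := by gcongr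
    _ = X / δ ^ 2 + (δ ^ 2 * lam ^ 4) * (4 * A ^ 2 * X) := by ring
    _ ≤ X / δ ^ 2 + (1 / δ ^ 2) * (4 * A ^ 2 * X) := by gcongr
    _ = (1 + 4 * A ^ 2) / δ ^ 2 * X := by ring
    _ ≤ (1 + 2 * A) ^ 2 / δ ^ 2 * X := by gcongr; nlinarith
    _ = mass ℓ g R' * P ^ (2 * (k + 1)) := by rw [hX, hP]; ring

lemma slice_zero_le {w : ℂ → ℝ} {ε R ℓ r : ℝ} (hε : 0 < ε) (hℓ : 0 ≤ ℓ) (hr : 0 < r)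
    (hrR : r < R) (hw : ContDiffOn ℝ ∞ w (strip (-ε) R)) :
    slice ℓ (fun z => w z ^ 2) 0 ≤ mass ℓ w r / r +
      ∫ t in (0 : ℝ)..r, slice ℓ (fun z => w z ^ 2 + dy w z ^ 2) t := by
  have hopen := isOpen_strip (-ε) R
  have hwy := contDiffOn_dy hopen hw
  have hsub : Icc 0 r ⊆ Ioo (-ε) R := fun t ht => ⟨by linarith [ht.1], by linarith [ht.2]⟩
  have hw2 : ContDiffOn ℝ ∞ (fun z => w z ^ 2) (strip (-ε) R) := hw.pow 2
  have hD : ContinuousOn (fun z => w z ^ 2 + dy w z ^ 2) (strip (-ε) R) :=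
    (hw.continuousOn.pow 2).add (hwy.continuousOn.pow 2)
  have hw2y := (contDiffOn_dy hopen hw2).continuousOn
  refine le_average_add_integral (v := slice ℓ (fun z => w z ^ 2))
    (v' := slice ℓ (dy (fun z => w z ^ 2))) hr ⟨le_rfl, hr.le⟩
    (fun t ht => hasDerivAt_slice hw2 ℓ (hsub ht))
    ((continuousOn_slice hw2y ℓ).mono hsub) ((continuousOn_slice hD ℓ).mono hsub) fun t ht => ?_
  have hts := hsub ht
  refine intervalIntegral.abs_integral_le_integral_abs hℓ |>.trans ?_
  refine slice_mono (v := fun z => |dy (fun z => w z ^ 2) z|) hℓ hw2y.abs hD hts fun x => ?_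
  have hd := differentiableAt_of_contDiffOn hopen hw
    (mem_strip_add.2 hts : (x : ℂ) + t * Complex.I ∈ _)
  have h2 : dy (fun z => w z ^ 2) (x + t * Complex.I) =
      2 * (w (x + t * Complex.I) * dy w (x + t * Complex.I)) := by
    simp only [pow_two]
    rw [dy_mul hd hd]
    ring
  rw [h2, abs_le]
  constructor
  · linarith [sq_nonneg (w (x + t * Complex.I) + dy w (x + t * Complex.I)),
      add_sq (w (x + t * Complex.I)) (dy w (x + t * Complex.I))]
  · linarith [sq_nonneg (w (x + t * Complex.I) - dy w (x + t * Complex.I)),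
      sub_sq (w (x + t * Complex.I)) (dy w (x + t * Complex.I))]

lemma sq_le_integral_sq_add {f f' : ℝ → ℝ} {ℓ : ℝ} (hℓ : 0 < ℓ)
    (hf : ∀ x, HasDerivAt f (f' x) x) (hf' : Continuous f') {x : ℝ} (hx : x ∈ Icc 0 ℓ) :
    f x ^ 2 ≤ (∫ t in (0 : ℝ)..ℓ, f t ^ 2) / ℓ + ∫ t in (0 : ℝ)..ℓ, (f t ^ 2 + f' t ^ 2) := by
  have hfc : Continuous f := continuous_iff_continuousAt.2 fun x => (hf x).continuousAt
  refine le_average_add_integral (v := fun t => f t ^ 2) (v' := fun t => 2 * (f t * f' t)) hℓ hx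
    (fun t _ => ?_) (by fun_prop) (by fun_prop) fun t _ => ?_
  · refine ((hf t).pow 2).congr_deriv ?_
    push_cast
    ring
  · rw [abs_le]
    constructor <;> nlinarith [sq_nonneg (f t + f' t), sq_nonneg (f t - f' t)]

lemma pow_le_factorial_mul_exp (m : ℕ) {lam : ℝ} (hlam : 0 ≤ lam) :
    ((m : ℝ) + lam) ^ m ≤ m.factorial * (exp m * exp lam) := by
  rw [← exp_add]
  have h := Real.pow_div_factorial_le_exp ((m : ℝ) + lam) (by positivity) m
  rwa [div_le_iff₀' (by positivity)] at h

/-- Quantitative analyticity of the boundary trace of a solution of `Δ g = V g` with vanishing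
normal derivative. -/
lemma exists_dx_iterate_le {ℓ R R' A : ℝ} (hℓ : 0 < ℓ) (hR' : 0 < R') (hR'1 : R' ≤ 1)
    (hR'R : R' < R) (hA : 0 ≤ A) : ∃ K > 0, ∀ (lam ε : ℝ) (g V : ℂ → ℝ), 0 < lam → 0 < ε →
    ContDiffOn ℝ ∞ g (strip (-ε) R) → ContDiffOn ℝ ∞ V (strip (-ε) R) →
    (∀ z, g (z + ℓ) = g z) → (∀ x : ℝ, dy g x = 0) →
    (∀ z ∈ strip 0 R, dx (dx g) z + dy (dy g) z = V z * g z) →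
    (∀ j (z : ℂ), 0 ≤ z.im → z.im < R →
      |dx^[j] V z| ≤ lam ^ 2 * A ^ (j + 1) * j.factorial) →
    ∀ (n : ℕ) (x : ℝ), |dx^[n] g x| ≤ K ^ (n + 1) * n.factorial * exp lam * √(mass ℓ g R') := by
  set c := (1 / ℓ + 2) * (2 / R' + 2) with hc
  have hc0 : 0 < c := by positivity
  set Q := 4 * (1 + 2 * A) / R' with hQ
  have hQ1 : 1 ≤ Q := by rw [hQ, le_div_iff₀ hR']; linarith
  refine ⟨√c * (4 * (Q * exp 1)) ^ 2 + 4 * (Q * exp 1), by positivity, ?_⟩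
  intro lam ε g V hlam hε hg hV hper hN heq hVA n x
  have hopen := isOpen_strip (-ε) R
  have hR : 0 < R := hR'.trans hR'R
  have hM0 : 0 ≤ mass ℓ g R' := mass_nonneg hℓ.le hR'.le g
  set N : ℝ := (n + 2 : ℕ) + lam with hNdef
  have hNN : N = n + 2 + lam := by rw [hNdef]; push_cast; ring
  have hN0 : 0 < N := by positivity
  set δ := R' / (4 * N) with hδ
  have hδ0 : 0 < δ := by positivity
  have hδN : δ * N = R' / 4 := by rw [hδ]; field_simp
  have hP : (1 + 2 * A) / δ = Q * N := by rw [hδ, hQ]; field_simp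
  have hQN : 1 ≤ Q * N := by nlinarith [Nat.cast_nonneg (α := ℝ) n]
  have hbase := energy_dx_iterate_le (n := n + 1) hε hℓ.le hA hlam hR'R hg hV hper hN heq hVA hδ0
    (by nlinarith [Nat.cast_nonneg (α := ℝ) n])
    (by push_cast; nlinarith [Nat.cast_nonneg (α := ℝ) n])
    (by push_cast; nlinarith [Nat.cast_nonneg (α := ℝ) n])
  rw [hP] at hbase
  set S := mass ℓ g R' * (Q * N) ^ (2 * (n + 2)) with hS
  have hS0 : 0 ≤ S := by positivity
  have hgk := fun k => contDiffOn_dx_iterate hopen hg k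
  have hgrad : ∀ k ≤ n + 1, ∫ t in (0 : ℝ)..R' / 2,
      slice ℓ (fun z => dx (dx^[k] g) z ^ 2 + dy (dx^[k] g) z ^ 2) t ≤ S := by
    intro k hk
    have hk' : (k : ℝ) ≤ n + 1 := by exact_mod_cast hk
    have h1 : R' / 2 ≤ R' - 2 * (k + 1) * δ := by nlinarith
    have h2 : 0 < 2 * ((k : ℝ) + 1) * δ := by positivity
    refine le_trans ?_ ((hbase k hk).trans ?_)
    · refine intervalIntegral.integral_mono_interval le_rfl (by linarith) h1
        (ae_of_all _ fun t => slice_nonneg hℓ.le (fun _ => by positivity) t)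
        (intervalIntegrable_slice hε ℓ (((contDiffOn_dx hopen (hgk k)).continuousOn.pow 2).add
          ((contDiffOn_dy hopen (hgk k)).continuousOn.pow 2)) (by linarith) (by linarith))
    · rw [hS]
      exact mul_le_mul_of_nonneg_left (pow_le_pow_right₀ hQN (by omega)) hM0
  have hmass : ∀ k ≤ n + 1, mass ℓ (dx^[k] g) (R' / 2) ≤ S := by
    intro k hk
    cases k with
    | zero =>
      refine (mass_mono hε hℓ.le hg.continuousOn (by linarith) (by linarith) hR'R).trans ?_
      exact le_mul_of_one_le_right hM0 (one_le_pow₀ hQN)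
    | succ k =>
      refine le_trans ?_ (hgrad k (by omega))
      have hgk' := (contDiffOn_dx hopen (hgk k)).continuousOn.pow 2
      refine integral_slice_mono hε hℓ.le ((hgk (k + 1)).continuousOn.pow 2)
        (hgk'.add ((contDiffOn_dy hopen (hgk k)).continuousOn.pow 2)) (by linarith) (by linarith)
        fun z _ _ => ?_
      rw [Function.iterate_succ_apply']
      exact le_add_of_nonneg_right (sq_nonneg _)
  have htrace : ∀ k ≤ n + 1, slice ℓ (fun z => (dx^[k] g z) ^ 2) 0 ≤ (2 / R' + 2) * S := by
    intro k hk
    refine (slice_zero_le hε hℓ.le (by linarith : 0 < R' / 2) (by linarith) (hgk k)).trans ?_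
    have h1 : ∫ t in (0 : ℝ)..R' / 2, slice ℓ (fun z => dx^[k] g z ^ 2 + dy (dx^[k] g) z ^ 2) t ≤
        S + S := by
      have hi1 : ContinuousOn (fun z => dx^[k] g z ^ 2) (strip (-ε) R) :=
        (hgk k).continuousOn.pow 2
      have hi2 : ContinuousOn (fun z => dy (dx^[k] g) z ^ 2) (strip (-ε) R) :=
        (contDiffOn_dy hopen (hgk k)).continuousOn.pow 2
      have hi3 : ContinuousOn (fun z => dx (dx^[k] g) z ^ 2 + dy (dx^[k] g) z ^ 2)
          (strip (-ε) R) := ((contDiffOn_dx hopen (hgk k)).continuousOn.pow 2).add hi2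
      have h2 : ∀ t ∈ uIcc 0 (R' / 2),
          slice ℓ (fun z => dx^[k] g z ^ 2 + dy (dx^[k] g) z ^ 2) t =
            slice ℓ (fun z => dx^[k] g z ^ 2) t + slice ℓ (fun z => dy (dx^[k] g) z ^ 2) t := by
        intro t ht
        rw [uIcc_of_le (by linarith)] at ht
        exact slice_add ℓ hi1 hi2 ⟨by linarith [ht.1], by linarith [ht.2]⟩
      rw [intervalIntegral.integral_congr h2, intervalIntegral.integral_add
        (intervalIntegrable_slice hε ℓ hi1 (by linarith) (by linarith))
        (intervalIntegrable_slice hε ℓ hi2 (by linarith) (by linarith))]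
      refine add_le_add (hmass k hk) (le_trans ?_ (hgrad k hk))
      exact integral_slice_mono hε hℓ.le hi2 hi3 (by linarith) (by linarith)
        fun z _ _ => le_add_of_nonneg_left (sq_nonneg _)
    have h3 : mass ℓ (dx^[k] g) (R' / 2) / (R' / 2) ≤ S / (R' / 2) := by
      gcongr; exact hmass k hk
    calc _ ≤ S / (R' / 2) + (S + S) := add_le_add h3 h1
      _ = _ := by field_simp; ring
  have h0 : -ε < (0 : ℝ) ∧ (0 : ℝ) < R := ⟨by linarith, hR⟩
  have hmain : ∀ y ∈ Icc 0 ℓ, dx^[n] g (y : ℂ) ^ 2 ≤ c * S := by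
    intro y hy
    have hcont := continuous_horizontal (hgk (n + 1)).continuousOn h0
    simp only [Complex.ofReal_zero, zero_mul, add_zero] at hcont
    have h1 := sq_le_integral_sq_add (f := fun t : ℝ => dx^[n] g t)
      (f' := fun t : ℝ => dx^[n + 1] g t) hℓ (fun t => ?_) hcont hy
    · refine h1.trans ?_
      have t1 := htrace n (by omega)
      have t2 := htrace (n + 1) le_rfl
      simp only [slice, Complex.ofReal_zero, zero_mul, add_zero] at t1 t2
      have hcont' := continuous_horizontal (hgk n).continuousOn h0
      simp only [Complex.ofReal_zero, zero_mul, add_zero] at hcont'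
      have i1 : IntervalIntegrable (fun t : ℝ => dx^[n] g t ^ 2) volume 0 ℓ :=
        (hcont'.pow 2).intervalIntegrable _ _
      have i2 : IntervalIntegrable (fun t : ℝ => dx^[n + 1] g t ^ 2) volume 0 ℓ :=
        (hcont.pow 2).intervalIntegrable _ _
      rw [intervalIntegral.integral_add i1 i2]
      calc _ ≤ ((2 / R' + 2) * S) / ℓ + ((2 / R' + 2) * S + (2 / R' + 2) * S) := by gcongr
        _ = c * S := by rw [hc]; field_simp; ring
    · have := hasDerivAt_comp_horizontal (f := dx^[n] g) (x := t) (y := 0)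
        (differentiableAt_of_contDiffOn hopen (hgk n) (mem_strip_add.2 h0))
      simp only [Complex.ofReal_zero, zero_mul, add_zero] at this
      rwa [Function.iterate_succ_apply']
  have hsq : dx^[n] g (x : ℂ) ^ 2 ≤ c * S := by
    have hp : Function.Periodic (fun t : ℝ => dx^[n] g (t : ℂ)) ℓ := fun t => by
      have := dx_iterate_periodic hper n (t : ℂ)
      simpa using this
    obtain ⟨y, hy, hxy⟩ := hp.exists_mem_Ico₀ hℓ x
    exact (congrArg (· ^ 2) hxy).trans_le (hmain y (Ico_subset_Icc_self hy))
  have hsqrt : |dx^[n] g (x : ℂ)| ≤ √c * ((Q * N) ^ (n + 2) * √(mass ℓ g R')) := by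
    refine abs_le_of_sq_le_sq ?_ (by positivity)
    rw [mul_pow, mul_pow, sq_sqrt hc0.le, sq_sqrt hM0]
    refine hsq.trans (le_of_eq ?_)
    rw [hS]; ring
  refine hsqrt.trans ?_
  have hfac : ((n + 2).factorial : ℝ) ≤ 4 ^ (n + 2) * n.factorial := by
    have h1 : (n + 2).factorial ≤ 4 ^ (n + 2) * n.factorial := by
      rw [Nat.factorial_succ, Nat.factorial_succ, ← mul_assoc]
      refine Nat.mul_le_mul_right _ ?_
      calc (n + 1 + 1) * (n + 1) ≤ 2 ^ (n + 2) * 2 ^ (n + 2) :=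
            Nat.mul_le_mul (Nat.lt_two_pow_self).le
              ((Nat.le_succ _).trans (Nat.lt_two_pow_self (n := n + 2)).le)
        _ = 4 ^ (n + 2) := by rw [← mul_pow]; norm_num
    exact_mod_cast h1
  have hpow : N ^ (n + 2) ≤ 4 ^ (n + 2) * n.factorial * (exp 1 ^ (n + 2) * exp lam) := by
    refine (pow_le_factorial_mul_exp (n + 2) hlam.le).trans ?_
    rw [← exp_nat_mul 1 (n + 2), mul_one]
    gcongr
  have hK : √c * (4 * (Q * exp 1)) ^ (n + 2) ≤
      (√c * (4 * (Q * exp 1)) ^ 2 + 4 * (Q * exp 1)) ^ (n + 1) := by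
    set a := 4 * (Q * exp 1)
    have ha : 0 ≤ a := by positivity
    have hexp : 1 ≤ exp 1 := one_le_exp zero_le_one
    have ha1 : 1 ≤ a := by
      have : 1 ≤ Q * exp 1 := one_le_mul_of_one_le_of_one_le hQ1 hexp
      linarith
    calc √c * a ^ (n + 2) = (√c * a ^ 2) * a ^ n := by ring
      _ ≤ (√c * a ^ 2 + a) * (√c * a ^ 2 + a) ^ n := by
        gcongr
        · linarith
        · exact le_add_of_nonneg_left (by positivity)
      _ = _ := by ring
  calc √c * ((Q * N) ^ (n + 2) * √(mass ℓ g R'))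
      = √c * Q ^ (n + 2) * N ^ (n + 2) * √(mass ℓ g R') := by rw [mul_pow]; ring
    _ ≤ √c * Q ^ (n + 2) * (4 ^ (n + 2) * n.factorial * (exp 1 ^ (n + 2) * exp lam)) *
        √(mass ℓ g R') := by gcongr
    _ = √c * (4 * (Q * exp 1)) ^ (n + 2) * n.factorial * exp lam * √(mass ℓ g R') := by
      rw [mul_pow, mul_pow]; ring
    _ ≤ _ := by gcongr

/-- The Taylor series of `v : ℝ → ℂ` at `x`, evaluated at a complex point. -/
def taylorC (v : ℝ → ℂ) (x : ℝ) (w : ℂ) : ℂ :=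
  ∑' n : ℕ, iteratedDeriv n v x / n.factorial * (w - x) ^ n

lemma norm_taylorC_term_le {v : ℝ → ℂ} {C K : ℝ}
    (hb : ∀ (n : ℕ) (x : ℝ), ‖iteratedDeriv n v x‖ ≤ C * K ^ n * n.factorial) (n : ℕ) (x : ℝ)
    {w : ℂ} {r : ℝ} (hw : ‖w - x‖ ≤ r) :
    ‖iteratedDeriv n v x / n.factorial * (w - x) ^ n‖ ≤ |C| * (|K| * r) ^ n := by
  have hr : 0 ≤ r := (norm_nonneg _).trans hw
  have h1 : ‖iteratedDeriv n v x / (n.factorial : ℂ)‖ ≤ |C| * |K| ^ n := by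
    rw [norm_div, Complex.norm_natCast, div_le_iff₀ (by positivity)]
    refine (hb n x).trans (mul_le_mul_of_nonneg_right ?_ (by positivity))
    rw [← abs_pow, ← abs_mul]
    exact le_abs_self _
  rw [norm_mul, norm_pow]
  calc _ ≤ |C| * |K| ^ n * r ^ n := by gcongr
    _ = _ := by rw [mul_pow]; ring

lemma summable_taylorC_bound {C K r : ℝ} (hK : 0 < K) (hr : 0 ≤ r) (hr1 : r < 1 / K) :
    Summable fun n : ℕ => |C| * (|K| * r) ^ n := by
  rw [lt_div_iff₀ hK] at hr1
  refine (summable_geometric_of_lt_one (by positivity) ?_).mul_left _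
  rwa [abs_of_pos hK, mul_comm]

lemma differentiableOn_taylorC {v : ℝ → ℂ} {C K : ℝ} (hK : 0 < K)
    (hb : ∀ (n : ℕ) (x : ℝ), ‖iteratedDeriv n v x‖ ≤ C * K ^ n * n.factorial) (x : ℝ) :
    DifferentiableOn ℂ (taylorC v x) (Metric.ball (x : ℂ) (1 / K)) := by
  intro w hw
  obtain ⟨r, hwr, hr⟩ := exists_between (Metric.mem_ball.1 hw)
  have hr0 : 0 ≤ r := dist_nonneg.trans hwr.le
  have := Complex.differentiableOn_tsum_of_summable_norm (U := Metric.ball (x : ℂ) r)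
    (F := fun (n : ℕ) (w : ℂ) => iteratedDeriv n v x / n.factorial * (w - x) ^ n)
    (summable_taylorC_bound (C := C) hK hr0 hr) (fun n => by fun_prop) Metric.isOpen_ball
    fun n w hw => norm_taylorC_term_le hb n x (by
      rw [← Complex.dist_eq]; exact (Metric.mem_ball.1 hw).le)
  exact (this.differentiableAt (Metric.isOpen_ball.mem_nhds hwr)).differentiableWithinAt

lemma taylorC_eq_of_le {v : ℝ → ℂ} (hv : ContDiff ℝ ∞ v) {C K : ℝ} (hK : 0 < K)
    (hb : ∀ (n : ℕ) (x : ℝ), ‖iteratedDeriv n v x‖ ≤ C * K ^ n * n.factorial) {x t : ℝ}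
    (hxt : x ≤ t) (ht : t < x + 1 / K) : taylorC v x t = v t := by
  have hr1 : t - x < 1 / K := by linarith
  have hr1' : K * (t - x) < 1 := by rwa [lt_div_iff₀ hK, mul_comm] at hr1
  have hsum : HasSum (fun n : ℕ => iteratedDeriv n v x / n.factorial * ((t : ℂ) - x) ^ n)
      (taylorC v x t) := by
    refine Summable.hasSum (Summable.of_norm_bounded
      (summable_taylorC_bound (C := C) hK (sub_nonneg.2 hxt) hr1) fun n =>
      norm_taylorC_term_le hb n x ?_)
    rw [← Complex.ofReal_sub, Complex.norm_real, Real.norm_of_nonneg (sub_nonneg.2 hxt)]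
  rcases hxt.eq_or_lt with rfl | hlt
  · unfold taylorC
    rw [tsum_eq_single 0]
    · simp
    · intro n hn; simp [hn]
  refine tendsto_nhds_unique (hsum.tendsto_sum_nat.comp (tendsto_add_atTop_nat 1)) ?_
  rw [tendsto_iff_norm_sub_tendsto_zero]
  have hid : ∀ (n : ℕ), ∀ y ∈ Icc x t, iteratedDerivWithin n v (Icc x t) y = iteratedDeriv n v y :=
    fun n y hy => iteratedDerivWithin_eq_iteratedDeriv (uniqueDiffOn_Icc hlt)
      (hv.contDiffAt.of_le (by exact_mod_cast le_top)) hy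
  have hbound : ∀ n : ℕ, ‖∑ i ∈ Finset.range (n + 1),
      iteratedDeriv i v x / i.factorial * ((t : ℂ) - x) ^ i - v t‖ ≤
        C * ((n + 1 : ℕ) * (K * (t - x)) ^ (n + 1)) := by
    intro n
    have h := taylor_mean_remainder_bound (n := n) hlt.le
      ((hv.of_le (by exact_mod_cast le_top)).contDiffOn) (right_mem_Icc.2 hlt.le)
      (C := C * K ^ (n + 1) * (n + 1).factorial)
      fun y hy => by rw [hid _ y hy]; exact hb _ _
    rw [taylor_within_apply, norm_sub_rev] at h
    have e : ∑ k ∈ Finset.range (n + 1), (((k.factorial : ℝ))⁻¹ * (t - x) ^ k) •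
        iteratedDerivWithin k v (Icc x t) x =
        ∑ i ∈ Finset.range (n + 1), iteratedDeriv i v x / i.factorial * ((t : ℂ) - x) ^ i := by
      refine Finset.sum_congr rfl fun k _ => ?_
      rw [hid k x (left_mem_Icc.2 hlt.le), Complex.real_smul]
      push_cast
      ring
    rw [e] at h
    refine h.trans (le_of_eq ?_)
    rw [Nat.factorial_succ, mul_pow]
    push_cast
    field_simp
  refine squeeze_zero (fun _ => norm_nonneg _) hbound ?_
  have h0 := (tendsto_self_mul_const_pow_of_lt_one (by nlinarith) hr1').comp
    (tendsto_add_atTop_nat 1)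
  simpa using h0.const_mul C

lemma taylorC_eqOn {v : ℝ → ℂ} (hv : ContDiff ℝ ∞ v) {C K : ℝ} (hK : 0 < K)
    (hb : ∀ (n : ℕ) (x : ℝ), ‖iteratedDeriv n v x‖ ≤ C * K ^ n * n.factorial) {x y : ℝ}
    (hxy : x ≤ y) (hy : y < x + 1 / K) :
    EqOn (taylorC v x) (taylorC v y)
      (Metric.ball (x : ℂ) (1 / K) ∩ Metric.ball (y : ℂ) (1 / K)) := by
  have hO : IsOpen (Metric.ball (x : ℂ) (1 / K) ∩ Metric.ball (y : ℂ) (1 / K)) :=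
    Metric.isOpen_ball.inter Metric.isOpen_ball
  have hpre := ((convex_ball (x : ℂ) (1 / K)).inter (convex_ball (y : ℂ) (1 / K))).isPreconnected
  refine AnalyticOnNhd.eqOn_of_preconnected_of_frequently_eq (z₀ := (y : ℂ))
    (((differentiableOn_taylorC hK hb x).mono inter_subset_left).analyticOnNhd hO)
    (((differentiableOn_taylorC hK hb y).mono inter_subset_right).analyticOnNhd hO) hpre ?_ ?_
  · refine ⟨?_, Metric.mem_ball_self (by positivity)⟩
    rw [Metric.mem_ball, Complex.dist_eq, ← Complex.ofReal_sub, Complex.norm_real,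
      Real.norm_of_nonneg (sub_nonneg.2 hxy)]
    linarith
  · have ht : Tendsto (fun t : ℝ => (t : ℂ)) (𝓝[>] y) (𝓝[≠] (y : ℂ)) := by
      refine tendsto_nhdsWithin_iff.2 ⟨?_, ?_⟩
      · exact (Complex.continuous_ofReal.tendsto y).mono_left nhdsWithin_le_nhds
      · filter_upwards [self_mem_nhdsWithin] with t ht
        simpa using (mem_Ioi.1 ht).ne'
    refine ht.frequently (Eventually.frequently ?_)
    have : Ioo y (x + 1 / K) ∈ 𝓝[>] y := Ioo_mem_nhdsGT hy
    filter_upwards [this] with t ht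
    rw [taylorC_eq_of_le hv hK hb (hxy.trans ht.1.le) ht.2,
      taylorC_eq_of_le hv hK hb ht.1.le (by linarith [ht.2])]

/-- Holomorphic extension to a strip of a function with uniformly analytic bounds. -/
lemma exists_holomorphic_extension {v : ℝ → ℂ} (hv : ContDiff ℝ ∞ v) {C K : ℝ} (hK : 0 < K)
    (hb : ∀ (n : ℕ) (x : ℝ), ‖iteratedDeriv n v x‖ ≤ C * K ^ n * n.factorial) :
    ∃ h : ℂ → ℂ, DifferentiableOn ℂ h (strip (-(1 / K)) (1 / K)) ∧ (∀ x : ℝ, h x = v x) ∧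
      (∀ w : ℂ, |w.im| ≤ 1 / (2 * K) → ‖h w‖ ≤ 2 * C) ∧
      ∀ ℓ : ℝ, Function.Periodic v ℓ → ∀ w, h (w + ℓ) = h w := by
  have hsub : ∀ w : ℂ, w - w.re = w.im * Complex.I := fun w => by
    nth_rewrite 1 [← Complex.re_add_im w]; ring
  have hnorm : ∀ w : ℂ, ‖w - w.re‖ = |w.im| := fun w => by rw [hsub]; simp
  have hC : 0 ≤ C := by simpa using (norm_nonneg _).trans (hb 0 0)
  refine ⟨fun w => taylorC v w.re w, ?_, ?_, ?_, ?_⟩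
  · intro w hw
    have hwim : |w.im| < 1 / K := abs_lt.2 hw
    have hwball : w ∈ Metric.ball (w.re : ℂ) (1 / K) := by
      rwa [Metric.mem_ball, Complex.dist_eq, hnorm]
    have hev : (fun z : ℂ => taylorC v z.re z) =ᶠ[𝓝 w] taylorC v w.re := by
      have e1 : ∀ᶠ z in 𝓝 w, |z.re - w.re| < 1 / K := by
        have : Tendsto (fun z : ℂ => |z.re - w.re|) (𝓝 w) (𝓝 |w.re - w.re|) :=
          Continuous.tendsto (by fun_prop) w
        rw [sub_self, abs_zero] at this
        exact this.eventually (gt_mem_nhds (by positivity))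
      have e2 : ∀ᶠ z in 𝓝 w, |z.im| < 1 / K :=
        (Continuous.tendsto (by fun_prop : Continuous fun z : ℂ => |z.im|) w).eventually
          (gt_mem_nhds hwim)
      filter_upwards [e1, e2, Metric.isOpen_ball.mem_nhds hwball] with z h1 h2 h3
      have h4 : z ∈ Metric.ball (z.re : ℂ) (1 / K) := by
        rwa [Metric.mem_ball, Complex.dist_eq, hnorm]
      rw [abs_lt] at h1
      rcases le_total z.re w.re with h | h
      · exact taylorC_eqOn hv hK hb h (by linarith) ⟨h4, h3⟩
      · exact (taylorC_eqOn hv hK hb h (by linarith) ⟨h3, h4⟩).symm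
    exact (((differentiableOn_taylorC hK hb w.re).differentiableAt
      (Metric.isOpen_ball.mem_nhds hwball)).congr_of_eventuallyEq hev).differentiableWithinAt
  · intro x
    exact taylorC_eq_of_le hv hK hb le_rfl (by simpa using hK)
  · intro w hw
    have hKw : |K| * |w.im| ≤ 1 / 2 := by
      rw [abs_of_pos hK]
      calc K * |w.im| ≤ K * (1 / (2 * K)) := by gcongr
        _ = 1 / 2 := by field_simp
    have h := tsum_of_norm_bounded
      (f := fun n : ℕ => iteratedDeriv n v w.re / n.factorial * (w - w.re) ^ n)
      (g := fun n : ℕ => |C| * (1 / 2 : ℝ) ^ n) (hasSum_geometric_two.mul_left |C|) fun n =>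
        (norm_taylorC_term_le hb n w.re (hnorm w).le).trans (by gcongr)
    rw [abs_of_nonneg hC] at h
    rw [mul_comm]
    exact h
  · intro ℓ hp w
    have hpn : ∀ (n : ℕ) (x : ℝ), iteratedDeriv n v (x + ℓ) = iteratedDeriv n v x := by
      intro n x
      have := congrFun (iteratedDeriv_comp_add_const n v ℓ) x
      rw [← this, show (fun z => v (z + ℓ)) = v from funext hp]
    unfold taylorC
    refine tsum_congr fun n => ?_
    rw [Complex.add_re, Complex.ofReal_re, hpn]
    push_cast
    ring_nf

/-- A conformal map of the strip `|im w| < r` onto the unit disc. -/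
def stripToDisc (r : ℝ) (w : ℂ) : ℂ :=
  (Complex.exp (π / (2 * r) * w) - 1) / (Complex.exp (π / (2 * r) * w) + 1)

/-- The inverse of `stripToDisc`. -/
def discToStrip (r : ℝ) (z : ℂ) : ℂ := 2 * r / π * Complex.log ((1 + z) / (1 - z))

lemma re_mobius_pos {z : ℂ} (hz : ‖z‖ < 1) : 0 < ((1 + z) / (1 - z)).re := by
  have h1 : 1 - z ≠ 0 := by
    rintro h
    rw [sub_eq_zero] at h
    simp [← h] at hz
  have h2 : 0 < Complex.normSq (1 - z) := Complex.normSq_pos.2 h1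
  have h3 : Complex.normSq z < 1 := by
    rw [Complex.normSq_eq_norm_sq]
    exact pow_lt_one₀ (norm_nonneg _) hz two_ne_zero
  rw [Complex.div_re, ← add_div]
  refine div_pos ?_ h2
  rw [Complex.normSq_apply] at h3
  simp
  nlinarith

lemma discToStrip_mem {r : ℝ} (hr : 0 < r) {z : ℂ} (hz : ‖z‖ < 1) :
    discToStrip r z ∈ strip (-r) r := by
  have h := Complex.abs_arg_lt_pi_div_two_iff.2 (Or.inl (re_mobius_pos hz))
  have e : (discToStrip r z).im = 2 * r / π * Complex.arg ((1 + z) / (1 - z)) := by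
    have : discToStrip r z = ((2 * r / π : ℝ) : ℂ) * Complex.log ((1 + z) / (1 - z)) := by
      simp [discToStrip]
    rw [this, Complex.im_ofReal_mul, Complex.log_im]
  have h2 : |(discToStrip r z).im| < r := by
    rw [e, abs_mul, abs_of_pos (by positivity)]
    calc _ < 2 * r / π * (π / 2) := by gcongr
      _ = r := by field_simp
  exact abs_lt.1 h2

lemma differentiableOn_discToStrip (r : ℝ) :
    DifferentiableOn ℂ (discToStrip r) (Metric.ball 0 1) := by
  intro z hz
  have hz1 : ‖z‖ < 1 := by simpa using hz
  have h1 : 1 - z ≠ 0 := by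
    rintro h
    rw [sub_eq_zero] at h
    simp [← h] at hz1
  refine DifferentiableAt.differentiableWithinAt ?_
  have hd : DifferentiableAt ℂ (fun z : ℂ => (1 + z) / (1 - z)) z :=
    DifferentiableAt.div (by fun_prop) (by fun_prop) h1
  exact (hd.clog (Or.inl (re_mobius_pos hz1))).const_mul _

lemma re_exp_pos_of_mem_strip {r : ℝ} (hr : 0 < r) {w : ℂ} (hw : w ∈ strip (-r) r) :
    0 < (Complex.exp (π / (2 * r) * w)).re ∧
      |(π / (2 * r) * w : ℂ).im| < π / 2 := by
  have e : (π / (2 * r) * w : ℂ).im = π / (2 * r) * w.im := by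
    have : (π / (2 * r) * w : ℂ) = ((π / (2 * r) : ℝ) : ℂ) * w := by simp
    rw [this, Complex.im_ofReal_mul]
  have h2 : |(π / (2 * r) * w : ℂ).im| < π / 2 := by
    rw [e, abs_mul, abs_of_pos (by positivity)]
    calc _ < π / (2 * r) * r := by gcongr; exact abs_lt.2 hw
      _ = π / 2 := by field_simp
  refine ⟨?_, h2⟩
  rw [Complex.exp_re]
  exact mul_pos (exp_pos _) (cos_pos_of_mem_Ioo (abs_lt.1 h2))

lemma exp_add_one_ne_zero {u : ℂ} (h : 0 < (Complex.exp u).re) : Complex.exp u + 1 ≠ 0 := by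
  intro h0
  have := congrArg Complex.re h0
  simp only [Complex.add_re, Complex.one_re, Complex.zero_re] at this
  linarith

lemma norm_stripToDisc_lt {r : ℝ} (hr : 0 < r) {w : ℂ} (hw : w ∈ strip (-r) r) :
    ‖stripToDisc r w‖ < 1 := by
  have h := (re_exp_pos_of_mem_strip hr hw).1
  have h1 := exp_add_one_ne_zero h
  unfold stripToDisc
  rw [norm_div, div_lt_one (norm_pos_iff.2 h1)]
  refine lt_of_pow_lt_pow_left₀ 2 (norm_nonneg _) ?_
  rw [← Complex.normSq_eq_norm_sq, ← Complex.normSq_eq_norm_sq, Complex.normSq_apply,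
    Complex.normSq_apply]
  simp only [Complex.add_re, Complex.sub_re, Complex.one_re, Complex.add_im, Complex.sub_im,
    Complex.one_im]
  nlinarith

lemma discToStrip_stripToDisc {r : ℝ} (hr : 0 < r) {w : ℂ} (hw : w ∈ strip (-r) r) :
    discToStrip r (stripToDisc r w) = w := by
  obtain ⟨h, him⟩ := re_exp_pos_of_mem_strip hr hw
  have h1 := exp_add_one_ne_zero h
  have e : (1 + stripToDisc r w) / (1 - stripToDisc r w) = Complex.exp (π / (2 * r) * w) := by
    unfold stripToDisc
    generalize Complex.exp (π / (2 * r) * w) = a at h1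
    have h2 : 1 - (a - 1) / (a + 1) = 2 / (a + 1) := by field_simp; ring
    rw [h2]
    field_simp
    ring
  rw [abs_lt] at him
  have hr' : (r : ℂ) ≠ 0 := by exact_mod_cast hr.ne'
  have hpi : (π : ℂ) ≠ 0 := by exact_mod_cast pi_ne_zero
  rw [discToStrip, e, Complex.log_exp (by linarith [pi_pos]) (by linarith [pi_pos])]
  field_simp

lemma differentiableOn_stripToDisc {r : ℝ} (hr : 0 < r) :
    DifferentiableOn ℂ (stripToDisc r) (strip (-r) r) := by
  intro w hw
  have h1 := exp_add_one_ne_zero (re_exp_pos_of_mem_strip hr hw).1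
  refine DifferentiableAt.differentiableWithinAt ?_
  unfold stripToDisc
  exact DifferentiableAt.div (by fun_prop) (by fun_prop) h1

lemma norm_stripToDisc_ofReal_le {r U : ℝ} (hr : 0 < r) {x : ℝ} (hx : |x| ≤ U) :
    ‖stripToDisc r x‖ ≤ (exp (π / (2 * r) * U) - 1) / (exp (π / (2 * r) * U) + 1) := by
  have e : stripToDisc r x =
      (((exp (π / (2 * r) * x) - 1) / (exp (π / (2 * r) * x) + 1) : ℝ) : ℂ) := by
    simp [stripToDisc]
  rw [e, Complex.norm_real, Real.norm_eq_abs, abs_le]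
  rw [abs_le] at hx
  have hc : 0 < π / (2 * r) := by positivity
  have h1 : exp (π / (2 * r) * x) ≤ exp (π / (2 * r) * U) := by gcongr; exact hx.2
  have h2 : 1 ≤ exp (π / (2 * r) * x) * exp (π / (2 * r) * U) := by
    rw [← exp_add, one_le_exp_iff, ← mul_add]
    exact mul_nonneg hc.le (by linarith)
  have p1 := exp_pos (π / (2 * r) * x)
  have p2 := exp_pos (π / (2 * r) * U)
  constructor
  · rw [← neg_div, div_le_div_iff₀ (by linarith) (by linarith)]
    nlinarith
  · rw [div_le_div_iff₀ (by linarith) (by linarith)]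
    nlinarith

/-- Dividing out a zero by the conformal map of the strip. -/
lemma exists_factor {h : ℂ → ℂ} {r M : ℝ} (hr : 0 < r)
    (hh : DifferentiableOn ℂ h (strip (-r) r)) (hM : ∀ w ∈ strip (-r) r, ‖h w‖ ≤ M) {s : ℝ}
    (hs : h s = 0) : ∃ h₁ : ℂ → ℂ, DifferentiableOn ℂ h₁ (strip (-r) r) ∧
      (∀ w ∈ strip (-r) r, ‖h₁ w‖ ≤ M) ∧
      ∀ w ∈ strip (-r) r, h w = stripToDisc r (w - s) * h₁ w := by
  have hshift : ∀ w ∈ strip (-r) r, w - s ∈ strip (-r) r := fun w hw => by simpa [strip] using hw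
  have hshift' : ∀ w ∈ strip (-r) r, s + w ∈ strip (-r) r := fun w hw => by simpa [strip] using hw
  set H : ℂ → ℂ := fun z => h (s + discToStrip r z) with hH
  have hH0 : H 0 = 0 := by simp [hH, discToStrip, hs]
  have hmem : ∀ z ∈ Metric.ball (0 : ℂ) 1, s + discToStrip r z ∈ strip (-r) r := fun z hz =>
    hshift' _ (discToStrip_mem hr (by simpa using hz))
  have hHd : DifferentiableOn ℂ H (Metric.ball 0 1) :=
    hh.comp ((differentiableOn_const _).add (differentiableOn_discToStrip r)) hmem
  have hds : DifferentiableOn ℂ (dslope H 0) (Metric.ball 0 1) :=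
    (Complex.differentiableOn_dslope (Metric.ball_mem_nhds _ one_pos)).2 hHd
  have hball : ∀ w ∈ strip (-r) r, stripToDisc r (w - s) ∈ Metric.ball (0 : ℂ) 1 := fun w hw => by
    simpa using norm_stripToDisc_lt hr (hshift w hw)
  refine ⟨fun w => dslope H 0 (stripToDisc r (w - s)), ?_, ?_, ?_⟩
  · exact hds.comp ((differentiableOn_stripToDisc hr).comp (by fun_prop) hshift) hball
  · intro w hw
    have := Complex.norm_dslope_le_div_of_mapsTo_ball (R₂ := M) hHd (fun z hz => by
      rw [hH0, mem_closedBall_zero_iff]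
      exact hM _ (hmem z hz)) (hball w hw)
    simpa using this
  · intro w hw
    have h1 : H (stripToDisc r (w - s)) = h w := by
      simp only [hH]
      rw [discToStrip_stripToDisc hr (hshift w hw)]
      congr 1
      ring
    have h2 := sub_smul_dslope H 0 (stripToDisc r (w - s))
    rw [hH0, sub_zero, sub_zero, smul_eq_mul, h1] at h2
    exact h2.symm

lemma norm_le_of_zeros {ℓ r M : ℝ} (hr : 0 < r) (S : Finset ℝ) (hS : ∀ s ∈ S, s ∈ Icc 0 ℓ)
    {h : ℂ → ℂ} (hh : DifferentiableOn ℂ h (strip (-r) r))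
    (hM : ∀ w ∈ strip (-r) r, ‖h w‖ ≤ M) (hz : ∀ s ∈ S, h (s : ℂ) = 0) {x : ℝ}
    (hx : x ∈ Icc 0 ℓ) :
    ‖h x‖ ≤ M * ((exp (π / (2 * r) * ℓ) - 1) / (exp (π / (2 * r) * ℓ) + 1)) ^ S.card := by
  have hreal : ∀ t : ℝ, (t : ℂ) ∈ strip (-r) r := fun t => by simp [strip, hr]
  induction S using Finset.induction_on generalizing h with
  | empty => simpa using hM _ (hreal x)
  | insert s S hsS ih =>
    obtain ⟨h₁, hd, hb, hf⟩ := exists_factor hr hh hM (hz s (Finset.mem_insert_self _ _))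
    have h1 := ih (fun t ht => hS t (Finset.mem_insert_of_mem ht)) hd hb fun t ht => by
      have h2 := hz t (Finset.mem_insert_of_mem ht)
      rw [hf _ (hreal t), mul_eq_zero] at h2
      refine h2.resolve_left fun h3 => hsS ?_
      have h4 : ((t - s : ℝ) : ℂ) ∈ strip (-r) r := hreal _
      have h5 := discToStrip_stripToDisc hr h4
      rw [Complex.ofReal_sub, h3] at h5
      have : (t : ℂ) = s := by
        rw [← sub_eq_zero, ← h5]; simp [discToStrip]
      rwa [← Complex.ofReal_inj.1 this]
    have hs := hS s (Finset.mem_insert_self _ _)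
    rw [hf _ (hreal x), norm_mul, Finset.card_insert_of_notMem hsS, pow_succ', ← Complex.ofReal_sub]
    have h3 := norm_stripToDisc_ofReal_le hr (U := ℓ) (x := x - s)
      (abs_le.2 ⟨by linarith [hx.1, hs.2], by linarith [hx.2, hs.1]⟩)
    calc _ ≤ _ := mul_le_mul h3 h1 (norm_nonneg _) ((norm_nonneg _).trans h3)
      _ = _ := by ring

/-- Jensen-type bound for the number of zeros on a segment of a bounded holomorphic function
on a strip. -/
lemma exists_ncard_zeros_le {ℓ r : ℝ} (hℓ : 0 < ℓ) (hr : 0 < r) : ∃ κ > 0, ∀ (h : ℂ → ℂ) (M : ℝ),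
    DifferentiableOn ℂ h (strip (-r) r) → (∀ w ∈ strip (-r) r, ‖h w‖ ≤ M) →
    ∀ x ∈ Icc 0 ℓ, h (x : ℂ) ≠ 0 →
      {s ∈ Ico 0 ℓ | h ((s : ℝ) : ℂ) = 0}.Finite ∧
      κ * ({s ∈ Ico 0 ℓ | h ((s : ℝ) : ℂ) = 0}.ncard : ℝ) ≤ log (M / ‖h x‖) := by
  set E := exp (π / (2 * r) * ℓ) with hE
  have hE1 : 1 < E := one_lt_exp_iff.2 (by positivity)
  set c := (E - 1) / (E + 1) with hc
  have hc0 : 0 < c := div_pos (by linarith) (by linarith)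
  have hc1 : c < 1 := by rw [hc, div_lt_one (by linarith)]; linarith
  have hκ : 0 < -log c := by linarith [log_neg hc0 hc1]
  refine ⟨-log c, hκ, fun h M hh hM x hx hx0 => ?_⟩
  have hxpos : 0 < ‖h x‖ := norm_pos_iff.2 hx0
  have hMpos : 0 < M := hxpos.trans_le (hM _ (by simp [strip, hr]))
  have key : ∀ S : Finset ℝ, (S : Set ℝ) ⊆ {s ∈ Ico 0 ℓ | h ((s : ℝ) : ℂ) = 0} →
      -log c * S.card ≤ log (M / ‖h x‖) := by
    intro S hS
    have h1 := norm_le_of_zeros hr S (fun s hs => Ico_subset_Icc_self (hS hs).1) hh hM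
      (fun s hs => (hS hs).2) hx
    have h2 := log_le_log hxpos h1
    rw [log_mul hMpos.ne' (by positivity), log_pow] at h2
    rw [log_div hMpos.ne' hxpos.ne']
    linarith
  have hfin : {s ∈ Ico 0 ℓ | h ((s : ℝ) : ℂ) = 0}.Finite := by
    by_contra hinf
    obtain ⟨n, hn⟩ := exists_nat_gt (log (M / ‖h x‖) / -log c)
    obtain ⟨S, hS, hcard⟩ := Set.Infinite.exists_subset_card_eq hinf n
    have := key S hS
    rw [div_lt_iff₀ hκ] at hn
    rw [hcard] at this
    linarith
  refine ⟨hfin, ?_⟩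
  rw [Set.ncard_eq_toFinset_card _ hfin]
  exact key _ (by simp)

lemma iteratedDeriv_eq_of_eqOn_ofReal {F : ℂ → ℂ} {U : Set ℂ} (hU : IsOpen U)
    (hF : DifferentiableOn ℂ F U) {v : ℝ → ℂ} (h : ∀ t : ℝ, (t : ℂ) ∈ U → v t = F t) (n : ℕ) :
    ∀ t : ℝ, (t : ℂ) ∈ U → iteratedDeriv n v t = iteratedDeriv n F t := by
  induction n with
  | zero => simpa using h
  | succ n ih =>
    intro t ht
    have hd : DifferentiableAt ℂ (iteratedDeriv n F) t := by
      rw [iteratedDeriv_eq_iterate]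
      exact ((hF.analyticOnNhd hU).iterated_deriv n t ht).differentiableAt
    have hev : iteratedDeriv n v =ᶠ[𝓝 t] fun s : ℝ => iteratedDeriv n F s := by
      filter_upwards [Complex.continuous_ofReal.continuousAt.preimage_mem_nhds (hU.mem_nhds ht)]
        with s hs using ih s hs
    rw [iteratedDeriv_succ, iteratedDeriv_succ, hev.deriv_eq]
    exact hd.hasDerivAt.comp_ofReal.deriv

/-- Locally uniform factorial bounds for the derivatives of a real-analytic function. -/
lemma exists_iteratedDeriv_le_of_analyticAt {v : ℝ → ℂ} {x₀ : ℝ} (hv : AnalyticAt ℝ v x₀) :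
    ∃ C K : ℝ, 0 ≤ C ∧ 0 ≤ K ∧ ∀ᶠ x in 𝓝 x₀, ∀ n,
      ‖iteratedDeriv n v x‖ ≤ C * K ^ n * n.factorial := by
  obtain ⟨p, r, hp⟩ := hv
  obtain ⟨ρ, hρ0, hρr⟩ := ENNReal.lt_iff_exists_nnreal_btwn.1 hp.r_pos
  have hρ : 0 < (ρ : ℝ) := by exact_mod_cast hρ0
  obtain ⟨C, hC, hbound⟩ := p.norm_mul_pow_le_of_lt_radius (hρr.trans_le hp.r_le)
  set U := Metric.ball (x₀ : ℂ) (ρ / 2) with hU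
  set F : ℂ → ℂ := fun w => ∑' n : ℕ, p.coeff n * (w - x₀) ^ n with hF
  have hterm : ∀ (n : ℕ) (w : ℂ), w ∈ U → ‖p.coeff n * (w - x₀) ^ n‖ ≤ C * (1 / 2) ^ n := by
    intro n w hw
    rw [hU, Metric.mem_ball, Complex.dist_eq] at hw
    rw [norm_mul, norm_pow]
    calc ‖p.coeff n‖ * ‖w - x₀‖ ^ n ≤ ‖p n‖ * (ρ / 2) ^ n := by
          rw [p.norm_apply_eq_norm_coef]; gcongr
      _ = ‖p n‖ * ρ ^ n * (1 / 2) ^ n := by ring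
      _ ≤ C * (1 / 2) ^ n := by gcongr; exact hbound n
  have hdiff : DifferentiableOn ℂ F U :=
    Complex.differentiableOn_tsum_of_summable_norm (F := fun n w => p.coeff n * (w - x₀) ^ n)
      (summable_geometric_two.mul_left C) (fun n => by fun_prop) Metric.isOpen_ball hterm
  have hFb : ∀ w ∈ U, ‖F w‖ ≤ C * 2 := fun w hw =>
    tsum_of_norm_bounded (hasSum_geometric_two.mul_left C) fun n => hterm n w hw
  have hreal : ∀ t : ℝ, (t : ℂ) ∈ U ↔ |t - x₀| < ρ / 2 := by
    intro t
    rw [hU, Metric.mem_ball, Complex.dist_eq, ← Complex.ofReal_sub, Complex.norm_real,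
      Real.norm_eq_abs]
  have hvF : ∀ t : ℝ, (t : ℂ) ∈ U → v t = F t := by
    intro t ht
    rw [hreal] at ht
    have h1 : t - x₀ ∈ Metric.eball (0 : ℝ) r := by
      rw [Metric.mem_eball, edist_zero_right]
      refine lt_trans ?_ hρr
      rw [← ofReal_norm, Real.norm_eq_abs]
      rw [ENNReal.ofReal_lt_coe_iff (abs_nonneg _)]
      linarith
    have h2 := hp.hasSum h1
    rw [add_sub_cancel] at h2
    rw [← h2.tsum_eq]
    refine tsum_congr fun n => ?_
    rw [p.apply_eq_pow_smul_coeff, Complex.real_smul, mul_comm]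
    push_cast
    rfl
  refine ⟨C * 2, 8 / ρ, by positivity, by positivity, ?_⟩
  filter_upwards [Metric.ball_mem_nhds x₀ (by positivity : 0 < (ρ : ℝ) / 8)] with x hx n
  rw [Metric.mem_ball, Real.dist_eq] at hx
  have hball : Metric.closedBall (x : ℂ) (ρ / 8) ⊆ U := by
    refine Metric.closedBall_subset_ball' ?_
    rw [Complex.dist_eq, ← Complex.ofReal_sub, Complex.norm_real, Real.norm_eq_abs]
    linarith
  rw [iteratedDeriv_eq_of_eqOn_ofReal Metric.isOpen_ball hdiff hvF n x
    (hball (Metric.mem_closedBall_self (by positivity)))]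
  have h := Complex.norm_iteratedDeriv_le_of_forall_mem_sphere_norm_le n
    (by positivity : 0 < (ρ : ℝ) / 8) (hdiff.diffContOnCl_ball hball)
    fun z hz => hFb z (hball (Metric.sphere_subset_closedBall hz))
  refine h.trans (le_of_eq ?_)
  rw [div_pow, div_pow]
  field_simp

lemma exists_iteratedDeriv_le_of_periodic {v : ℝ → ℂ} {ℓ : ℝ} (hℓ : 0 < ℓ)
    (hv : AnalyticOnNhd ℝ v univ) (hp : Function.Periodic v ℓ) :
    ∃ C K : ℝ, 0 < K ∧ ∀ (n : ℕ) (x : ℝ), ‖iteratedDeriv n v x‖ ≤ C * K ^ n * n.factorial := by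
  obtain ⟨C, K, hC, hK, h⟩ : ∃ C K : ℝ, 0 ≤ C ∧ 0 ≤ K ∧ ∀ x ∈ Icc 0 ℓ, ∀ n,
      ‖iteratedDeriv n v x‖ ≤ C * K ^ n * n.factorial := by
    refine (isCompact_Icc (a := (0 : ℝ)) (b := ℓ)).induction_on (p := fun s => ∃ C K : ℝ,
      0 ≤ C ∧ 0 ≤ K ∧ ∀ x ∈ s, ∀ n, ‖iteratedDeriv n v x‖ ≤ C * K ^ n * n.factorial) ?_ ?_ ?_ ?_
    · exact ⟨0, 0, le_rfl, le_rfl, by simp⟩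
    · rintro s t hst ⟨C, K, hC, hK, h⟩
      exact ⟨C, K, hC, hK, fun x hx => h x (hst hx)⟩
    · rintro s t ⟨C, K, hC, hK, h⟩ ⟨C', K', hC', hK', h'⟩
      refine ⟨C + C', K + K', by positivity, by positivity, ?_⟩
      rintro x (hx | hx) n
      · refine (h x hx n).trans ?_
        gcongr <;> linarith
      · refine (h' x hx n).trans ?_
        gcongr <;> linarith
    · intro x _
      obtain ⟨C, K, hC, hK, h⟩ := exists_iteratedDeriv_le_of_analyticAt (hv x (mem_univ x))
      exact ⟨_, mem_nhdsWithin_of_mem_nhds h, C, K, hC, hK, fun y hy => hy⟩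
  refine ⟨C, K + 1, by positivity, fun n x => ?_⟩
  have hpn : Function.Periodic (iteratedDeriv n v) ℓ := by
    intro x
    have := congrFun (iteratedDeriv_comp_add_const n v ℓ) x
    rw [← this, show (fun z => v (z + ℓ)) = v from funext hp]
  obtain ⟨y, hy, hxy⟩ := hpn.exists_mem_Ico₀ hℓ x
  rw [hxy]
  refine (h y (Ico_subset_Icc_self hy) n).trans ?_
  gcongr
  linarith

/-- A holomorphic parametrization, periodic in the real direction, of a neighborhood of the
frontier of a bounded planar open set; the upper half of the strip parametrizes the part of the
neighborhood lying inside. -/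
structure Collar (Ω : Set ℂ) (ℓ R : ℝ) (Q : ℂ → ℂ) : Prop where
  isOpen : IsOpen Ω
  isBounded : Bornology.IsBounded Ω
  period_pos : 0 < ℓ
  width_pos : 0 < R
  diff : DifferentiableOn ℂ Q (strip (-R) R)
  periodic : ∀ z, Q (z + ℓ) = Q z
  deriv_ne : ∀ z ∈ strip (-R) R, deriv Q z ≠ 0
  inj : ∀ z ∈ strip (-R) R, ∀ w ∈ strip (-R) R, Q z = Q w → ∃ n : ℤ, z = w + n * ℓ
  upper : ∀ z ∈ strip 0 R, Q z ∈ Ω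
  lower : ∀ z ∈ strip (-R) R, z.im ≤ 0 → Q z ∉ Ω
  frontier_le : ∀ p ∈ frontier Ω, ∃ x : ℝ, Q x = p
  unit : ∀ x : ℝ, ‖deriv Q x‖ = 1

lemma strip_mono {a b c d : ℝ} (h1 : c ≤ a) (h2 : b ≤ d) : strip a b ⊆ strip c d :=
  fun _ hz => ⟨h1.trans_lt hz.1, hz.2.trans_le h2⟩

lemma ofReal_mem_strip {R : ℝ} (hR : 0 < R) (x : ℝ) : (x : ℂ) ∈ strip (-R) R := by
  simp [strip, hR]

lemma convex_strip (a b : ℝ) : Convex ℝ (strip a b) :=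
  (convex_halfSpace_im_gt a).inter (convex_halfSpace_im_lt b)

lemma periodic_int {Q : ℂ → ℂ} {ℓ : ℝ} (h : ∀ z, Q (z + ℓ) = Q z) (n : ℤ) (z : ℂ) :
    Q (z + n * ℓ) = Q z :=
  Function.Periodic.int_mul (f := Q) (c := (ℓ : ℂ)) h n z

lemma exists_shift_mem_Ico {ℓ : ℝ} (hℓ : 0 < ℓ) (z : ℂ) :
    ∃ n : ℤ, (z + n * ℓ).re ∈ Ico 0 ℓ ∧ (z + n * ℓ).im = z.im := by
  obtain ⟨n, hn, -⟩ := existsUnique_add_zsmul_mem_Ico hℓ z.re 0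
  refine ⟨n, ?_, by simp⟩
  simpa using hn

lemma isCompact_segment_ofReal (ℓ : ℝ) : IsCompact ((fun x : ℝ => (x : ℂ)) '' Icc 0 ℓ) :=
  isCompact_Icc.image Complex.continuous_ofReal

lemma dist_re_lt {z : ℂ} {R : ℝ} (hz : z ∈ strip (-R) R) : dist z z.re < R := by
  have : z - z.re = z.im * Complex.I := by
    nth_rewrite 1 [← Complex.re_add_im z]; ring
  rw [Complex.dist_eq, this]
  simpa using abs_lt.2 hz

lemma exists_deriv_ne_zero {Q : ℂ → ℂ} {ℓ R : ℝ} (hℓ : 0 < ℓ) (hR : 0 < R)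
    (hQ : DifferentiableOn ℂ Q (strip (-R) R)) (hp : ∀ z, Q (z + ℓ) = Q z)
    (h0 : ∀ x : ℝ, deriv Q x ≠ 0) :
    ∃ r > 0, r ≤ R ∧ ∀ z ∈ strip (-r) r, deriv Q z ≠ 0 := by
  have hcont : ContinuousOn (deriv Q) (strip (-R) R) :=
    (hQ.deriv (isOpen_strip _ _)).continuousOn
  have hopen : IsOpen (strip (-R) R ∩ deriv Q ⁻¹' {0}ᶜ) :=
    hcont.isOpen_inter_preimage (isOpen_strip _ _) isOpen_compl_singleton
  obtain ⟨δ, hδ, hsub⟩ := (isCompact_segment_ofReal ℓ).exists_thickening_subset_open hopen (by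
    rintro _ ⟨x, -, rfl⟩
    exact ⟨ofReal_mem_strip hR x, h0 x⟩)
  refine ⟨min δ R, lt_min hδ hR, min_le_right _ _, fun z hz => ?_⟩
  obtain ⟨n, hn, him⟩ := exists_shift_mem_Ico hℓ z
  have hz' : z + n * ℓ ∈ strip (-δ) δ := by
    refine strip_mono (neg_le_neg (min_le_left δ R)) (min_le_left δ R) ?_
    simpa only [strip, mem_ofPred_eq, him] using hz
  have h1 := hsub (Metric.mem_thickening_iff.2 ⟨((z + n * ℓ).re : ℂ),
    ⟨_, Ico_subset_Icc_self hn, rfl⟩, dist_re_lt hz'⟩)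
  have h2 : deriv Q (z + n * ℓ) = deriv Q z := by
    rw [← deriv_comp_add_const Q _ z]
    exact congrArg (fun f => deriv f z) (funext fun w => periodic_int hp n w)
  exact h2 ▸ h1.2

lemma exists_collar_inj {Q : ℂ → ℂ} {ℓ R : ℝ} (hℓ : 0 < ℓ) (hR : 0 < R)
    (hQ : DifferentiableOn ℂ Q (strip (-R) R)) (hp : ∀ z, Q (z + ℓ) = Q z)
    (h0 : ∀ z ∈ strip (-R) R, deriv Q z ≠ 0)
    (hinj : ∀ x y : ℝ, Q x = Q y → ∃ n : ℤ, x = y + n * ℓ) :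
    ∃ r > 0, r ≤ R ∧ ∀ z ∈ strip (-r) r, ∀ w ∈ strip (-r) r, Q z = Q w →
      ∃ n : ℤ, z = w + n * ℓ := by
  set G : Set (ℂ × ℂ) :=
    {p | ∀ᶠ q : ℂ × ℂ in 𝓝 p, Q q.1 = Q q.2 → ∃ n : ℤ, q.1 = q.2 + n * ℓ} with hG
  have hGopen : IsOpen G := isOpen_setOfPred_eventually_nhds
  set S := (fun x : ℝ => (x : ℂ)) '' Icc 0 ℓ
  have hcontAt : ∀ x : ℝ, ContinuousAt Q x := fun x =>
    (hQ.differentiableAt ((isOpen_strip _ _).mem_nhds (ofReal_mem_strip hR x))).continuousAt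
  have hSG : S ×ˢ S ⊆ G := by
    rintro ⟨_, _⟩ ⟨⟨x, hx, rfl⟩, ⟨y, hy, rfl⟩⟩
    by_cases hxy : Q x = Q y
    · obtain ⟨n, hn⟩ := hinj x y hxy
      have hmem := ofReal_mem_strip hR x
      have hstrict : HasStrictDerivAt Q (deriv Q x) x :=
        ((hQ.analyticAt ((isOpen_strip _ _).mem_nhds hmem)).hasStrictDerivAt)
      have hloc : ∃ N ∈ 𝓝 (x : ℂ), InjOn Q N := by
        have e := (hstrict.hasStrictFDerivAt_equiv (h0 _ hmem))
        exact ⟨_, e.toOpenPartialHomeomorph Q |>.open_source.mem_nhds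
          e.mem_toOpenPartialHomeomorph_source, (e.toOpenPartialHomeomorph Q).injOn⟩
      obtain ⟨N, hN, hNinj⟩ := hloc
      have h1 : ∀ᶠ q : ℂ × ℂ in 𝓝 ((x : ℂ), (y : ℂ)), q.1 ∈ N :=
        continuousAt_fst.preimage_mem_nhds hN
      have h2 : ∀ᶠ q : ℂ × ℂ in 𝓝 ((x : ℂ), (y : ℂ)), q.2 + n * ℓ ∈ N := by
        refine ContinuousAt.preimage_mem_nhds (f := fun q : ℂ × ℂ => q.2 + n * ℓ)
          (by fun_prop) ?_
        have : ((y : ℂ) + n * ℓ) = x := by rw [hn]; push_cast; ring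
        simpa only [this] using hN
      filter_upwards [h1, h2] with q hq1 hq2 hq
      exact ⟨n, hNinj hq1 hq2 (by rw [periodic_int hp, hq])⟩
    · have h1 : ContinuousAt (fun q : ℂ × ℂ => Q q.1) ((x : ℂ), (y : ℂ)) :=
        ContinuousAt.comp (g := Q) (hcontAt x) continuousAt_fst
      have h2 : ContinuousAt (fun q : ℂ × ℂ => Q q.2) ((x : ℂ), (y : ℂ)) :=
        ContinuousAt.comp (g := Q) (hcontAt y) continuousAt_snd
      filter_upwards [(h1.sub h2).eventually_ne (sub_ne_zero.2 hxy)] with q hq hq'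
      exact absurd (sub_eq_zero.2 hq') hq
  obtain ⟨δ, hδ, hsub⟩ := ((isCompact_segment_ofReal ℓ).prod
    (isCompact_segment_ofReal ℓ)).exists_thickening_subset_open hGopen hSG
  refine ⟨min δ R, lt_min hδ hR, min_le_right _ _, fun z hz w hw hzw => ?_⟩
  obtain ⟨n, hn, hnim⟩ := exists_shift_mem_Ico hℓ z
  obtain ⟨m, hm, hmim⟩ := exists_shift_mem_Ico hℓ w
  have hz' : z + n * ℓ ∈ strip (-δ) δ := by
    refine strip_mono (neg_le_neg (min_le_left δ R)) (min_le_left δ R) ?_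
    simpa only [strip, mem_ofPred_eq, hnim] using hz
  have hw' : w + m * ℓ ∈ strip (-δ) δ := by
    refine strip_mono (neg_le_neg (min_le_left δ R)) (min_le_left δ R) ?_
    simpa only [strip, mem_ofPred_eq, hmim] using hw
  have hmem : (z + n * ℓ, w + m * ℓ) ∈ G := hsub (Metric.mem_thickening_iff.2
    ⟨((z + n * ℓ).re, (w + m * ℓ).re), ⟨⟨_, Ico_subset_Icc_self hn, rfl⟩,
      ⟨_, Ico_subset_Icc_self hm, rfl⟩⟩, max_lt (dist_re_lt hz') (dist_re_lt hw')⟩)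
  obtain ⟨k, hk⟩ := Filter.Eventually.self_of_nhds hmem
    (by simp only [periodic_int hp, hzw])
  refine ⟨k + m - n, ?_⟩
  simp only at hk
  push_cast
  linear_combination hk

/-- Each of the two half-strips of a holomorphic parametrization of the frontier is mapped inside
or outside of the set. -/
lemma half_strip_image_subset {Ω : Set ℂ} {Q : ℂ → ℂ} {S : Set ℂ} (hΩ : IsOpen Ω)
    (hS : IsPreconnected S) (hQ : ContinuousOn Q S) (hd : ∀ z ∈ S, Q z ∉ frontier Ω) :
    (∀ z ∈ S, Q z ∈ Ω) ∨ ∀ z ∈ S, Q z ∉ closure Ω := by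
  have h := (hS.image Q hQ).subset_or_subset hΩ (isClosed_closure (s := Ω)).isOpen_compl
    (disjoint_compl_right.mono_left subset_closure) (by
      rintro _ ⟨z, hz, rfl⟩
      by_cases hc : Q z ∈ closure Ω
      · left
        have := hd z hz
        rw [hΩ.frontier_eq] at this
        by_contra hn
        exact this ⟨hc, hn⟩
      · exact Or.inr hc)
  rcases h with h | h
  · exact Or.inl fun z hz => h ⟨z, hz, rfl⟩
  · exact Or.inr fun z hz => h ⟨z, hz, rfl⟩

lemma exists_holomorphic_frontier {Ω : Set ℂ} (hΩ : IsOpen Ω) (hb : Bornology.IsBounded Ω)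
    {ℓ : ℝ} (hℓ : 0 < ℓ) {γ : ℝ → ℂ} (hγ : AnalyticOnNhd ℝ γ univ) (hp : Function.Periodic γ ℓ)
    (hinj : InjOn γ (Ico 0 ℓ)) (hunit : ∀ s, ‖deriv γ s‖ = 1) (hrange : range γ = frontier Ω) :
    ∃ (R : ℝ) (Q : ℂ → ℂ), 0 < R ∧ (∀ x : ℝ, Q x = γ x) ∧
      DifferentiableOn ℂ Q (strip (-R) R) ∧ (∀ z, Q (z + ℓ) = Q z) ∧
      (∀ z ∈ strip (-R) R, deriv Q z ≠ 0) ∧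
      (∀ z ∈ strip (-R) R, ∀ w ∈ strip (-R) R, Q z = Q w → ∃ n : ℤ, z = w + n * ℓ) ∧
      (∀ x : ℝ, ‖deriv Q x‖ = 1) ∧
      (((∀ z ∈ strip 0 R, Q z ∈ Ω) ∧ ∀ z ∈ strip (-R) 0, Q z ∉ Ω) ∨
        ((∀ z ∈ strip (-R) 0, Q z ∈ Ω) ∧ ∀ z ∈ strip 0 R, Q z ∉ Ω)) := by
  obtain ⟨C, K, hK, hCK⟩ := exists_iteratedDeriv_le_of_periodic hℓ hγ hp
  have hsmooth : ContDiff ℝ ∞ γ := by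
    rw [← contDiffOn_univ]
    exact hγ.contDiffOn (by simp [uniqueDiffOn_univ])
  obtain ⟨Q, hQ, hQγ, -, hQp⟩ := exists_holomorphic_extension hsmooth hK hCK
  replace hQp := hQp ℓ hp
  have hR0 : 0 < 1 / K := by positivity
  have hderiv : ∀ x : ℝ, deriv Q x = deriv γ x := fun x => by
    have h1 := (hQ.differentiableAt ((isOpen_strip _ _).mem_nhds
      (ofReal_mem_strip hR0 x))).hasDerivAt.comp_ofReal
    simp only [hQγ] at h1
    exact h1.deriv.symm
  have hunit' : ∀ x : ℝ, ‖deriv Q x‖ = 1 := fun x => by rw [hderiv, hunit]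
  obtain ⟨R₁, hR₁, hR₁0, hne⟩ := exists_deriv_ne_zero hℓ hR0 hQ hQp
    (fun x => norm_ne_zero_iff.1 (by rw [hunit']; exact one_ne_zero))
  have hinj' : ∀ x y : ℝ, Q x = Q y → ∃ n : ℤ, x = y + n * ℓ := by
    intro x y hxy
    rw [hQγ, hQγ] at hxy
    obtain ⟨n, hn, -⟩ := existsUnique_add_zsmul_mem_Ico hℓ x 0
    obtain ⟨m, hm, -⟩ := existsUnique_add_zsmul_mem_Ico hℓ y 0
    rw [zero_add] at hn hm
    have := hinj hn hm (by
      simp only [zsmul_eq_mul]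
      rw [hp.int_mul, hp.int_mul, hxy])
    refine ⟨m - n, ?_⟩
    simp only [zsmul_eq_mul] at this
    push_cast
    linear_combination this
  obtain ⟨R, hR, hRR₁, hQinj⟩ := exists_collar_inj hℓ hR₁
    (hQ.mono (strip_mono (neg_le_neg hR₁0) hR₁0)) hQp hne hinj'
  have hsub : strip (-R) R ⊆ strip (-(1 / K)) (1 / K) :=
    strip_mono (neg_le_neg (hRR₁.trans hR₁0)) (hRR₁.trans hR₁0)
  have hQR := hQ.mono hsub
  have hup : strip 0 R ⊆ strip (-R) R := strip_mono (by linarith) le_rfl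
  have hlow : strip (-R) 0 ⊆ strip (-R) R := strip_mono le_rfl hR.le
  have hfr : ∀ z ∈ strip (-R) R, Q z ∈ frontier Ω → z.im = 0 := by
    intro z hz hf
    rw [← hrange] at hf
    obtain ⟨x, hx⟩ := hf
    obtain ⟨n, hn⟩ := hQinj z hz x (ofReal_mem_strip hR x) (by rw [hQγ, hx])
    rw [hn]; simp
  have hupper := half_strip_image_subset hΩ (convex_strip 0 R).isPreconnected
    (hQR.continuousOn.mono hup) fun z hz hf => hz.1.ne' (hfr z (hup hz) hf)
  have hlower := half_strip_image_subset hΩ (convex_strip (-R) 0).isPreconnected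
    (hQR.continuousOn.mono hlow) fun z hz hf => hz.2.ne (hfr z (hlow hz) hf)
  have hreal : ∀ z ∈ strip (-R) R, z.im = 0 → Q z ∈ frontier Ω := by
    intro z _ hz
    have : z = (z.re : ℂ) := Complex.ext rfl (by simpa using hz)
    rw [this, hQγ, ← hrange]
    exact ⟨_, rfl⟩
  have htri : ∀ z ∈ strip (-R) R, z ∈ strip (-R) 0 ∨ z.im = 0 ∨ z ∈ strip 0 R := by
    intro z hz
    rcases lt_trichotomy z.im 0 with h | h | h
    · exact Or.inl ⟨hz.1, h⟩
    · exact Or.inr (Or.inl h)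
    · exact Or.inr (Or.inr ⟨h, hz.2⟩)
  have hnhds : ∀ x : ℝ, Q '' strip (-R) R ∈ 𝓝 (Q x) := by
    intro x
    have hmem := ofReal_mem_strip hR x
    have hstrict : HasStrictDerivAt Q (deriv Q x) x :=
      (hQR.analyticAt ((isOpen_strip _ _).mem_nhds hmem)).hasStrictDerivAt
    have hne0 : deriv Q x ≠ 0 := norm_ne_zero_iff.1 (by rw [hunit']; exact one_ne_zero)
    rw [← hstrict.map_nhds_eq hne0]
    exact image_mem_map ((isOpen_strip _ _).mem_nhds hmem)
  have hnot : ∀ z, Q z ∉ closure Ω → Q z ∉ Ω := fun z h h' => h (subset_closure h')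
  refine ⟨R, Q, hR, hQγ, hQR, hQp, fun z hz => hne z (strip_mono (neg_le_neg hRR₁) hRR₁ hz),
    hQinj, hunit', ?_⟩
  have hfne : Q ((0 : ℝ) : ℂ) ∈ frontier Ω := hreal _ (ofReal_mem_strip hR 0) (by simp)
  rcases hupper with hu | hu <;> rcases hlower with hl | hl
  · exfalso
    have hcl : IsOpen (closure Ω) := by
      rw [isOpen_iff_mem_nhds]
      intro p hp
      by_cases hpΩ : p ∈ Ω
      · exact mem_of_superset (hΩ.mem_nhds hpΩ) subset_closure
      · have : p ∈ frontier Ω := by rw [hΩ.frontier_eq]; exact ⟨hp, hpΩ⟩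
        rw [← hrange] at this
        obtain ⟨x, rfl⟩ := this
        rw [← hQγ]
        refine mem_of_superset (hnhds x) ?_
        rintro _ ⟨z, hz, rfl⟩
        rcases htri z hz with h | h | h
        · exact subset_closure (hl z h)
        · exact frontier_subset_closure (hreal z hz h)
        · exact subset_closure (hu z h)
    have huniv := IsClopen.eq_univ ⟨isClosed_closure, hcl⟩
      ⟨_, frontier_subset_closure hfne⟩
    have := hb.closure
    rw [huniv] at this
    exact NormedSpace.unbounded_univ ℝ ℂ this
  · exact Or.inl ⟨hu, fun z hz => hnot z (hl z hz)⟩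
  · exact Or.inr ⟨hl, fun z hz => hnot z (hu z hz)⟩
  · exfalso
    obtain ⟨p, hp1, hp2⟩ := mem_closure_iff_nhds.1 (frontier_subset_closure hfne) _ (hnhds 0)
    obtain ⟨z, hz, rfl⟩ := hp1
    rcases htri z hz with h | h | h
    · exact hnot z (hl z h) hp2
    · have := hreal z hz h
      rw [hΩ.frontier_eq] at this
      exact this.2 hp2
    · exact hnot z (hu z h) hp2

lemma collar_of_holomorphic_frontier {Ω : Set ℂ} (hΩ : IsOpen Ω) (hb : Bornology.IsBounded Ω)
    {ℓ : ℝ} (hℓ : 0 < ℓ) {Q : ℂ → ℂ} {R : ℝ} (hR : 0 < R)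
    (hrange : ∀ p, p ∈ frontier Ω ↔ ∃ x : ℝ, Q x = p)
    (hQ : DifferentiableOn ℂ Q (strip (-R) R)) (hQp : ∀ z, Q (z + ℓ) = Q z)
    (hne : ∀ z ∈ strip (-R) R, deriv Q z ≠ 0)
    (hinj : ∀ z ∈ strip (-R) R, ∀ w ∈ strip (-R) R, Q z = Q w → ∃ n : ℤ, z = w + n * ℓ)
    (hunit : ∀ x : ℝ, ‖deriv Q x‖ = 1) (hu : ∀ z ∈ strip 0 R, Q z ∈ Ω)
    (hl : ∀ z ∈ strip (-R) 0, Q z ∉ Ω) : Collar Ω ℓ R Q where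
  isOpen := hΩ
  isBounded := hb
  period_pos := hℓ
  width_pos := hR
  diff := hQ
  periodic := hQp
  deriv_ne := hne
  inj := hinj
  upper := hu
  lower z hz him := by
    rcases him.lt_or_eq with h | h
    · exact hl z ⟨hz.1, h⟩
    · have hz' : z = (z.re : ℂ) := Complex.ext rfl (by simpa using h)
      have : Q z ∈ frontier Ω := (hrange _).2 ⟨z.re, by rw [← hz']⟩
      rw [hΩ.frontier_eq] at this
      exact this.2
  frontier_le p hp := (hrange p).1 hp
  unit := hunit

/-- A bounded planar open set with real-analytic boundary has a holomorphic collar, possibly after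
a reflection. -/
lemma exists_collar {Ω : Set ℂ} (hΩ : IsOpen Ω) (hb : Bornology.IsBounded Ω)
    {ℓ : ℝ} (hℓ : 0 < ℓ) {γ : ℝ → ℂ} (hγ : AnalyticOnNhd ℝ γ univ) (hp : Function.Periodic γ ℓ)
    (hinj : InjOn γ (Ico 0 ℓ)) (hunit : ∀ s, ‖deriv γ s‖ = 1) (hrange : range γ = frontier Ω) :
    ∃ (R : ℝ) (Q : ℂ → ℂ), ((∀ x : ℝ, Q x = γ x) ∧ Collar Ω ℓ R Q) ∨
      ((∀ x : ℝ, Q x = starRingEnd ℂ (γ x)) ∧ Collar (starRingEnd ℂ ⁻¹' Ω) ℓ R Q) := by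
  obtain ⟨R, Q, hR, hQγ, hQ, hQp, hne, hQinj, hQunit, h | h⟩ :=
    exists_holomorphic_frontier hΩ hb hℓ hγ hp hinj hunit hrange
  · refine ⟨R, Q, Or.inl ⟨hQγ, collar_of_holomorphic_frontier hΩ hb hℓ hR ?_ hQ hQp hne hQinj
      hQunit h.1 h.2⟩⟩
    intro p
    rw [← hrange]
    simp [hQγ]
  · have hconj : ∀ {a b : ℝ} {z : ℂ}, z ∈ strip a b → starRingEnd ℂ z ∈ strip (-b) (-a) :=
      fun hz => ⟨by simpa using hz.2, by simpa using hz.1⟩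
    have hconjR : ∀ {z : ℂ}, z ∈ strip (-R) R → starRingEnd ℂ z ∈ strip (-R) R :=
      fun hz => by simpa using hconj hz
    have hderiv : ∀ z ∈ strip (-R) R, HasDerivAt (fun w => starRingEnd ℂ (Q (starRingEnd ℂ w)))
        (starRingEnd ℂ (deriv Q (starRingEnd ℂ z))) z := by
      intro z hz
      simpa [Function.comp_def] using
        ((hQ.differentiableAt ((isOpen_strip _ _).mem_nhds (hconjR hz))).hasDerivAt).conj_conj
    refine ⟨R, fun z => starRingEnd ℂ (Q (starRingEnd ℂ z)), Or.inr ⟨fun x => by simp [hQγ],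
      collar_of_holomorphic_frontier (hΩ.preimage Complex.continuous_conj) ?_ hℓ hR ?_
        (fun z hz => (hderiv z hz).differentiableAt.differentiableWithinAt) ?_ ?_ ?_ ?_ ?_ ?_⟩⟩
    · exact (Complex.conjLIE.isometry.antilipschitz.isBounded_preimage hb)
    · intro p
      have : frontier (starRingEnd ℂ ⁻¹' Ω) = starRingEnd ℂ ⁻¹' frontier Ω :=
        (Complex.conjLIE.toHomeomorph.preimage_frontier Ω).symm
      rw [this, mem_preimage, ← hrange]
      simp only [Complex.conj_ofReal, hQγ, mem_range]
      exact exists_congr fun x => ⟨fun h => by rw [h]; simp, fun h => by rw [← h]; simp⟩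
    · intro z
      simp [hQp]
    · intro z hz
      rw [(hderiv z hz).deriv]
      simpa using hne _ (hconjR hz)
    · intro z hz w hw hzw
      obtain ⟨n, hn⟩ := hQinj _ (hconjR hz) _ (hconjR hw) ((starRingEnd ℂ).injective hzw)
      refine ⟨n, (starRingEnd ℂ).injective ?_⟩
      simpa using hn
    · intro x
      rw [(hderiv x (ofReal_mem_strip hR x)).deriv]
      simpa using hQunit x
    · intro z hz
      simpa using h.1 _ (by simpa using hconj hz)
    · intro z hz
      simpa using h.2 _ (by simpa using hconj hz)

open Classical in
/-- The height coordinate on the image of a collar parametrization. -/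
def depth (Q : ℂ → ℂ) (R : ℝ) (p : ℂ) : ℝ :=
  if h : ∃ w ∈ strip (-R) R, Q w = p then (Classical.choose h).im else 0

open Classical in
/-- The function equal to `η` of the height on the inner half of a collar, to `1` on the rest of
`Ω` and to `0` outside `Ω`. -/
def cutoff (Ω : Set ℂ) (Q : ℂ → ℂ) (R : ℝ) (η : ℝ → ℝ) (p : ℂ) : ℝ :=
  if p ∈ Ω then if p ∈ Q '' strip 0 R then η (depth Q R p) else 1 else 0

namespace Collar

variable {Ω : Set ℂ} {ℓ R : ℝ} {Q : ℂ → ℂ}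

lemma depth_apply (H : Collar Ω ℓ R Q) {w : ℂ} (hw : w ∈ strip (-R) R) :
    depth Q R (Q w) = w.im := by
  have h : ∃ w' ∈ strip (-R) R, Q w' = Q w := ⟨w, hw, rfl⟩
  obtain ⟨h1, h2⟩ := Classical.choose_spec h
  obtain ⟨n, hn⟩ := H.inj _ h1 _ hw h2
  rw [depth, dif_pos h, hn]
  simp

lemma strip_zero_subset (H : Collar Ω ℓ R Q) : strip 0 R ⊆ strip (-R) R :=
  strip_mono (neg_nonpos.2 H.width_pos.le) le_rfl

lemma differentiableAt (H : Collar Ω ℓ R Q) {w : ℂ} (hw : w ∈ strip (-R) R) :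
    DifferentiableAt ℂ Q w :=
  H.diff.differentiableAt ((isOpen_strip _ _).mem_nhds hw)

lemma map_nhds_eq (H : Collar Ω ℓ R Q) {w : ℂ} (hw : w ∈ strip (-R) R) :
    map Q (𝓝 w) = 𝓝 (Q w) :=
  ((H.diff.analyticAt ((isOpen_strip _ _).mem_nhds hw)).hasStrictDerivAt).map_nhds_eq
    (H.deriv_ne w hw)

lemma image_mem_nhds (H : Collar Ω ℓ R Q) {w : ℂ} {S : Set ℂ} (hS : IsOpen S)
    (hSR : S ⊆ strip (-R) R) (hw : w ∈ S) : Q '' S ∈ 𝓝 (Q w) := by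
  rw [← H.map_nhds_eq (hSR hw)]
  exact image_mem_map (hS.mem_nhds hw)

lemma contDiffAt_depth (H : Collar Ω ℓ R Q) {w : ℂ} (hw : w ∈ strip (-R) R) :
    ContDiffAt ℝ ∞ (depth Q R) (Q w) := by
  have han : AnalyticAt ℂ Q w := H.diff.analyticAt ((isOpen_strip _ _).mem_nhds hw)
  have hstrict := han.hasStrictDerivAt
  have hc : ContDiffAt ℂ ∞ Q w := han.contDiffAt
  have hF := (hstrict.hasStrictFDerivAt_equiv (H.deriv_ne w hw)).hasFDerivAt
  have hinv := (hc.to_localInverse hF (by simp)).restrict_scalars ℝ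
  set g := hc.localInverse hF (by simp)
  have hright : ∀ᶠ p in 𝓝 (Q w), Q (g p) = p :=
    (hc.hasStrictFDerivAt' hF (by simp)).eventually_right_inverse
  have hgw : g (Q w) = w := hc.localInverse_apply_image hF (by simp)
  have hmem : ∀ᶠ p in 𝓝 (Q w), g p ∈ strip (-R) R :=
    hinv.continuousAt.preimage_mem_nhds ((isOpen_strip _ _).mem_nhds (by rwa [hgw]))
  have heq : depth Q R =ᶠ[𝓝 (Q w)] fun p => (g p).im := by
    filter_upwards [hright, hmem] with p hp1 hp2
    rw [← H.depth_apply hp2, hp1]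
  exact (Complex.imCLM.contDiff.contDiffAt.comp (Q w) hinv).congr_of_eventuallyEq heq

lemma isCompact_image (H : Collar Ω ℓ R Q) {c d : ℝ} (hc : -R < c) (hd : d < R) :
    IsCompact (Q '' {w | c ≤ w.im ∧ w.im ≤ d}) := by
  have hK : IsCompact (Icc 0 ℓ ×ℂ Icc c d) := isCompact_Icc.reProdIm isCompact_Icc
  have hsub : Icc 0 ℓ ×ℂ Icc c d ⊆ strip (-R) R := fun w hw =>
    ⟨hc.trans_le (Complex.mem_reProdIm.1 hw).2.1, (Complex.mem_reProdIm.1 hw).2.2.trans_lt hd⟩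
  convert hK.image_of_continuousOn (H.diff.continuousOn.mono hsub) using 1
  refine Subset.antisymm ?_ (image_mono fun w hw => (Complex.mem_reProdIm.1 hw).2)
  rintro _ ⟨w, hw, rfl⟩
  obtain ⟨n, hn, hnim⟩ := exists_shift_mem_Ico H.period_pos w
  exact ⟨w + n * ℓ, Complex.mem_reProdIm.2 ⟨Ico_subset_Icc_self hn, by rw [hnim]; exact hw⟩,
    periodic_int H.periodic n w⟩

lemma cutoff_apply (H : Collar Ω ℓ R Q) {η : ℝ → ℝ} (h0 : ∀ y ≤ 0, η y = 0) {w : ℂ}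
    (hw : w ∈ strip (-R) R) : cutoff Ω Q R η (Q w) = η w.im := by
  rcases le_or_gt w.im 0 with h | h
  · rw [cutoff, if_neg (H.lower w hw h), h0 _ h]
  · rw [cutoff, if_pos (H.upper w ⟨h, hw.2⟩), if_pos ⟨w, ⟨h, hw.2⟩, rfl⟩, H.depth_apply hw]

lemma cutoff_of_notMem (p : ℂ) (hp : p ∉ Ω) (η : ℝ → ℝ) : cutoff Ω Q R η p = 0 := by
  rw [cutoff, if_neg hp]

lemma cutoff_eventuallyEq (H : Collar Ω ℓ R Q) {η : ℝ → ℝ} (h0 : ∀ y ≤ 0, η y = 0) {d : ℝ}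
    (hdR : d < R) (h1 : ∀ y, d ≤ y → η y = 1) (p : ℂ) :
    (∃ w ∈ strip (-R) R, Q w = p ∧ cutoff Ω Q R η =ᶠ[𝓝 p] fun p' => η (depth Q R p')) ∨
      ∃ c : ℝ, cutoff Ω Q R η =ᶠ[𝓝 p] fun _ => c := by
  by_cases hp : p ∈ Q '' strip (-R) R
  · obtain ⟨w, hw, rfl⟩ := hp
    refine Or.inl ⟨w, hw, rfl, ?_⟩
    filter_upwards [H.image_mem_nhds (isOpen_strip _ _) subset_rfl hw] with p' hp'
    obtain ⟨w', hw', rfl⟩ := hp'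
    rw [H.cutoff_apply h0 hw', H.depth_apply hw']
  · right
    by_cases hpc : p ∈ closure Ω
    · have hpΩ : p ∈ Ω := by
        by_contra hn
        obtain ⟨x, hx⟩ := H.frontier_le p (by rw [H.isOpen.frontier_eq]; exact ⟨hpc, hn⟩)
        exact hp ⟨x, ofReal_mem_strip H.width_pos x, hx⟩
      refine ⟨1, ?_⟩
      have hcomp := H.isCompact_image (c := 0) (neg_neg_of_pos H.width_pos) hdR
      have hnot : p ∉ Q '' {w | 0 ≤ w.im ∧ w.im ≤ d} := by
        rintro ⟨w, hw, rfl⟩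
        exact hp ⟨w, ⟨(neg_neg_of_pos H.width_pos).trans_le hw.1, hw.2.trans_lt hdR⟩, rfl⟩
      filter_upwards [H.isOpen.mem_nhds hpΩ, hcomp.isClosed.isOpen_compl.mem_nhds hnot]
        with p' hp1 hp2
      rw [cutoff, if_pos hp1]
      split_ifs with hp3
      · obtain ⟨w, hw, rfl⟩ := hp3
        rw [H.depth_apply (H.strip_zero_subset hw), h1]
        by_contra hlt
        exact hp2 ⟨w, ⟨hw.1.le, (not_le.1 hlt).le⟩, rfl⟩
      · rfl
    · refine ⟨0, ?_⟩
      filter_upwards [isClosed_closure.isOpen_compl.mem_nhds hpc] with p' hp'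
      exact cutoff_of_notMem p' (fun h => hp' (subset_closure h)) η

lemma contDiff_cutoff (H : Collar Ω ℓ R Q) {η : ℝ → ℝ} (hη : ContDiff ℝ ∞ η)
    (h0 : ∀ y ≤ 0, η y = 0) {d : ℝ} (hdR : d < R) (h1 : ∀ y, d ≤ y → η y = 1) :
    ContDiff ℝ ∞ (cutoff Ω Q R η) := by
  rw [contDiff_iff_contDiffAt]
  intro p
  rcases H.cutoff_eventuallyEq h0 hdR h1 p with ⟨w, hw, rfl, he⟩ | ⟨c, he⟩
  · exact (hη.contDiffAt.comp _ (H.contDiffAt_depth hw)).congr_of_eventuallyEq he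
  · exact contDiffAt_const.congr_of_eventuallyEq he

lemma fderiv_cutoff_apply (H : Collar Ω ℓ R Q) {η : ℝ → ℝ} (hη : ContDiff ℝ ∞ η)
    (h0 : ∀ y ≤ 0, η y = 0) {d : ℝ} (hdR : d < R) (h1 : ∀ y, d ≤ y → η y = 1) {w : ℂ}
    (hw : w ∈ strip (-R) R) (v : ℂ) :
    fderiv ℝ (cutoff Ω Q R η) (Q w) v = deriv η w.im * (v / deriv Q w).im := by
  have hχ : DifferentiableAt ℝ (cutoff Ω Q R η) (Q w) :=
    (H.contDiff_cutoff hη h0 hdR h1).contDiffAt.differentiableAt (by simp)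
  have hQ : HasFDerivAt Q _ w := (H.differentiableAt hw).hasDerivAt.hasFDerivAt.restrictScalars ℝ
  have hl := hχ.hasFDerivAt.comp w hQ
  have hr : HasFDerivAt (fun w : ℂ => η w.im) _ w :=
    ((hη.differentiable (by simp)).differentiableAt (x := w.im)).hasDerivAt.comp_hasFDerivAt w
      Complex.imCLM.hasFDerivAt
  have heq : (cutoff Ω Q R η ∘ Q) =ᶠ[𝓝 w] fun w : ℂ => η w.im := by
    filter_upwards [(isOpen_strip _ _).mem_nhds hw] with w' hw'
    exact H.cutoff_apply h0 hw'
  have := congrArg (fun L => L (v / deriv Q w)) (hl.unique (hr.congr_of_eventuallyEq heq))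
  have hne := H.deriv_ne w hw
  simpa [div_mul_cancel₀ _ hne] using this

lemma fderiv_cutoff_eq_zero (H : Collar Ω ℓ R Q) {η : ℝ → ℝ}
    (h0 : ∀ y ≤ 0, η y = 0) {d : ℝ} (hdR : d < R) (h1 : ∀ y, d ≤ y → η y = 1) {p : ℂ}
    (hp : p ∉ Q '' strip (-R) R) : fderiv ℝ (cutoff Ω Q R η) p = 0 := by
  rcases H.cutoff_eventuallyEq h0 hdR h1 p with ⟨w, hw, rfl, -⟩ | ⟨c, he⟩
  · exact absurd ⟨w, hw, rfl⟩ hp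
  · rw [he.fderiv_eq]
    simp

end Collar

lemma integral_reProdIm_eq {F : ℂ → ℝ} {a b c d ℓ : ℝ} (hℓ : 0 ≤ ℓ)
    (hF : ContinuousOn F (strip a b)) (hac : a < c) (hcd : c ≤ d) (hdb : d < b) :
    ∫ w in Ico 0 ℓ ×ℂ Ioc c d, F w = ∫ y in c..d, slice ℓ F y := by
  have hpre : Ico 0 ℓ ×ℂ Ioc c d =
      Complex.measurableEquivRealProd ⁻¹' (Ico 0 ℓ ×ˢ Ioc c d) := by
    ext w; simp [Complex.mem_reProdIm]
  have hmp := Complex.volume_preserving_equiv_real_prod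
  have h1 : ∫ w in Ico 0 ℓ ×ℂ Ioc c d, F w =
      ∫ p in Ico 0 ℓ ×ˢ Ioc c d, F (p.1 + p.2 * Complex.I) := by
    rw [hpre, ← hmp.setIntegral_preimage_emb Complex.measurableEquivRealProd.measurableEmbedding]
    refine integral_congr_ae (Eventually.of_forall fun w => ?_)
    simp [Complex.re_add_im]
  have hcont : ContinuousOn (fun p : ℝ × ℝ => F (p.1 + p.2 * Complex.I))
      (Icc 0 ℓ ×ˢ Icc c d) := by
    refine hF.comp (by fun_prop) fun p hp => mem_strip_add.2
      ⟨hac.trans_le hp.2.1, hp.2.2.trans_lt hdb⟩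
  have hFint : IntegrableOn (fun p : ℝ × ℝ => F (p.1 + p.2 * Complex.I))
      (Ioc c d ×ˢ Ico 0 ℓ |>.preimage Prod.swap) (volume.prod volume) := by
    refine (hcont.integrableOn_compact (isCompact_Icc.prod isCompact_Icc)).mono_set ?_
    rintro ⟨x, y⟩ ⟨h1, h2⟩
    exact ⟨Ico_subset_Icc_self h2, Ioc_subset_Icc_self h1⟩
  rw [h1, Measure.volume_eq_prod, ← setIntegral_prod_swap, setIntegral_prod,
    intervalIntegral.integral_of_le hcd]
  · refine setIntegral_congr_fun measurableSet_Ioc fun y _ => ?_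
    simp only [slice, intervalIntegral.integral_of_le hℓ, Prod.swap]
    exact setIntegral_congr_set Ico_ae_eq_Ioc
  · have := (Measure.measurePreserving_swap (μ := (volume : Measure ℝ))
      (ν := (volume : Measure ℝ))).integrableOn_comp_preimage
      (s := Ioc c d ×ˢ Ico 0 ℓ |>.preimage Prod.swap)
      (f := fun p : ℝ × ℝ => F (p.1 + p.2 * Complex.I)) MeasurableEquiv.prodComm.measurableEmbedding
    exact this.2 hFint

namespace Collar

variable {Ω : Set ℂ} {ℓ R : ℝ} {Q : ℂ → ℂ}

lemma injOn_reProdIm (H : Collar Ω ℓ R Q) {c d : ℝ} (hc : -R < c) (hd : d < R) :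
    InjOn Q (Ico 0 ℓ ×ℂ Ioc c d) := by
  intro z hz w hw hzw
  rw [Complex.mem_reProdIm] at hz hw
  obtain ⟨n, hn⟩ := H.inj z ⟨hc.trans hz.2.1, hz.2.2.trans_lt hd⟩ w
    ⟨hc.trans hw.2.1, hw.2.2.trans_lt hd⟩ hzw
  have hre : z.re = w.re + n * ℓ := by rw [hn]; simp
  have h1 : (n : ℝ) < 1 := by
    by_contra h
    nlinarith [H.period_pos, hz.1.2, hw.1.1, not_lt.1 h]
  have h2 : (-1 : ℝ) < n := by
    by_contra h
    nlinarith [H.period_pos, hz.1.1, hw.1.2, not_lt.1 h]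
  have h3 : n = 0 := by
    have h1' : n < 1 := by exact_mod_cast h1
    have h2' : -1 < n := by exact_mod_cast h2
    omega
  rw [hn, h3]; simp

lemma integral_image_eq (H : Collar Ω ℓ R Q) {G : ℂ → ℝ}
    (hG : ContinuousOn (fun w => ‖deriv Q w‖ ^ 2 * G (Q w)) (strip (-R) R)) {c d : ℝ}
    (hc : -R < c) (hcd : c ≤ d) (hd : d < R) :
    ∫ p in Q '' (Ico 0 ℓ ×ℂ Ioc c d), G p =
      ∫ y in c..d, slice ℓ (fun w => ‖deriv Q w‖ ^ 2 * G (Q w)) y := by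
  have hmem : ∀ w ∈ Ico 0 ℓ ×ℂ Ioc c d, w ∈ strip (-R) R := fun w hw =>
    ⟨hc.trans (Complex.mem_reProdIm.1 hw).2.1, (Complex.mem_reProdIm.1 hw).2.2.trans_lt hd⟩
  have hmeas : MeasurableSet (Ico 0 ℓ ×ℂ Ioc c d) :=
    (Complex.measurable_re measurableSet_Ico).inter (Complex.measurable_im measurableSet_Ioc)
  rw [integral_image_eq_integral_abs_det_fderiv_smul volume hmeas
    (fun w hw => ((H.differentiableAt (hmem w hw)).hasDerivAt.hasFDerivAt.restrictScalars
      ℝ).hasFDerivWithinAt) (H.injOn_reProdIm hc hd),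
    ← integral_reProdIm_eq H.period_pos.le hG hc hcd hd]
  refine setIntegral_congr_fun hmeas fun w _ => ?_
  simp [ContinuousLinearMap.det, LinearMap.det_restrictScalars, Algebra.norm_complex_eq,
    Complex.normSq_eq_norm_sq]

end Collar

/-- The inward flux of the vector field `(a, b)` through a level curve of the height in a
collar. -/
def flux (Q : ℂ → ℂ) (ℓ : ℝ) (a b : ℂ → ℝ) (y : ℝ) : ℝ :=
  slice ℓ (fun w => (starRingEnd ℂ (deriv Q w) * (a (Q w) + b (Q w) * Complex.I)).im) y

lemma contDiff_one_dx {a : ℂ → ℝ} (ha : ContDiff ℝ 1 a) : Continuous (dx a) :=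
  (ha.continuous_fderiv (by simp)).clm_apply continuous_const

lemma contDiff_one_dy {a : ℂ → ℝ} (ha : ContDiff ℝ 1 a) : Continuous (dy a) :=
  (ha.continuous_fderiv (by simp)).clm_apply continuous_const

lemma integral_mul_fderiv_add {χ a b : ℂ → ℝ} (hχ : ContDiff ℝ 1 χ) (hc : HasCompactSupport χ)
    (ha : ContDiff ℝ 1 a) (hb : ContDiff ℝ 1 b) :
    ∫ p, χ p * (dx a p + dy b p) = -∫ p, (dx χ p * a p + dy χ p * b p) := by
  have key : ∀ (a : ℂ → ℝ) (v : ℂ), ContDiff ℝ 1 a →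
      Integrable (fun p => χ p * fderiv ℝ a p v) ∧ Integrable (fun p => fderiv ℝ χ p v * a p) ∧
      ∫ p, χ p * fderiv ℝ a p v = -∫ p, fderiv ℝ χ p v * a p := by
    intro a v ha
    have hca : Continuous fun p => fderiv ℝ a p v :=
      (ha.continuous_fderiv (by simp)).clm_apply continuous_const
    have hcχ : Continuous fun p => fderiv ℝ χ p v :=
      (hχ.continuous_fderiv (by simp)).clm_apply continuous_const
    have h1 : Integrable (fun p => χ p * fderiv ℝ a p v) :=
      (hχ.continuous.mul hca).integrable_of_hasCompactSupport hc.mul_right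
    have h2 : Integrable (fun p => fderiv ℝ χ p v * a p) :=
      (hcχ.mul ha.continuous).integrable_of_hasCompactSupport
        ((hc.fderiv_apply (𝕜 := ℝ) v).mul_right)
    have h3 : Integrable (fun p => χ p * a p) :=
      (hχ.continuous.mul ha.continuous).integrable_of_hasCompactSupport hc.mul_right
    exact ⟨h1, h2, integral_mul_fderiv_eq_neg_fderiv_mul_of_integrable h2 h1 h3
      (fun p _ => hχ.differentiable (by simp) p) fun p _ => ha.differentiable (by simp) p⟩
  obtain ⟨a1, a2, a3⟩ := key a 1 ha
  obtain ⟨b1, b2, b3⟩ := key b Complex.I hb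
  simp only [dx, dy, mul_add]
  rw [integral_add a1 b1, integral_add a2 b2, a3, b3]
  ring

lemma deriv_eq_zero_of_eqOn_Iic {η : ℝ → ℝ} {c e : ℝ} (h : ∀ y ≤ c, η y = e) {y : ℝ}
    (hy : y < c) : deriv η y = 0 := by
  have : η =ᶠ[𝓝 y] fun _ => e := by
    filter_upwards [Iio_mem_nhds hy] with t ht using h t ht.le
  rw [this.deriv_eq]; simp

lemma deriv_eq_zero_of_eqOn_Ici {η : ℝ → ℝ} {d e : ℝ} (h : ∀ y, d ≤ y → η y = e) {y : ℝ}
    (hy : d < y) : deriv η y = 0 := by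
  have : η =ᶠ[𝓝 y] fun _ => e := by
    filter_upwards [Ioi_mem_nhds hy] with t ht using h t (le_of_lt ht)
  rw [this.deriv_eq]; simp

namespace Collar

variable {Ω : Set ℂ} {ℓ R : ℝ} {Q : ℂ → ℂ}

lemma continuousOn_deriv (H : Collar Ω ℓ R Q) : ContinuousOn (deriv Q) (strip (-R) R) :=
  (H.diff.deriv (isOpen_strip _ _)).continuousOn

lemma continuousOn_flux_integrand (H : Collar Ω ℓ R Q) {a b : ℂ → ℝ} (ha : Continuous a)
    (hb : Continuous b) : ContinuousOn
      (fun w => (starRingEnd ℂ (deriv Q w) * (a (Q w) + b (Q w) * Complex.I)).im)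
      (strip (-R) R) := by
  have h1 : ContinuousOn (fun w => starRingEnd ℂ (deriv Q w)) (strip (-R) R) :=
    Complex.continuous_conj.comp_continuousOn H.continuousOn_deriv
  have h2 : ContinuousOn (fun w => ((a (Q w) : ℝ) : ℂ)) (strip (-R) R) :=
    (Complex.continuous_ofReal.comp ha).comp_continuousOn H.diff.continuousOn
  have h3 : ContinuousOn (fun w => ((b (Q w) : ℝ) : ℂ)) (strip (-R) R) :=
    (Complex.continuous_ofReal.comp hb).comp_continuousOn H.diff.continuousOn
  exact Complex.continuous_im.comp_continuousOn (h1.mul (h2.add (h3.mul continuousOn_const)))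

lemma hasCompactSupport_cutoff (H : Collar Ω ℓ R Q) (η : ℝ → ℝ) :
    HasCompactSupport (cutoff Ω Q R η) :=
  HasCompactSupport.intro' H.isBounded.isCompact_closure isClosed_closure fun p hp =>
    cutoff_of_notMem p (fun h => hp (subset_closure h)) η

lemma integral_cutoff_mul (H : Collar Ω ℓ R Q) {η : ℝ → ℝ} (hη : ContDiff ℝ ∞ η) {c d : ℝ}
    (hc : 0 < c) (hcd : c ≤ d) (hdR : d < R) (h0 : ∀ y ≤ c, η y = 0)
    (h1 : ∀ y, d ≤ y → η y = 1) {a b : ℂ → ℝ} (ha : ContDiff ℝ 1 a) (hb : ContDiff ℝ 1 b) :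
    ∫ p, cutoff Ω Q R η p * (dx a p + dy b p) =
      -∫ y in (0 : ℝ)..d, deriv η y * flux Q ℓ a b y := by
  have h0' : ∀ y ≤ 0, η y = 0 := fun y hy => h0 y (hy.trans hc.le)
  have hχ := H.contDiff_cutoff hη h0' hdR h1
  rw [integral_mul_fderiv_add (hχ.of_le (by norm_cast)) (H.hasCompactSupport_cutoff η) ha hb]
  congr 1
  set D : ℂ → ℝ := fun p =>
    dx (cutoff Ω Q R η) p * a p + dy (cutoff Ω Q R η) p * b p with hD
  have hDzero : ∀ p, p ∉ Q '' (Ico 0 ℓ ×ℂ Ioc 0 d) → D p = 0 := by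
    intro p hp
    by_cases hps : p ∈ Q '' strip (-R) R
    · obtain ⟨w, hw, rfl⟩ := hps
      have hη0 : deriv η w.im = 0 := by
        by_cases hle : w.im ≤ 0
        · exact deriv_eq_zero_of_eqOn_Iic h0 (hle.trans_lt hc)
        · by_cases hgt : d < w.im
          · exact deriv_eq_zero_of_eqOn_Ici h1 hgt
          · obtain ⟨n, hn, hnim⟩ := exists_shift_mem_Ico H.period_pos w
            exact absurd ⟨w + n * ℓ, Complex.mem_reProdIm.2 ⟨hn, by
              rw [hnim]; exact ⟨not_le.1 hle, not_lt.1 hgt⟩⟩, periodic_int H.periodic n w⟩ hp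
      simp only [hD, dx, dy, H.fderiv_cutoff_apply hη h0' hdR h1 hw, hη0]
      ring
    · simp [hD, dx, dy, H.fderiv_cutoff_eq_zero h0' hdR h1 hps]
  have hDQ : ∀ w ∈ strip (-R) R, ‖deriv Q w‖ ^ 2 * D (Q w) = deriv η w.im *
      (starRingEnd ℂ (deriv Q w) * (a (Q w) + b (Q w) * Complex.I)).im := by
    intro w hw
    simp only [hD, dx, dy, H.fderiv_cutoff_apply hη h0' hdR h1 hw]
    have hne := H.deriv_ne w hw
    have hn : ‖deriv Q w‖ ^ 2 ≠ 0 := by simpa using hne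
    rw [← Complex.normSq_eq_norm_sq] at hn ⊢
    simp only [Complex.div_im, Complex.mul_im, Complex.add_re, Complex.add_im, Complex.mul_re,
      Complex.ofReal_re, Complex.ofReal_im, Complex.I_re, Complex.I_im, Complex.conj_re,
      Complex.conj_im, Complex.one_re, Complex.one_im]
    field_simp
    ring
  have hηc : Continuous fun w : ℂ => deriv η w.im :=
    (hη.continuous_deriv (by norm_cast)).comp Complex.continuous_im
  have hcont : ContinuousOn (fun w => ‖deriv Q w‖ ^ 2 * D (Q w)) (strip (-R) R) :=
    (hηc.continuousOn.mul (H.continuousOn_flux_integrand ha.continuous hb.continuous)).congr hDQ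
  rw [← setIntegral_eq_integral_of_forall_compl_eq_zero hDzero,
    H.integral_image_eq hcont (neg_neg_of_pos H.width_pos) (hc.le.trans hcd) hdR]
  refine intervalIntegral.integral_congr fun y hy => ?_
  rw [uIcc_of_le (hc.le.trans hcd)] at hy
  simp only [flux, slice]
  rw [← intervalIntegral.integral_const_mul]
  refine intervalIntegral.integral_congr fun x _ => ?_
  rw [hDQ _ (mem_strip_add.2 ⟨(neg_neg_of_pos H.width_pos).trans_le hy.1, hy.2.trans_lt hdR⟩)]
  simp

lemma continuousOn_flux (H : Collar Ω ℓ R Q) {a b : ℂ → ℝ} (ha : Continuous a)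
    (hb : Continuous b) : ContinuousOn (flux Q ℓ a b) (Ioo (-R) R) :=
  continuousOn_slice (H.continuousOn_flux_integrand ha hb) ℓ

end Collar

/-- A smooth step from `0` on `(-∞, δ]` to `1` on `[2δ, ∞)`. -/
def step (δ y : ℝ) : ℝ := Real.smoothTransition ((y - δ) / δ)

lemma contDiff_step (δ : ℝ) : ContDiff ℝ ∞ (step δ) :=
  Real.smoothTransition.contDiff.comp ((contDiff_id.sub contDiff_const).div_const δ)

lemma step_eq_zero {δ y : ℝ} (hδ : 0 < δ) (hy : y ≤ δ) : step δ y = 0 :=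
  Real.smoothTransition.zero_of_nonpos (div_nonpos_of_nonpos_of_nonneg (by linarith) hδ.le)

lemma step_eq_one {δ y : ℝ} (hδ : 0 < δ) (hy : 2 * δ ≤ y) : step δ y = 1 :=
  Real.smoothTransition.one_of_one_le ((one_le_div hδ).2 (by linarith))

lemma step_monotone {δ : ℝ} (hδ : 0 < δ) : Monotone (step δ) := fun x y hxy =>
  Real.smoothTransition.monotone (by gcongr)

lemma abs_integral_deriv_step_mul_sub_le {δ ε : ℝ} (hδ : 0 < δ) {Ψ : ℝ → ℝ}
    (hΨ : ContinuousOn Ψ (Icc 0 (2 * δ))) {L : ℝ} (h : ∀ y ∈ Icc 0 (2 * δ), |Ψ y - L| ≤ ε) :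
    |(∫ y in (0 : ℝ)..(2 * δ), deriv (step δ) y * Ψ y) - L| ≤ ε := by
  have hd : Continuous (deriv (step δ)) := (contDiff_step δ).continuous_deriv (by norm_cast)
  have h2 : (0 : ℝ) ≤ 2 * δ := by positivity
  have hFint : ∫ y in (0 : ℝ)..(2 * δ), deriv (step δ) y = 1 := by
    rw [intervalIntegral.integral_eq_sub_of_hasDerivAt
      (fun x _ => (((contDiff_step δ).differentiable (by simp)) x).hasDerivAt)
      (hd.intervalIntegrable _ _), step_eq_one hδ le_rfl, step_eq_zero hδ hδ.le, sub_zero]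
  have hΨ' : ContinuousOn Ψ (uIcc 0 (2 * δ)) := by rwa [uIcc_of_le h2]
  have i1 : IntervalIntegrable (fun y => deriv (step δ) y * Ψ y) volume 0 (2 * δ) :=
    (hd.continuousOn.mul hΨ').intervalIntegrable
  have i2 : IntervalIntegrable (fun y => deriv (step δ) y * L) volume 0 (2 * δ) :=
    (hd.mul continuous_const).intervalIntegrable _ _
  have heq : (∫ y in (0 : ℝ)..(2 * δ), deriv (step δ) y * Ψ y) - L =
      ∫ y in (0 : ℝ)..(2 * δ), (deriv (step δ) y * Ψ y - deriv (step δ) y * L) := by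
    rw [intervalIntegral.integral_sub i1 i2, intervalIntegral.integral_mul_const, hFint, one_mul]
  rw [heq, ← Real.norm_eq_abs]
  calc _ ≤ ∫ y in (0 : ℝ)..(2 * δ), deriv (step δ) y * ε := by
        refine intervalIntegral.norm_integral_le_of_norm_le h2 ?_
          ((hd.mul continuous_const).intervalIntegrable _ _)
        refine Eventually.of_forall fun y hy => ?_
        rw [← mul_sub, norm_mul, Real.norm_of_nonneg (step_monotone hδ).deriv_nonneg]
        exact mul_le_mul_of_nonneg_left (h y (Ioc_subset_Icc_self hy))
          (step_monotone hδ).deriv_nonneg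
    _ = ε := by rw [intervalIntegral.integral_mul_const, hFint, one_mul]

namespace Collar

variable {Ω : Set ℂ} {ℓ R : ℝ} {Q : ℂ → ℂ}

lemma tendsto_cutoff_step (H : Collar Ω ℓ R Q) (p : ℂ) :
    ∀ᶠ δ in 𝓝[>] (0 : ℝ), cutoff Ω Q R (step δ) p = Ω.indicator (fun _ => 1) p := by
  by_cases hp : p ∈ Ω
  · rw [indicator_of_mem hp]
    by_cases hps : p ∈ Q '' strip 0 R
    · obtain ⟨w, hw, rfl⟩ := hps
      filter_upwards [Ioo_mem_nhdsGT (show (0 : ℝ) < w.im / 2 by linarith [hw.1])] with δ hδ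
      rw [H.cutoff_apply (fun y hy => step_eq_zero hδ.1 (hy.trans hδ.1.le))
        (H.strip_zero_subset hw), step_eq_one hδ.1 (by linarith [hδ.2])]
    · exact Eventually.of_forall fun δ => by rw [cutoff, if_pos hp, if_neg hps]
  · rw [indicator_of_notMem hp]
    exact Eventually.of_forall fun δ => cutoff_of_notMem p hp _

lemma norm_cutoff_step_le (p : ℂ) (δ : ℝ) :
    ‖cutoff Ω Q R (step δ) p‖ ≤ Ω.indicator (fun _ => (1 : ℝ)) p := by
  by_cases hp : p ∈ Ω
  · rw [indicator_of_mem hp, cutoff, if_pos hp]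
    split_ifs
    · rw [step, Real.norm_of_nonneg (Real.smoothTransition.nonneg _)]
      exact Real.smoothTransition.le_one _
    · simp
  · rw [indicator_of_notMem hp, cutoff_of_notMem p hp]
    simp

lemma integrableOn (H : Collar Ω ℓ R Q) {F : ℂ → ℝ} (hF : Continuous F) : IntegrableOn F Ω :=
  (hF.continuousOn.integrableOn_compact H.isBounded.isCompact_closure).mono_set subset_closure

/-- The divergence theorem for a bounded open set with a collar. -/
lemma integral_divergence (H : Collar Ω ℓ R Q) {a b : ℂ → ℝ} (ha : ContDiff ℝ 1 a)
    (hb : ContDiff ℝ 1 b) : ∫ p in Ω, (dx a p + dy b p) = -flux Q ℓ a b 0 := by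
  set F : ℂ → ℝ := fun p => dx a p + dy b p with hF
  have hFc : Continuous F := (contDiff_one_dx ha).add (contDiff_one_dy hb)
  have hlim1 : Tendsto (fun δ => ∫ p, cutoff Ω Q R (step δ) p * F p) (𝓝[>] 0)
      (𝓝 (∫ p in Ω, F p)) := by
    have hind : ∫ p in Ω, F p = ∫ p, Ω.indicator (fun _ => (1 : ℝ)) p * F p := by
      rw [← integral_indicator H.isOpen.measurableSet]
      refine integral_congr_ae (Eventually.of_forall fun p => ?_)
      by_cases hp : p ∈ Ω <;> simp [hp]
    rw [hind]
    have hsmall : ∀ᶠ δ in 𝓝[>] (0 : ℝ), 0 < δ ∧ 2 * δ < R := by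
      filter_upwards [Ioo_mem_nhdsGT (show (0 : ℝ) < R / 2 by linarith [H.width_pos])] with δ hδ
      exact ⟨hδ.1, by linarith [hδ.2]⟩
    refine tendsto_integral_filter_of_dominated_convergence
      (Ω.indicator fun p => ‖F p‖) ?_ ?_ ?_ ?_
    · filter_upwards [hsmall] with δ hδ
      exact ((H.contDiff_cutoff (contDiff_step δ)
        (fun y hy => step_eq_zero hδ.1 (hy.trans hδ.1.le)) hδ.2
        (fun y hy => step_eq_one hδ.1 hy)).continuous.mul hFc).aestronglyMeasurable
    · refine Eventually.of_forall fun δ => Eventually.of_forall fun p => ?_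
      rw [norm_mul]
      refine (mul_le_mul_of_nonneg_right (norm_cutoff_step_le p δ) (norm_nonneg _)).trans ?_
      by_cases hp : p ∈ Ω <;> simp [hp]
    · rw [integrable_indicator_iff H.isOpen.measurableSet]
      exact H.integrableOn hFc.norm
    · refine Eventually.of_forall fun p => ?_
      refine (tendsto_const_nhds.congr' ?_)
      filter_upwards [H.tendsto_cutoff_step p] with δ hδ
      rw [hδ]
  have hlim2 : Tendsto (fun δ => ∫ p, cutoff Ω Q R (step δ) p * F p) (𝓝[>] 0)
      (𝓝 (-flux Q ℓ a b 0)) := by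
    rw [Metric.tendsto_nhds]
    intro ε hε
    have hcont := H.continuousOn_flux ha.continuous hb.continuous
    have h0 : (0 : ℝ) ∈ Ioo (-R) R := ⟨neg_neg_of_pos H.width_pos, H.width_pos⟩
    obtain ⟨r, hr, hr'⟩ := Metric.continuousAt_iff.1
      (hcont.continuousAt (Ioo_mem_nhds h0.1 h0.2)) (ε / 2) (by positivity)
    have hpos : 0 < min (r / 2) (R / 2) := lt_min (by positivity) (by linarith [H.width_pos])
    filter_upwards [Ioo_mem_nhdsGT hpos] with δ hδ
    have hδr : 2 * δ < r := by linarith [hδ.2.trans_le (min_le_left _ _)]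
    have hδR : 2 * δ < R := by linarith [hδ.2.trans_le (min_le_right _ _)]
    rw [H.integral_cutoff_mul (contDiff_step δ) hδ.1 (by linarith [hδ.1]) hδR
      (fun y hy => step_eq_zero hδ.1 hy) (fun y hy => step_eq_one hδ.1 hy) ha hb,
      dist_neg_neg, Real.dist_eq]
    refine (abs_integral_deriv_step_mul_sub_le hδ.1 (hcont.mono fun y hy =>
      ⟨h0.1.trans_le hy.1, hy.2.trans_lt hδR⟩) (ε := ε / 2) fun y hy => ?_).trans_lt
      (by linarith)
    rw [← Real.dist_eq]
    refine (hr' ?_).le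
    rw [Real.dist_eq, sub_zero, abs_of_nonneg hy.1]
    exact hy.2.trans_lt hδr
  exact tendsto_nhds_unique hlim1 hlim2

end Collar

lemma fderiv_apply_eq (f : ℂ → ℝ) (p v : ℂ) :
    fderiv ℝ f p v = v.re * dx f p + v.im * dy f p := by
  have hv : v = v.re • (1 : ℂ) + v.im • Complex.I := by simp [Complex.re_add_im]
  nth_rewrite 1 [hv]
  rw [map_add, map_smul, map_smul]
  rfl

lemma fderiv_apply_one (f : ℂ → ℝ) (p : ℂ) : fderiv ℝ f p 1 = dx f p := rfl

lemma fderiv_apply_I (f : ℂ → ℝ) (p : ℂ) : fderiv ℝ f p Complex.I = dy f p := rfl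

lemma contDiff_dx {f : ℂ → ℝ} (hf : ContDiff ℝ ∞ f) : ContDiff ℝ ∞ (dx f) := by
  rw [← contDiffOn_univ] at *
  exact contDiffOn_dx isOpen_univ hf

lemma contDiff_dy {f : ℂ → ℝ} (hf : ContDiff ℝ ∞ f) : ContDiff ℝ ∞ (dy f) := by
  rw [← contDiffOn_univ] at *
  exact contDiffOn_dy isOpen_univ hf

/-- The gradient energy density. -/
def gradSq (f : ℂ → ℝ) (p : ℂ) : ℝ := dx f p ^ 2 + dy f p ^ 2

lemma continuous_gradSq {f : ℂ → ℝ} (hf : ContDiff ℝ ∞ f) : Continuous (gradSq f) :=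
  ((contDiff_dx hf).continuous.pow 2).add ((contDiff_dy hf).continuous.pow 2)

section VectorFields

variable {f : ℂ → ℝ} (hf : ContDiff ℝ ∞ f) (p : ℂ)
include hf

lemma divergence_mul_gradient :
    dx (fun z => f z * dx f z) p + dy (fun z => f z * dy f z) p =
      gradSq f p + f p * (dx (dx f) p + dy (dy f) p) := by
  have h0 := (hf.differentiable (by simp)) p
  have h1 := ((contDiff_dx hf).differentiable (by simp)) p
  have h2 := ((contDiff_dy hf).differentiable (by simp)) p
  rw [dx_mul h0 h1, dy_mul h0 h2, gradSq]
  ring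

lemma divergence_sq_mul_id :
    dx (fun z => f z ^ 2 * z.re) p + dy (fun z => f z ^ 2 * z.im) p =
      2 * f p ^ 2 + 2 * f p * (p.re * dx f p + p.im * dy f p) := by
  have h0 := ((hf.differentiable (by simp)) p).hasFDerivAt
  have hre : HasFDerivAt (fun z : ℂ => z.re) Complex.reCLM p := Complex.reCLM.hasFDerivAt
  have him : HasFDerivAt (fun z : ℂ => z.im) Complex.imCLM p := Complex.imCLM.hasFDerivAt
  have hx : dx (fun z => f z ^ 2 * z.re) p = f p ^ 2 + 2 * f p * dx f p * p.re := by
    refine (congrArg (fun L : ℂ →L[ℝ] ℝ => L 1) (HasFDerivAt.fderiv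
      ((h0.pow 2).mul hre))).trans ?_
    simp [dx]; ring
  have hy : dy (fun z => f z ^ 2 * z.im) p = f p ^ 2 + 2 * f p * dy f p * p.im := by
    refine (congrArg (fun L : ℂ →L[ℝ] ℝ => L Complex.I) (HasFDerivAt.fderiv
      ((h0.pow 2).mul him))).trans ?_
    simp [dy]; ring
  rw [hx, hy]; ring

lemma divergence_rellich (c : ℝ) :
    dx (fun z => 2 * (z.re * dx f z + z.im * dy f z) * dx f z
        - (dx f z ^ 2 + dy f z ^ 2 - c * f z ^ 2) * z.re) p +
      dy (fun z => 2 * (z.re * dx f z + z.im * dy f z) * dy f z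
        - (dx f z ^ 2 + dy f z ^ 2 - c * f z ^ 2) * z.im) p =
      2 * c * f p ^ 2 + 2 * (p.re * dx f p + p.im * dy f p) *
        (dx (dx f) p + dy (dy f) p + c * f p) := by
  have h0 := ((hf.differentiable (by simp)) p).hasFDerivAt
  have h1 := (((contDiff_dx hf).differentiable (by simp)) p).hasFDerivAt
  have h2 := (((contDiff_dy hf).differentiable (by simp)) p).hasFDerivAt
  have hre : HasFDerivAt (fun z : ℂ => z.re) Complex.reCLM p := Complex.reCLM.hasFDerivAt
  have him : HasFDerivAt (fun z : ℂ => z.im) Complex.imCLM p := Complex.imCLM.hasFDerivAt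
  have hzf := ((hre.mul h1).add (him.mul h2)).const_mul 2
  have hE := ((h1.pow 2).add (h2.pow 2)).sub ((h0.pow 2).const_mul c)
  have hcomm : dx (dy f) p = dy (dx f) p :=
    dx_dy_comm isOpen_univ hf.contDiffOn (mem_univ p)
  have hx : dx (fun z => 2 * (z.re * dx f z + z.im * dy f z) * dx f z
        - (dx f z ^ 2 + dy f z ^ 2 - c * f z ^ 2) * z.re) p =
      2 * (dx f p + p.re * dx (dx f) p + p.im * dx (dy f) p) * dx f p +
      2 * (p.re * dx f p + p.im * dy f p) * dx (dx f) p -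
      (2 * dx f p * dx (dx f) p + 2 * dy f p * dx (dy f) p - 2 * c * f p * dx f p) * p.re -
      (dx f p ^ 2 + dy f p ^ 2 - c * f p ^ 2) := by
    refine (congrArg (fun L : ℂ →L[ℝ] ℝ => L 1) (HasFDerivAt.fderiv
      ((hzf.mul h1).sub (hE.mul hre)))).trans ?_
    simp [fderiv_apply_one]
    ring
  have hy : dy (fun z => 2 * (z.re * dx f z + z.im * dy f z) * dy f z
        - (dx f z ^ 2 + dy f z ^ 2 - c * f z ^ 2) * z.im) p =
      2 * (dy f p + p.re * dy (dx f) p + p.im * dy (dy f) p) * dy f p +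
      2 * (p.re * dx f p + p.im * dy f p) * dy (dy f) p -
      (2 * dx f p * dy (dx f) p + 2 * dy f p * dy (dy f) p - 2 * c * f p * dy f p) * p.im -
      (dx f p ^ 2 + dy f p ^ 2 - c * f p ^ 2) := by
    refine (congrArg (fun L : ℂ →L[ℝ] ℝ => L Complex.I) (HasFDerivAt.fderiv
      ((hzf.mul h2).sub (hE.mul him)))).trans ?_
    simp [fderiv_apply_I]
    ring
  rw [hx, hy, hcomm]
  ring

end VectorFields

/-- `f` solves the Neumann eigenvalue problem in the collared domain `Ω`. -/
structure NeumannMode (Ω : Set ℂ) (Q : ℂ → ℂ) (lam : ℝ) (f : ℂ → ℝ) : Prop where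
  smooth : ContDiff ℝ ∞ f
  eigen : ∀ p ∈ Ω, dx (dx f) p + dy (dy f) p = -lam ^ 2 * f p
  neumann : ∀ x : ℝ, (deriv Q x).re * dy f (Q x) - (deriv Q x).im * dx f (Q x) = 0

lemma Collar.exists_norm_le {Ω : Set ℂ} {ℓ R : ℝ} {Q : ℂ → ℂ} (H : Collar Ω ℓ R Q) :
    ∃ D > 0, (∀ p ∈ Ω, ‖p‖ ≤ D) ∧ ∀ x : ℝ, ‖Q x‖ ≤ D := by
  obtain ⟨D₁, hD₁⟩ := H.isBounded.exists_norm_le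
  have hc : Continuous fun x : ℝ => Q x := by
    refine H.diff.continuousOn.comp_continuous Complex.continuous_ofReal fun x => ?_
    exact ofReal_mem_strip H.width_pos x
  have hp : Function.Periodic (fun x : ℝ => Q x) ℓ := fun x => by
    simpa using H.periodic (x : ℂ)
  obtain ⟨D₂, hD₂⟩ := (hp.isBounded_of_continuous H.period_pos.ne' hc).exists_norm_le
  refine ⟨max 1 (max D₁ D₂), by positivity, fun p hpΩ => ?_, fun x => ?_⟩
  · exact (hD₁ p hpΩ).trans ((le_max_left _ _).trans (le_max_right _ _))
  · exact (hD₂ _ ⟨x, rfl⟩).trans ((le_max_right _ _).trans (le_max_right _ _))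

namespace NeumannMode

variable {Ω : Set ℂ} {ℓ R : ℝ} {Q : ℂ → ℂ} {lam : ℝ} {f : ℂ → ℝ}

lemma flux_integrand_eq (v : ℂ) (a b : ℝ) :
    (starRingEnd ℂ v * (a + b * Complex.I)).im = v.re * b - v.im * a := by
  simp; ring

lemma abs_re_mul_im_sub_le {v p : ℂ} {D : ℝ} (hv : ‖v‖ = 1) (hp : ‖p‖ ≤ D) :
    |v.re * p.im - v.im * p.re| ≤ D := by
  have h : v.re * p.im - v.im * p.re = (starRingEnd ℂ v * p).im := by simp; ring
  rw [h]
  refine (Complex.abs_im_le_norm _).trans ?_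
  simpa [hv] using hp

/-- The energy identity. -/
lemma integral_gradSq (N : NeumannMode Ω Q lam f) (H : Collar Ω ℓ R Q) :
    ∫ p in Ω, gradSq f p = lam ^ 2 * ∫ p in Ω, f p ^ 2 := by
  have hs : ContDiff ℝ 1 f := N.smooth.of_le (by norm_cast)
  have ha := hs.mul ((contDiff_dx N.smooth).of_le (m := 1) (by norm_cast))
  have hb := hs.mul ((contDiff_dy N.smooth).of_le (m := 1) (by norm_cast))
  have h := H.integral_divergence ha hb
  have hflux : flux Q ℓ (fun z => f z * dx f z) (fun z => f z * dy f z) 0 = 0 := by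
    have : ∀ x : ℝ, (starRingEnd ℂ (deriv Q x) * (((f (Q x) * dx f (Q x) : ℝ) : ℂ) +
        ((f (Q x) * dy f (Q x) : ℝ) : ℂ) * Complex.I)).im = 0 := fun x => by
      rw [flux_integrand_eq]
      linear_combination f (Q x) * N.neumann x
    simp [flux, slice, -Complex.mul_im, this, -Complex.ofReal_mul]
  rw [hflux, neg_zero] at h
  have hcongr : ∫ p in Ω, (dx (fun z => f z * dx f z) p + dy (fun z => f z * dy f z) p) =
      ∫ p in Ω, (gradSq f p - lam ^ 2 * f p ^ 2) := by
    refine setIntegral_congr_fun H.isOpen.measurableSet fun p hp => ?_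
    rw [divergence_mul_gradient N.smooth p, N.eigen p hp]
    ring
  have i1 : IntegrableOn (fun p => f p ^ 2) Ω := H.integrableOn (N.smooth.continuous.pow 2)
  rw [hcongr, integral_sub (H.integrableOn (continuous_gradSq N.smooth)) (i1.const_mul _),
    integral_const_mul] at h
  linarith

lemma continuous_comp_ofReal (H : Collar Ω ℓ R Q) {F : ℂ → ℝ} (hF : Continuous F) :
    Continuous fun x : ℝ => F (Q x) :=
  hF.comp (H.diff.continuousOn.comp_continuous Complex.continuous_ofReal
    fun x => ofReal_mem_strip H.width_pos x)

lemma abs_flux_le (H : Collar Ω ℓ R Q) {a b F : ℂ → ℝ} (hF : Continuous F)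
    (h : ∀ x : ℝ, |(deriv Q x).re * b (Q x) - (deriv Q x).im * a (Q x)| ≤ F (Q x)) :
    |flux Q ℓ a b 0| ≤ ∫ x in (0 : ℝ)..ℓ, F (Q x) := by
  have := intervalIntegral.norm_integral_le_of_norm_le (μ := volume) H.period_pos.le
    (f := fun x : ℝ => (starRingEnd ℂ (deriv Q x) * (a (Q x) + b (Q x) * Complex.I)).im)
    (g := fun x : ℝ => F (Q x))
    (Eventually.of_forall fun x _ => by
      rw [flux_integrand_eq, Real.norm_eq_abs]; exact h x)
    ((continuous_comp_ofReal H hF).intervalIntegrable _ _)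
  simpa [flux, slice] using this

lemma integral_sq_le (N : NeumannMode Ω Q lam f) (H : Collar Ω ℓ R Q) {D : ℝ}
    (hD : ∀ p ∈ Ω, ‖p‖ ≤ D) (hD' : ∀ x : ℝ, ‖Q x‖ ≤ D) :
    ∫ p in Ω, f p ^ 2 ≤
      D * (∫ x in (0 : ℝ)..ℓ, f (Q x) ^ 2) + D ^ 2 * lam ^ 2 * ∫ p in Ω, f p ^ 2 := by
  have hs : ContDiff ℝ 1 f := N.smooth.of_le (by norm_cast)
  have ha : ContDiff ℝ 1 fun z : ℂ => f z ^ 2 * z.re :=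
    (hs.pow 2).mul Complex.reCLM.contDiff
  have hb : ContDiff ℝ 1 fun z : ℂ => f z ^ 2 * z.im :=
    (hs.pow 2).mul Complex.imCLM.contDiff
  have h := H.integral_divergence ha hb
  have hfl := abs_flux_le H (a := fun z : ℂ => f z ^ 2 * z.re) (b := fun z : ℂ => f z ^ 2 * z.im)
    (F := fun p => D * f p ^ 2) (continuous_const.mul (N.smooth.continuous.pow 2)) fun x => by
      have h1 := abs_re_mul_im_sub_le (H.unit x) (hD' x)
      have : (deriv Q x).re * (f (Q x) ^ 2 * (Q x).im) - (deriv Q x).im *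
          (f (Q x) ^ 2 * (Q x).re) =
          ((deriv Q x).re * (Q x).im - (deriv Q x).im * (Q x).re) * f (Q x) ^ 2 := by ring
      refine (congrArg abs this).trans_le ?_
      rw [abs_mul, abs_of_nonneg (sq_nonneg (f (Q x)))]
      gcongr
  rw [intervalIntegral.integral_const_mul] at hfl
  have i1 : IntegrableOn (fun p => f p ^ 2) Ω := H.integrableOn (N.smooth.continuous.pow 2)
  have i2 := H.integrableOn (continuous_gradSq N.smooth)
  have hmono : ∫ p in Ω, (f p ^ 2 - D ^ 2 * gradSq f p) ≤
      ∫ p in Ω, (dx (fun z => f z ^ 2 * z.re) p + dy (fun z => f z ^ 2 * z.im) p) := by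
    refine setIntegral_mono_on (i1.sub (i2.const_mul _))
      (H.integrableOn ((contDiff_one_dx ha).add (contDiff_one_dy hb)))
      H.isOpen.measurableSet fun p hp => ?_
    rw [divergence_sq_mul_id N.smooth p]
    have hcs : (p.re * dx f p + p.im * dy f p) ^ 2 ≤ D ^ 2 * gradSq f p := by
      have h1 : (p.re * dx f p + p.im * dy f p) ^ 2 ≤ ‖p‖ ^ 2 * gradSq f p := by
        rw [← Complex.normSq_eq_norm_sq, Complex.normSq_apply, gradSq]
        nlinarith [sq_nonneg (p.re * dy f p - p.im * dx f p)]
      have h2 : ‖p‖ ^ 2 ≤ D ^ 2 := pow_le_pow_left₀ (norm_nonneg _) (hD p hp) 2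
      have h3 : 0 ≤ gradSq f p := add_nonneg (sq_nonneg _) (sq_nonneg _)
      exact h1.trans (mul_le_mul_of_nonneg_right h2 h3)
    nlinarith [sq_nonneg (f p + (p.re * dx f p + p.im * dy f p))]
  rw [integral_sub i1 (i2.const_mul _), integral_const_mul, N.integral_gradSq H, h] at hmono
  have := neg_abs_le (flux Q ℓ (fun z : ℂ => f z ^ 2 * z.re) (fun z : ℂ => f z ^ 2 * z.im) 0)
  linarith

/-- The Rellich identity bounds the interior mass by boundary data. -/
lemma integral_sq_le_boundary (N : NeumannMode Ω Q lam f) (H : Collar Ω ℓ R Q) {D : ℝ}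
    (hD' : ∀ x : ℝ, ‖Q x‖ ≤ D) :
    2 * lam ^ 2 * ∫ p in Ω, f p ^ 2 ≤ D * ((∫ x in (0 : ℝ)..ℓ, gradSq f (Q x)) +
      lam ^ 2 * ∫ x in (0 : ℝ)..ℓ, f (Q x) ^ 2) := by
  have hs : ContDiff ℝ 1 f := N.smooth.of_le (by norm_cast)
  have hsx : ContDiff ℝ 1 (dx f) := (contDiff_dx N.smooth).of_le (by norm_cast)
  have hsy : ContDiff ℝ 1 (dy f) := (contDiff_dy N.smooth).of_le (by norm_cast)
  have hre : ContDiff ℝ 1 fun z : ℂ => z.re := Complex.reCLM.contDiff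
  have him : ContDiff ℝ 1 fun z : ℂ => z.im := Complex.imCLM.contDiff
  have hX := contDiff_const (c := (2 : ℝ)).mul ((hre.mul hsx).add (him.mul hsy))
  have hE := ((hsx.pow 2).add (hsy.pow 2)).sub
    ((contDiff_const (c := lam ^ 2)).mul (hs.pow 2))
  have h := H.integral_divergence ((hX.mul hsx).sub (hE.mul hre)) ((hX.mul hsy).sub (hE.mul him))
  have hcongr := Eq.trans (a := ∫ p in Ω, 2 * lam ^ 2 * f p ^ 2) ?_ h
  swap
  · refine setIntegral_congr_fun H.isOpen.measurableSet fun p hp => ?_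
    refine Eq.trans ?_ (divergence_rellich N.smooth p (lam ^ 2)).symm
    rw [N.eigen p hp]
    ring
  rw [integral_const_mul] at hcongr
  rw [hcongr]
  refine (neg_le_abs _).trans ((abs_flux_le H (F := fun p => D * (gradSq f p + lam ^ 2 * f p ^ 2))
    (continuous_const.mul ((continuous_gradSq N.smooth).add
      (continuous_const.mul (N.smooth.continuous.pow 2)))) fun x => ?_).trans_eq ?_)
  · have h1 := abs_re_mul_im_sub_le (H.unit x) (hD' x)
    have hn := N.neumann x
    have : (deriv Q x).re * (2 * ((Q x).re * dx f (Q x) + (Q x).im * dy f (Q x)) * dy f (Q x)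
          - (dx f (Q x) ^ 2 + dy f (Q x) ^ 2 - lam ^ 2 * f (Q x) ^ 2) * (Q x).im) -
        (deriv Q x).im * (2 * ((Q x).re * dx f (Q x) + (Q x).im * dy f (Q x)) * dx f (Q x)
          - (dx f (Q x) ^ 2 + dy f (Q x) ^ 2 - lam ^ 2 * f (Q x) ^ 2) * (Q x).re) =
        -(((deriv Q x).re * (Q x).im - (deriv Q x).im * (Q x).re) *
          (gradSq f (Q x) - lam ^ 2 * f (Q x) ^ 2)) := by
      rw [gradSq]
      linear_combination 2 * ((Q x).re * dx f (Q x) + (Q x).im * dy f (Q x)) * hn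
    refine (congrArg abs this).trans_le ?_
    rw [abs_neg, abs_mul]
    have h3 : 0 ≤ gradSq f (Q x) := add_nonneg (sq_nonneg _) (sq_nonneg _)
    have h4 : 0 ≤ lam ^ 2 * f (Q x) ^ 2 := by positivity
    have h5 : |gradSq f (Q x) - lam ^ 2 * f (Q x) ^ 2| ≤ gradSq f (Q x) + lam ^ 2 * f (Q x) ^ 2 :=
      abs_le.2 ⟨by linarith, by linarith⟩
    exact mul_le_mul h1 h5 (abs_nonneg _) ((norm_nonneg _).trans (hD' x))
  · have c1 : Continuous fun x : ℝ => f (Q x) ^ 2 :=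
      continuous_comp_ofReal H (N.smooth.continuous.pow 2)
    rw [intervalIntegral.integral_const_mul, intervalIntegral.integral_add
      ((continuous_comp_ofReal H (continuous_gradSq N.smooth)).intervalIntegrable _ _)
      ((c1.const_mul _).intervalIntegrable _ _),
      intervalIntegral.integral_const_mul]

end NeumannMode

lemma exists_abs_le_of_periodic {F : ℂ → ℝ} {a b c d ℓ : ℝ} (hℓ : 0 < ℓ)
    (hF : ContinuousOn F (strip a b)) (hp : ∀ z, F (z + ℓ) = F z) (hc : a < c) (hd : d < b) :
    ∃ M > 0, ∀ w : ℂ, c ≤ w.im → w.im ≤ d → |F w| ≤ M := by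
  have hK : IsCompact (Icc 0 ℓ ×ℂ Icc c d) := isCompact_Icc.reProdIm isCompact_Icc
  obtain ⟨M, hM⟩ := hK.exists_bound_of_continuousOn (f := F) (hF.mono fun w hw =>
    ⟨hc.trans_le (Complex.mem_reProdIm.1 hw).2.1, (Complex.mem_reProdIm.1 hw).2.2.trans_lt hd⟩)
  refine ⟨max 1 M, by positivity, fun w h1 h2 => ?_⟩
  obtain ⟨n, hn, him⟩ := exists_shift_mem_Ico hℓ w
  have hFn : F (w + n * ℓ) = F w := Function.Periodic.int_mul (f := F) (c := (ℓ : ℂ)) hp n w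
  rw [← hFn]
  exact (hM _ (Complex.mem_reProdIm.2 ⟨Ico_subset_Icc_self hn, by rw [him]; exact ⟨h1, h2⟩⟩)).trans
    (le_max_right _ _)

section HolomorphicParts

variable {h : ℂ → ℂ} {w : ℂ}

lemma fderiv_real_apply (hh : DifferentiableAt ℂ h w) (v : ℂ) :
    fderiv ℝ h w v = deriv h w * v := by
  rw [hh.fderiv_restrictScalars ℝ]
  simp [mul_comm]

lemma fderiv_re_apply (hh : DifferentiableAt ℂ h w) (v : ℂ) :
    fderiv ℝ (fun z => (h z).re) w v = (deriv h w * v).re := by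
  have := (Complex.reCLM.hasFDerivAt.comp w (hh.restrictScalars ℝ).hasFDerivAt).fderiv
  rw [← fderiv_real_apply hh]
  exact congrArg (fun L : ℂ →L[ℝ] ℝ => L v) this

lemma fderiv_im_apply (hh : DifferentiableAt ℂ h w) (v : ℂ) :
    fderiv ℝ (fun z => (h z).im) w v = (deriv h w * v).im := by
  have := (Complex.imCLM.hasFDerivAt.comp w (hh.restrictScalars ℝ).hasFDerivAt).fderiv
  rw [← fderiv_real_apply hh]
  exact congrArg (fun L : ℂ →L[ℝ] ℝ => L v) this

lemma fderiv_comp_holomorphic_apply {F : ℂ → ℝ} (hF : DifferentiableAt ℝ F (h w))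
    (hh : DifferentiableAt ℂ h w) (v : ℂ) :
    fderiv ℝ (fun z => F (h z)) w v =
      (deriv h w * v).re * dx F (h w) + (deriv h w * v).im * dy F (h w) := by
  have := (hF.hasFDerivAt.comp w (hh.restrictScalars ℝ).hasFDerivAt).fderiv
  rw [← fderiv_apply_eq, ← fderiv_real_apply hh]
  exact congrArg (fun L : ℂ →L[ℝ] ℝ => L v) this

lemma dx_comp_holomorphic {F : ℂ → ℝ} (hF : DifferentiableAt ℝ F (h w))
    (hh : DifferentiableAt ℂ h w) :
    dx (fun z => F (h z)) w = (deriv h w).re * dx F (h w) + (deriv h w).im * dy F (h w) := by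
  rw [dx, fderiv_comp_holomorphic_apply hF hh, mul_one]

lemma dy_comp_holomorphic {F : ℂ → ℝ} (hF : DifferentiableAt ℝ F (h w))
    (hh : DifferentiableAt ℂ h w) :
    dy (fun z => F (h z)) w = -(deriv h w).im * dx F (h w) + (deriv h w).re * dy F (h w) := by
  rw [dy, fderiv_comp_holomorphic_apply hF hh]
  simp

end HolomorphicParts

lemma contDiffOn_real {h : ℂ → ℂ} {W : Set ℂ} (hW : IsOpen W) (hh : DifferentiableOn ℂ h W) :
    ContDiffOn ℝ ∞ h W :=
  (hh.contDiffOn hW (n := ∞)).restrict_scalars ℝ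

namespace Collar

variable {Ω : Set ℂ} {ℓ R : ℝ} {Q : ℂ → ℂ}

lemma deriv_periodic (H : Collar Ω ℓ R Q) (z : ℂ) : deriv Q (z + ℓ) = deriv Q z := by
  rw [← deriv_comp_add_const, funext H.periodic]

lemma differentiableOn_deriv (H : Collar Ω ℓ R Q) :
    DifferentiableOn ℂ (deriv Q) (strip (-R) R) := H.diff.deriv (isOpen_strip _ _)

lemma contDiffOn_normSq_deriv (H : Collar Ω ℓ R Q) :
    ContDiffOn ℝ ∞ (fun w => ‖deriv Q w‖ ^ 2) (strip (-R) R) :=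
  (contDiffOn_real (isOpen_strip _ _) H.differentiableOn_deriv).norm_sq ℝ

lemma contDiffOn_comp (H : Collar Ω ℓ R Q) {f : ℂ → ℝ} (hf : ContDiff ℝ ∞ f) :
    ContDiffOn ℝ ∞ (fun w => f (Q w)) (strip (-R) R) :=
  hf.comp_contDiffOn (contDiffOn_real (isOpen_strip _ _) H.diff)

lemma laplacian_comp (H : Collar Ω ℓ R Q) {f : ℂ → ℝ} (hf : ContDiff ℝ ∞ f) {w : ℂ}
    (hw : w ∈ strip (-R) R) :
    dx (dx fun z => f (Q z)) w + dy (dy fun z => f (Q z)) w =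
      ‖deriv Q w‖ ^ 2 * (dx (dx f) (Q w) + dy (dy f) (Q w)) := by
  have hW := isOpen_strip (-R) R
  have hQ : ∀ z ∈ strip (-R) R, DifferentiableAt ℂ Q z := fun z hz =>
    H.diff.differentiableAt (hW.mem_nhds hz)
  have hQ' : DifferentiableAt ℂ (deriv Q) w :=
    H.differentiableOn_deriv.differentiableAt (hW.mem_nhds hw)
  have d0 : Differentiable ℝ f := hf.differentiable (by simp)
  have d1 : Differentiable ℝ (dx f) := (contDiff_dx hf).differentiable (by simp)
  have d2 : Differentiable ℝ (dy f) := (contDiff_dy hf).differentiable (by simp)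
  have e1 : EqOn (dx fun z => f (Q z)) (fun z => (deriv Q z).re * dx f (Q z) +
      (deriv Q z).im * dy f (Q z)) (strip (-R) R) := fun z hz =>
    dx_comp_holomorphic (d0 _) (hQ z hz)
  have e2 : EqOn (dy fun z => f (Q z)) (fun z => (-(deriv Q z).im) * dx f (Q z) +
      (deriv Q z).re * dy f (Q z)) (strip (-R) R) := fun z hz =>
    dy_comp_holomorphic (d0 _) (hQ z hz)
  have hQr : DifferentiableAt ℝ Q w := (hQ w hw).restrictScalars ℝ
  have hA : DifferentiableAt ℝ (fun z => (deriv Q z).re) w :=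
    Complex.reCLM.differentiableAt.comp w (hQ'.restrictScalars ℝ)
  have hB : DifferentiableAt ℝ (fun z => (deriv Q z).im) w :=
    Complex.imCLM.differentiableAt.comp w (hQ'.restrictScalars ℝ)
  have hX : DifferentiableAt ℝ (fun z => dx f (Q z)) w := (d1 _).comp w hQr
  have hY : DifferentiableAt ℝ (fun z => dy f (Q z)) w := (d2 _).comp w hQr
  have hcomm : dx (dy f) (Q w) = dy (dx f) (Q w) :=
    dx_dy_comm isOpen_univ hf.contDiffOn (mem_univ _)
  have hneg : dy (fun z => -(deriv Q z).im) w = -(deriv (deriv Q) w).re := by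
    rw [dy, fderiv_fun_neg]
    simp [fderiv_im_apply hQ']
  rw [dx_congr hW e1 hw, dy_congr hW e2 hw, dx_add (hA.fun_mul hX) (hB.fun_mul hY),
    dy_add (hB.fun_neg.fun_mul hX) (hA.fun_mul hY), dx_mul hA hX, dx_mul hB hY, dy_mul hB.fun_neg hX,
    dy_mul hA hY,
    dx_comp_holomorphic (d1 _) (hQ w hw), dx_comp_holomorphic (d2 _) (hQ w hw),
    dy_comp_holomorphic (d1 _) (hQ w hw), dy_comp_holomorphic (d2 _) (hQ w hw), hneg, hcomm,
    ← Complex.normSq_eq_norm_sq, Complex.normSq_apply]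
  have a1 : dx (fun z => (deriv Q z).re) w = (deriv (deriv Q) w).re := by
    rw [dx, fderiv_re_apply hQ', mul_one]
  have a2 : dx (fun z => (deriv Q z).im) w = (deriv (deriv Q) w).im := by
    rw [dx, fderiv_im_apply hQ', mul_one]
  have a3 : dy (fun z => (deriv Q z).re) w = -(deriv (deriv Q) w).im := by
    rw [dy, fderiv_re_apply hQ']; simp
  rw [a1, a2, a3]
  ring

lemma map_mem_closure (H : Collar Ω ℓ R Q) {w : ℂ} (h0 : 0 ≤ w.im) (hR : w.im < R) :
    Q w ∈ closure Ω := by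
  have hw : w ∈ strip (-R) R := ⟨(neg_neg_of_pos H.width_pos).trans_le h0, hR⟩
  have hc : ContinuousAt Q w :=
    (H.diff.differentiableAt ((isOpen_strip _ _).mem_nhds hw)).continuousAt
  have hlim : Tendsto (fun t : ℝ => w + t * Complex.I) (𝓝[>] 0) (𝓝 w) := by
    have : Continuous fun t : ℝ => w + t * Complex.I := by fun_prop
    simpa using (this.tendsto 0).mono_left nhdsWithin_le_nhds
  refine mem_closure_of_tendsto (hc.tendsto.comp hlim) ?_
  filter_upwards [Ioo_mem_nhdsGT (show (0 : ℝ) < R - w.im by linarith)] with t ht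
  refine H.upper _ ⟨?_, ?_⟩
  · simpa using add_pos_of_nonneg_of_pos h0 ht.1
  · simp; linarith [ht.2]

end Collar

namespace NeumannMode

variable {Ω : Set ℂ} {ℓ R : ℝ} {Q : ℂ → ℂ} {lam : ℝ} {f : ℂ → ℝ}

lemma eigen_closure (N : NeumannMode Ω Q lam f) {p : ℂ} (hp : p ∈ closure Ω) :
    dx (dx f) p + dy (dy f) p = -lam ^ 2 * f p := by
  have hc : IsClosed {p | dx (dx f) p + dy (dy f) p = -lam ^ 2 * f p} :=
    isClosed_eq (((contDiff_dx (contDiff_dx N.smooth)).continuous).add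
      ((contDiff_dy (contDiff_dy N.smooth)).continuous))
      (continuous_const.mul N.smooth.continuous)
  exact closure_minimal N.eigen hc hp

lemma laplacian_pullback (N : NeumannMode Ω Q lam f) (H : Collar Ω ℓ R Q) {w : ℂ}
    (h0 : 0 ≤ w.im) (hR : w.im < R) :
    dx (dx fun z => f (Q z)) w + dy (dy fun z => f (Q z)) w =
      -lam ^ 2 * ‖deriv Q w‖ ^ 2 * f (Q w) := by
  rw [H.laplacian_comp N.smooth ⟨(neg_neg_of_pos H.width_pos).trans_le h0, hR⟩,
    N.eigen_closure (H.map_mem_closure h0 hR)]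
  ring

lemma dy_pullback (N : NeumannMode Ω Q lam f) (H : Collar Ω ℓ R Q) (x : ℝ) :
    dy (fun z => f (Q z)) x = 0 := by
  rw [dy_comp_holomorphic (N.smooth.differentiable (by simp) _)
    (H.diff.differentiableAt ((isOpen_strip _ _).mem_nhds (ofReal_mem_strip H.width_pos x)))]
  linear_combination N.neumann x

lemma gradSq_pullback (N : NeumannMode Ω Q lam f) (H : Collar Ω ℓ R Q) {w : ℂ}
    (hw : w ∈ strip (-R) R) :
    gradSq (fun z => f (Q z)) w = ‖deriv Q w‖ ^ 2 * gradSq f (Q w) := by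
  have hQ := H.diff.differentiableAt ((isOpen_strip _ _).mem_nhds hw)
  have hf := N.smooth.differentiable (by simp) (Q w)
  rw [gradSq, gradSq, dx_comp_holomorphic hf hQ, dy_comp_holomorphic hf hQ,
    ← Complex.normSq_eq_norm_sq, Complex.normSq_apply]
  ring

lemma gradSq_boundary (N : NeumannMode Ω Q lam f) (H : Collar Ω ℓ R Q) (x : ℝ) :
    gradSq f (Q x) = dx (fun z => f (Q z)) x ^ 2 := by
  have h := N.gradSq_pullback H (ofReal_mem_strip H.width_pos x)
  rw [H.unit, one_pow, one_mul] at h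
  rw [← h, gradSq, N.dy_pullback H]
  ring

end NeumannMode

lemma iteratedDeriv_ofReal {v : ℝ → ℝ} (hv : ContDiff ℝ ∞ v) (n : ℕ) :
    iteratedDeriv n (fun t => (v t : ℂ)) = fun t => ((iteratedDeriv n v t : ℝ) : ℂ) := by
  induction n with
  | zero => simp
  | succ n ih =>
    rw [iteratedDeriv_succ, ih]
    funext t
    have hd : DifferentiableAt ℝ (iteratedDeriv n v) t :=
      (hv.differentiable_iteratedDeriv n (by exact_mod_cast WithTop.coe_lt_top n)) t
    rw [iteratedDeriv_succ]
    exact hd.hasDerivAt.ofReal_comp.deriv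

namespace Collar

variable {Ω : Set ℂ} {ℓ R : ℝ} {Q : ℂ → ℂ}

lemma normSq_deriv_periodic (H : Collar Ω ℓ R Q) (z : ℂ) :
    ‖deriv Q (z + ℓ)‖ ^ 2 = ‖deriv Q z‖ ^ 2 := by rw [H.deriv_periodic]

lemma exists_density_bounds (H : Collar Ω ℓ R Q) {r : ℝ} (hr : r < R) :
    ∃ M > 0, ∀ w : ℂ, 0 ≤ w.im → w.im ≤ r → 1 ≤ M * ‖deriv Q w‖ ^ 2 ∧
      |dy (fun z => ‖deriv Q z‖ ^ 2) w| ≤ M * ‖deriv Q w‖ ^ 2 := by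
  have h0 : -R < 0 := neg_neg_of_pos H.width_pos
  have hne : ∀ w ∈ strip (-R) R, ‖deriv Q w‖ ^ 2 ≠ 0 := fun w hw => by
    simpa using H.deriv_ne w hw
  obtain ⟨M₁, hM₁, h₁⟩ := exists_abs_le_of_periodic H.period_pos
    (contDiffOn_dy (isOpen_strip _ _) H.contDiffOn_normSq_deriv).continuousOn
    (dy_periodic H.normSq_deriv_periodic) h0 hr
  obtain ⟨M₂, hM₂, h₂⟩ := exists_abs_le_of_periodic H.period_pos
    (F := fun w => (‖deriv Q w‖ ^ 2)⁻¹)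
    (H.contDiffOn_normSq_deriv.continuousOn.inv₀ hne)
    (fun z => by rw [H.normSq_deriv_periodic]) h0 hr
  refine ⟨max M₂ (M₁ * M₂), lt_max_of_lt_left hM₂, fun w hw0 hwr => ?_⟩
  have hpos : 0 < ‖deriv Q w‖ ^ 2 :=
    lt_of_le_of_ne (by positivity) (hne w ⟨h0.trans_le hw0, hwr.trans_lt hr⟩).symm
  have h3 : 1 ≤ M₂ * ‖deriv Q w‖ ^ 2 := by
    have := (le_abs_self _).trans (h₂ w hw0 hwr)
    rwa [inv_le_iff_one_le_mul₀ hpos] at this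
  refine ⟨h3.trans (by gcongr; exact le_max_left _ _), (h₁ w hw0 hwr).trans ?_⟩
  calc M₁ = M₁ * 1 := (mul_one _).symm
    _ ≤ M₁ * (M₂ * ‖deriv Q w‖ ^ 2) := by gcongr
    _ = M₁ * M₂ * ‖deriv Q w‖ ^ 2 := by ring
    _ ≤ _ := by gcongr; exact le_max_right _ _

lemma continuousOn_density_mul (H : Collar Ω ℓ R Q) {G : ℂ → ℝ} (hG : Continuous G) :
    ContinuousOn (fun w => ‖deriv Q w‖ ^ 2 * G (Q w)) (strip (-R) R) :=
  H.contDiffOn_normSq_deriv.continuousOn.mul (hG.comp_continuousOn H.diff.continuousOn)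

lemma integral_slice_le (H : Collar Ω ℓ R Q) {G : ℂ → ℝ} (hG : Continuous G) (hG0 : ∀ p, 0 ≤ G p)
    {r : ℝ} (h0 : 0 ≤ r) (hr : r < R) :
    ∫ y in (0 : ℝ)..r, slice ℓ (fun w => ‖deriv Q w‖ ^ 2 * G (Q w)) y ≤ ∫ p in Ω, G p := by
  rw [← H.integral_image_eq (H.continuousOn_density_mul hG) (neg_neg_of_pos H.width_pos) h0 hr]
  refine setIntegral_mono_set (H.integrableOn hG) (Eventually.of_forall hG0)
    (LE.le.eventuallyLE ?_)
  rintro _ ⟨w, hw, rfl⟩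
  have := (Complex.mem_reProdIm.1 hw).2
  exact H.upper w ⟨this.1, this.2.trans_lt hr⟩

/-- The mass of a pulled back function on a half collar is controlled by its mass in `Ω`. -/
lemma exists_mass_le (H : Collar Ω ℓ R Q) {r : ℝ} (h0 : 0 ≤ r) (hr : r < R) :
    ∃ M > 0, ∀ f : ℂ → ℝ, Continuous f →
      mass ℓ (fun w => f (Q w)) r ≤ M * ∫ p in Ω, f p ^ 2 := by
  obtain ⟨M, hM, h⟩ := H.exists_density_bounds hr
  refine ⟨M, hM, fun f hf => ?_⟩
  have hR := neg_neg_of_pos H.width_pos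
  have hc1 : ContinuousOn (fun w => f (Q w) ^ 2) (strip (-R) R) :=
    (hf.pow 2).comp_continuousOn H.diff.continuousOn
  have hc2 := H.continuousOn_density_mul (hf.pow 2)
  have hc3 : ContinuousOn (fun w => M * (‖deriv Q w‖ ^ 2 * f (Q w) ^ 2)) (strip (-R) R) :=
    continuousOn_const.mul hc2
  have hsub : uIcc 0 r ⊆ Ioo (-R) R := by
    rw [uIcc_of_le h0]
    exact fun t ht => ⟨hR.trans_le ht.1, ht.2.trans_lt hr⟩
  calc mass ℓ (fun w => f (Q w)) r
      ≤ ∫ y in (0 : ℝ)..r, slice ℓ (fun w => M * (‖deriv Q w‖ ^ 2 * f (Q w) ^ 2)) y := by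
        refine intervalIntegral.integral_mono_on h0
          ((continuousOn_slice hc1 ℓ).mono hsub).intervalIntegrable
          ((continuousOn_slice hc3 ℓ).mono hsub).intervalIntegrable fun y hy => ?_
        refine slice_mono H.period_pos.le hc1 hc3 ⟨hR.trans_le hy.1, hy.2.trans_lt hr⟩ fun x => ?_
        have := (h (x + y * Complex.I) (by simpa using hy.1) (by simpa using hy.2)).1
        nlinarith [sq_nonneg (f (Q (x + y * Complex.I)))]
    _ = M * ∫ y in (0 : ℝ)..r, slice ℓ (fun w => ‖deriv Q w‖ ^ 2 * f (Q w) ^ 2) y := by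
        simp only [slice_const_mul, intervalIntegral.integral_const_mul]
    _ ≤ _ := by
        gcongr
        exact H.integral_slice_le (G := fun p => f p ^ 2) (hf.pow 2) (fun _ => sq_nonneg _) h0 hr

/-- Cauchy estimates for the horizontal derivatives of the conformal density. -/
lemma exists_dx_iterate_density_le (H : Collar Ω ℓ R Q) :
    ∃ A ≥ 0, ∀ (c : ℝ) (j : ℕ) (z : ℂ), 0 ≤ z.im → z.im < R / 2 →
      |dx^[j] (fun w => c * ‖deriv Q w‖ ^ 2) z| ≤ |c| * A ^ (j + 1) * j.factorial := by
  have hR := H.width_pos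
  obtain ⟨M, hM, h⟩ := exists_abs_le_of_periodic H.period_pos (F := fun w => ‖deriv Q w‖)
    H.continuousOn_deriv.norm (fun z => by rw [H.deriv_periodic])
    (show -R < -(3 * R / 4) by linarith) (show 3 * R / 4 < R by linarith)
  simp only [abs_norm] at h
  refine ⟨max (M ^ 2) (4 / R), by positivity, fun c j z hz0 hzR => ?_⟩
  obtain ⟨x, y, rfl⟩ : ∃ x y : ℝ, z = x + y * Complex.I := ⟨z.re, z.im, (Complex.re_add_im z).symm⟩
  simp only [Complex.add_im, Complex.ofReal_im, Complex.mul_im, Complex.ofReal_re, Complex.I_im,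
    mul_one, Complex.I_re, mul_zero, add_zero, zero_add] at hz0 hzR
  have hreal : ContDiffOn ℝ ∞ (fun w => c * ‖deriv Q w‖ ^ 2) (strip (-R) R) :=
    contDiffOn_const.mul H.contDiffOn_normSq_deriv
  have hy : -R < y ∧ y < R := ⟨by linarith, by linarith⟩
  rw [← iteratedDeriv_horizontal hreal hy]
  set F : ℂ → ℂ := fun ξ => c * (deriv Q (ξ + y * Complex.I) *
    starRingEnd ℂ (deriv Q (starRingEnd ℂ ξ + y * Complex.I))) with hF
  have hd : ∀ ξ ∈ strip (-(R / 2)) (R / 2), DifferentiableAt ℂ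
      (fun ξ : ℂ => deriv Q (ξ + y * Complex.I)) ξ := by
    intro ξ hξ
    refine (H.differentiableOn_deriv.differentiableAt ((isOpen_strip _ _).mem_nhds ?_)).comp ξ
      (differentiableAt_id.add_const _)
    simp only [strip, mem_ofPred_eq] at hξ
    refine ⟨?_, ?_⟩ <;> simp <;> linarith [hξ.1, hξ.2]
  have hFd : DifferentiableOn ℂ F (strip (-(R / 2)) (R / 2)) := by
    intro ξ hξ
    have hξ' : starRingEnd ℂ ξ ∈ strip (-(R / 2)) (R / 2) := by
      refine ⟨?_, ?_⟩ <;> simp <;> linarith [hξ.1, hξ.2]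
    have h2 := (hd _ hξ').conj_conj
    rw [Complex.conj_conj] at h2
    exact (((hd ξ hξ).mul h2).const_mul (c : ℂ)).differentiableWithinAt
  have hv : ∀ t : ℝ, (t : ℂ) ∈ strip (-(R / 2)) (R / 2) →
      (((fun t : ℝ => c * ‖deriv Q (t + y * Complex.I)‖ ^ 2) t : ℝ) : ℂ) = F t := by
    intro t _
    simp [hF, Complex.mul_conj, Complex.normSq_eq_norm_sq]
  have hcx : iteratedDeriv j (fun t : ℝ => ((c * ‖deriv Q (t + y * Complex.I)‖ ^ 2 : ℝ) : ℂ)) x =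
      ((iteratedDeriv j (fun t : ℝ => c * ‖deriv Q (t + y * Complex.I)‖ ^ 2) x : ℝ) : ℂ) := by
    have hs : ContDiff ℝ ∞ fun t : ℝ => c * ‖deriv Q (t + y * Complex.I)‖ ^ 2 :=
      contDiff_horizontal hreal hy
    exact congrFun (iteratedDeriv_ofReal hs j) x
  have heq := iteratedDeriv_eq_of_eqOn_ofReal (isOpen_strip _ _) hFd hv j x
    (ofReal_mem_strip (by linarith) x)
  rw [← Real.norm_eq_abs, ← Complex.norm_real, ← hcx, heq]
  have hball : Metric.closedBall (x : ℂ) (R / 4) ⊆ strip (-(R / 2)) (R / 2) ∩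
      {ξ | |ξ.im| ≤ R / 4} := by
    intro ξ hξ
    have : |ξ.im| ≤ R / 4 := by
      have h1 := Complex.abs_im_le_norm (ξ - x)
      rw [← dist_eq_norm] at h1
      simpa using h1.trans hξ
    exact ⟨⟨by linarith [(abs_le.1 this).1], by linarith [(abs_le.1 this).2]⟩, this⟩
  refine (Complex.norm_iteratedDeriv_le_of_forall_mem_sphere_norm_le j (show 0 < R / 4 by linarith)
    (C := |c| * M ^ 2) ?_ ?_).trans ?_
  · exact ((hFd.mono (hball.trans inter_subset_left)).diffContOnCl_ball subset_rfl)
  · intro ξ hξ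
    have him : |ξ.im| ≤ R / 4 := (hball (Metric.sphere_subset_closedBall hξ)).2
    rw [abs_le] at him
    have n1 := h (ξ + y * Complex.I) (by simp; linarith) (by simp; linarith)
    have n2 := h (starRingEnd ℂ ξ + y * Complex.I) (by simp; linarith) (by simp; linarith)
    simp only [hF, norm_mul, Complex.norm_real, Real.norm_eq_abs, RCLike.norm_conj]
    rw [sq]
    gcongr
  · have e : (j.factorial : ℝ) * (|c| * M ^ 2) / (R / 4) ^ j =
        |c| * (M ^ 2 * (4 / R) ^ j) * j.factorial := by
      rw [div_pow, div_pow]; field_simp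
    rw [e, pow_succ' (max _ _)]
    have h1 := le_max_left (M ^ 2) (4 / R)
    have h2 := le_max_right (M ^ 2) (4 / R)
    have h3 : 0 ≤ max (M ^ 2) (4 / R) := by positivity
    generalize max (M ^ 2) (4 / R) = A at h1 h2 h3
    gcongr

end Collar

namespace NeumannMode

variable {Ω : Set ℂ} {ℓ R : ℝ} {Q : ℂ → ℂ} {lam : ℝ} {f : ℂ → ℝ}

/-- The tangential derivative on the boundary is controlled by boundary and interior mass. -/
lemma exists_boundary_gradSq_le (H : Collar Ω ℓ R Q) : ∃ c > 0, ∀ (lam : ℝ) (f : ℂ → ℝ),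
    NeumannMode Ω Q lam f → ∫ x in (0 : ℝ)..ℓ, gradSq f (Q x) ≤
      lam ^ 2 * ((∫ x in (0 : ℝ)..ℓ, f (Q x) ^ 2) + c * ∫ p in Ω, f p ^ 2) := by
  have hR := H.width_pos
  set r := R / 2 with hr
  have hr0 : 0 < r := by positivity
  have hrR : r < R := by linarith
  obtain ⟨M, hM, hρ⟩ := H.exists_density_bounds hrR
  refine ⟨1 / r + M, by positivity, fun lam f N => ?_⟩
  have hW := isOpen_strip (-R) R
  have hsub : Icc 0 r ⊆ Ioo (-R) R := fun t ht => ⟨by linarith [ht.1], by linarith [ht.2]⟩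
  set g : ℂ → ℝ := fun w => f (Q w) with hg
  set ρ : ℂ → ℝ := fun w => ‖deriv Q w‖ ^ 2 with hρdef
  have sg : ContDiffOn ℝ ∞ g (strip (-R) R) := H.contDiffOn_comp N.smooth
  have sρ : ContDiffOn ℝ ∞ ρ (strip (-R) R) := H.contDiffOn_normSq_deriv
  have sx := contDiffOn_dx hW sg
  have sy := contDiffOn_dy hW sg
  have hgper : ∀ z, g (z + ℓ) = g z := fun z => by rw [hg]; simp only [H.periodic]
  set w : ℂ → ℝ := fun z => dx g z * dx g z + (-(dy g z * dy g z) + -lam ^ 2 * ρ z * (g z * g z))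
    with hw
  have s3 : ContDiffOn ℝ ∞ (fun z => -lam ^ 2 * ρ z * (g z * g z)) (strip (-R) R) :=
    (contDiffOn_const.mul sρ).mul (sg.mul sg)
  have sw : ContDiffOn ℝ ∞ w (strip (-R) R) := (sx.mul sx).add ((sy.mul sy).neg.add s3)
  set P : ℂ → ℝ := fun z => dx g z * dy g z with hP
  have sP : ContDiffOn ℝ ∞ P (strip (-R) R) := sx.mul sy
  have hPper : ∀ z, P (z + ℓ) = P z := fun z => by
    rw [hP]; simp only [dx_periodic hgper, dy_periodic hgper]
  set E : ℂ → ℝ := fun z => -lam ^ 2 * (dy ρ z * g z ^ 2) with hE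
  have cE : ContinuousOn E (strip (-R) R) :=
    continuousOn_const.mul ((contDiffOn_dy hW sρ).continuousOn.mul (sg.continuousOn.pow 2))
  have hdyw : ∀ z : ℂ, 0 ≤ z.im → z.im < R → dy w z = 2 * dx P z + E z := by
    intro z h0 hzR
    have hz : z ∈ strip (-R) R := ⟨by linarith, hzR⟩
    have dg := differentiableAt_of_contDiffOn hW sg hz
    have dρ := differentiableAt_of_contDiffOn hW sρ hz
    have dX := differentiableAt_of_contDiffOn hW sx hz
    have dY := differentiableAt_of_contDiffOn hW sy hz
    have dc : DifferentiableAt ℝ (fun _ : ℂ => -lam ^ 2) z := differentiableAt_const _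
    have hl := N.laplacian_pullback H h0 hzR
    have hcomm := dx_dy_comm hW sg hz
    have hneg : dy (fun z => -(dy g z * dy g z)) z = -(dy (fun z => dy g z * dy g z) z) := by
      rw [dy, fderiv_fun_neg]; rfl
    have hcρ : dy (fun z => -lam ^ 2 * ρ z) z = -lam ^ 2 * dy ρ z := by
      rw [dy_mul dc dρ]; simp [dy]
    rw [hw, dy_add (dX.fun_mul dX) ((dY.fun_mul dY).fun_neg.fun_add
      ((dc.fun_mul dρ).fun_mul (dg.fun_mul dg))), dy_add (dY.fun_mul dY).fun_neg
      ((dc.fun_mul dρ).fun_mul (dg.fun_mul dg)), hneg, dy_mul dX dX, dy_mul dY dY,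
      dy_mul (dc.fun_mul dρ) (dg.fun_mul dg), hcρ, dy_mul dg dg, hP, dx_mul dX dY, hE, hcomm]
    linear_combination (-2 * dy g z) * hl
  have hder : ∀ t ∈ Icc 0 r, HasDerivAt (slice ℓ w) (slice ℓ E t) t := by
    intro t ht
    have h1 := hasDerivAt_slice sw ℓ (hsub ht)
    refine h1.congr_deriv ?_
    have h2 : slice ℓ (dy w) t = slice ℓ (fun z => 2 * dx P z + E z) t :=
      intervalIntegral.integral_congr fun x _ => hdyw _ (by simpa using ht.1)
        (by simpa using ht.2.trans_lt hrR)
    have cP : ContinuousOn (fun z => 2 * dx P z) (strip (-R) R) :=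
      continuousOn_const.mul (contDiffOn_dx hW sP).continuousOn
    rw [h2, slice_add ℓ cP cE (hsub ht),
      slice_const_mul, slice_dx sP hPper (hsub ht)]
    simp
  have cρg : ContinuousOn (fun z => ρ z * f (Q z) ^ 2) (strip (-R) R) :=
    H.continuousOn_density_mul (G := fun p => f p ^ 2) (N.smooth.continuous.pow 2)
  have hbound : ∀ t ∈ Icc 0 r, |slice ℓ E t| ≤
      lam ^ 2 * M * slice ℓ (fun z => ρ z * f (Q z) ^ 2) t := by
    intro t ht
    rw [← slice_const_mul]
    have := intervalIntegral.norm_integral_le_of_norm_le (μ := volume) H.period_pos.le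
      (f := fun x : ℝ => E (x + t * Complex.I))
      (g := fun x : ℝ => lam ^ 2 * M * (ρ (x + t * Complex.I) * f (Q (x + t * Complex.I)) ^ 2))
      (Eventually.of_forall fun x _ => ?_)
      ((continuous_horizontal (continuousOn_const.mul cρg) (hsub ht)).intervalIntegrable _ _)
    · simpa [slice] using this
    · have h1 := (hρ (x + t * Complex.I) (by simpa using ht.1) (by simpa using ht.2)).2
      rw [hE, Real.norm_eq_abs]
      simp only [abs_mul, abs_neg, abs_pow, sq_abs]
      rw [mul_assoc (lam ^ 2), ← mul_assoc M]
      gcongr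
  have main := le_average_add_integral
    (D := fun t => lam ^ 2 * M * slice ℓ (fun z => ρ z * f (Q z) ^ 2) t) hr0 ⟨le_rfl, hr0.le⟩ hder
    ((continuousOn_slice cE ℓ).mono hsub)
    (continuousOn_const.mul ((continuousOn_slice cρg ℓ).mono hsub)) hbound
  have hv0 : slice ℓ w 0 = (∫ x in (0 : ℝ)..ℓ, gradSq f (Q x)) -
      lam ^ 2 * ∫ x in (0 : ℝ)..ℓ, f (Q x) ^ 2 := by
    have c1 : Continuous fun x : ℝ => gradSq f (Q x) :=
      continuous_comp_ofReal H (continuous_gradSq N.smooth)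
    have c2 : Continuous fun x : ℝ => f (Q x) ^ 2 :=
      continuous_comp_ofReal H (N.smooth.continuous.pow 2)
    rw [← intervalIntegral.integral_const_mul, ← intervalIntegral.integral_sub
      (c1.intervalIntegrable _ _) ((c2.const_mul _).intervalIntegrable _ _), slice]
    refine intervalIntegral.integral_congr fun x _ => ?_
    simp only [Complex.ofReal_zero, zero_mul, add_zero, hw, hρdef, H.unit]
    rw [N.gradSq_boundary H, N.dy_pullback H]
    simp only [hg]
    ring
  have hmono : ∫ t in (0 : ℝ)..r, slice ℓ w t ≤ ∫ p in Ω, gradSq f p := by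
    have cG := H.continuousOn_density_mul (continuous_gradSq N.smooth)
    refine le_trans ?_ (H.integral_slice_le (continuous_gradSq N.smooth)
      (fun p => add_nonneg (sq_nonneg _) (sq_nonneg _)) hr0.le hrR)
    have hsub' : uIcc 0 r ⊆ Ioo (-R) R := by rwa [uIcc_of_le hr0.le]
    refine intervalIntegral.integral_mono_on hr0.le
      ((continuousOn_slice sw.continuousOn ℓ).mono hsub').intervalIntegrable
      ((continuousOn_slice cG ℓ).mono hsub').intervalIntegrable fun t ht => ?_
    refine slice_mono H.period_pos.le sw.continuousOn cG (hsub ht) fun x => ?_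
    rw [← N.gradSq_pullback H (mem_strip_add.2 (hsub ht)), gradSq, hw]
    have : 0 ≤ lam ^ 2 * ρ (x + t * Complex.I) * (g (x + t * Complex.I) * g (x + t * Complex.I)) :=
      mul_nonneg (mul_nonneg (sq_nonneg _) (sq_nonneg _)) (mul_self_nonneg _)
    nlinarith [sq_nonneg (dy g (x + t * Complex.I))]
  have hmass : ∫ t in (0 : ℝ)..r, slice ℓ (fun z => ρ z * f (Q z) ^ 2) t ≤ ∫ p in Ω, f p ^ 2 :=
    H.integral_slice_le (G := fun p => f p ^ 2) (N.smooth.continuous.pow 2)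
      (fun _ => sq_nonneg _) hr0.le hrR
  rw [hv0, intervalIntegral.integral_const_mul] at main
  rw [N.integral_gradSq H] at hmono
  have e1 : (∫ t in (0 : ℝ)..r, slice ℓ w t) / r ≤ (lam ^ 2 * ∫ p in Ω, f p ^ 2) / r := by gcongr
  have e2 : lam ^ 2 * M * ∫ t in (0 : ℝ)..r, slice ℓ (fun z => ρ z * f (Q z) ^ 2) t ≤
      lam ^ 2 * M * ∫ p in Ω, f p ^ 2 := by gcongr
  have e3 : lam ^ 2 * ((∫ x in (0 : ℝ)..ℓ, f (Q x) ^ 2) + (1 / r + M) * ∫ p in Ω, f p ^ 2) =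
      lam ^ 2 * (∫ x in (0 : ℝ)..ℓ, f (Q x) ^ 2) + (lam ^ 2 * ∫ p in Ω, f p ^ 2) / r +
      lam ^ 2 * M * ∫ p in Ω, f p ^ 2 := by ring
  rw [e3]
  linarith

end NeumannMode

lemma setIntegral_sq_pos {Ω : Set ℂ} (hΩ : IsOpen Ω) {f : ℂ → ℝ} (hf : Continuous f)
    (hi : IntegrableOn (fun p => f p ^ 2) Ω) (hne : ∃ p ∈ Ω, f p ≠ 0) :
    0 < ∫ p in Ω, f p ^ 2 := by
  rw [setIntegral_pos_iff_support_of_nonneg_ae (Eventually.of_forall fun p => sq_nonneg (f p)) hi]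
  obtain ⟨p, hp, hfp⟩ := hne
  have hopen : IsOpen (Function.support (fun p => f p ^ 2) ∩ Ω) :=
    ((hf.pow 2).isOpen_support).inter hΩ
  exact hopen.measure_pos volume ⟨p, by simpa using hfp, hp⟩

lemma exists_sq_ge_average {ℓ : ℝ} (hℓ : 0 < ℓ) {T : ℝ → ℝ} (hT : Continuous T) :
    ∃ x ∈ Icc 0 ℓ, (∫ s in (0 : ℝ)..ℓ, T s ^ 2) / ℓ ≤ T x ^ 2 := by
  obtain ⟨x, hx, hmax⟩ := isCompact_Icc.exists_isMaxOn (nonempty_Icc.2 hℓ.le)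
    (hT.pow 2).continuousOn
  refine ⟨x, hx, ?_⟩
  rw [div_le_iff₀ hℓ]
  have hc : IntervalIntegrable (fun _ : ℝ => T x ^ 2) volume 0 ℓ :=
    continuous_const.intervalIntegrable 0 ℓ
  have := intervalIntegral.integral_mono_on hℓ.le ((hT.pow 2).intervalIntegrable 0 ℓ) hc
    fun s hs => hmax hs
  simpa [mul_comm] using this

namespace NeumannMode

variable {Ω : Set ℂ} {ℓ R : ℝ} {Q : ℂ → ℂ} {lam : ℝ} {f : ℂ → ℝ}

/-- Under the Schiffer condition the frequency is bounded below and the interior mass is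
controlled by the tangential derivative. -/
lemma exists_integral_sq_le (H : Collar Ω ℓ R Q) {C₀ : ℝ} (hC₀ : 0 < C₀) :
    ∃ μ > 0, ∃ c > 0, ∀ (lam : ℝ) (f : ℂ → ℝ), 0 < lam → NeumannMode Ω Q lam f →
      (∃ p ∈ Ω, f p ≠ 0) →
      exp (-2 * C₀ * lam) * (∫ x in (0 : ℝ)..ℓ, f (Q x) ^ 2) ≤
        ∫ x in (0 : ℝ)..ℓ, gradSq f (Q x) →
      μ ≤ lam ∧ 0 < (∫ x in (0 : ℝ)..ℓ, gradSq f (Q x)) ∧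
      ∫ p in Ω, f p ^ 2 ≤ c * exp (2 * C₀ * lam) * ∫ x in (0 : ℝ)..ℓ, gradSq f (Q x) := by
  obtain ⟨D, hD0, hD, hD'⟩ := H.exists_norm_le
  obtain ⟨c, hc, hgrad⟩ := exists_boundary_gradSq_le H
  set m := min 1 (min (1 / (2 * D ^ 2)) (exp (-2 * C₀) / (2 * (1 + 2 * D * c)))) with hm
  have hm0 : 0 < m := by positivity
  refine ⟨√m, by positivity, D / 2 * (1 / m + 1), by positivity, fun lam f hlam N hne hS => ?_⟩
  have hI := setIntegral_sq_pos H.isOpen N.smooth.continuous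
    (H.integrableOn (N.smooth.continuous.pow 2)) hne
  have h1 := N.integral_sq_le H hD hD'
  have h2 := N.integral_sq_le_boundary H hD'
  have h3 := hgrad lam f N
  have hB0 : 0 ≤ ∫ x in (0 : ℝ)..ℓ, f (Q x) ^ 2 :=
    intervalIntegral.integral_nonneg H.period_pos.le fun _ _ => sq_nonneg _
  have hB1 : 0 ≤ ∫ x in (0 : ℝ)..ℓ, gradSq f (Q x) :=
    intervalIntegral.integral_nonneg H.period_pos.le fun _ _ =>
      add_nonneg (sq_nonneg _) (sq_nonneg _)
  generalize (∫ p in Ω, f p ^ 2) = I at hI h1 h2 h3 ⊢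
  generalize (∫ x in (0 : ℝ)..ℓ, f (Q x) ^ 2) = B₀ at hS h1 h2 h3 hB0 ⊢
  generalize (∫ x in (0 : ℝ)..ℓ, gradSq f (Q x)) = B₁ at hS h2 h3 hB1 ⊢
  have hS' : B₀ ≤ exp (2 * C₀ * lam) * B₁ := by
    have := mul_le_mul_of_nonneg_left hS (exp_pos (2 * C₀ * lam)).le
    rwa [← mul_assoc, ← exp_add, show 2 * C₀ * lam + -2 * C₀ * lam = 0 by ring, exp_zero,
      one_mul] at this
  have hl2 : 0 < lam ^ 2 := by positivity
  have hpos : 0 < B₁ := by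
    refine hB1.lt_of_ne fun h0 => ?_
    rw [← h0] at hS' h2
    have : B₀ = 0 := le_antisymm (by simpa using hS') hB0
    rw [this] at h2
    simp only [mul_zero, add_zero] at h2
    have : 0 < 2 * lam ^ 2 * I := by positivity
    linarith
  have hmlam : m ≤ lam ^ 2 := by
    by_contra! hlt
    have l1 : lam < 1 := by
      have : lam ^ 2 < 1 := hlt.trans_le (min_le_left _ _)
      nlinarith
    have l2 : D ^ 2 * lam ^ 2 ≤ 1 / 2 := by
      have : lam ^ 2 ≤ 1 / (2 * D ^ 2) :=
        hlt.le.trans ((min_le_right _ _).trans (min_le_left _ _))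
      rw [le_div_iff₀ (by positivity)] at this
      linarith
    have l3 : 2 * (1 + 2 * D * c) * lam ^ 2 ≤ exp (-2 * C₀) := by
      have : lam ^ 2 ≤ exp (-2 * C₀) / (2 * (1 + 2 * D * c)) :=
        hlt.le.trans ((min_le_right _ _).trans (min_le_right _ _))
      rw [le_div_iff₀ (by positivity)] at this
      linarith
    have l4 : I ≤ 2 * D * B₀ := by nlinarith
    have l5 : B₁ ≤ lam ^ 2 * (1 + 2 * D * c) * B₀ := by
      refine h3.trans ?_
      have : B₀ + c * I ≤ (1 + 2 * D * c) * B₀ := by nlinarith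
      calc _ ≤ lam ^ 2 * ((1 + 2 * D * c) * B₀) := by gcongr
        _ = _ := by ring
    have l0 : 2 * C₀ * lam ≤ 2 * C₀ := by nlinarith
    have l6 : B₀ ≤ exp (2 * C₀) * B₁ :=
      hS'.trans (mul_le_mul_of_nonneg_right (exp_le_exp.2 l0) hB1)
    have l7 : lam ^ 2 * (1 + 2 * D * c) * B₀ ≤ exp (-2 * C₀) / 2 * (exp (2 * C₀) * B₁) := by
      refine mul_le_mul (by linarith) l6 hB0 (by positivity)
    have l8 : exp (-2 * C₀) / 2 * (exp (2 * C₀) * B₁) = B₁ / 2 := by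
      have : exp (-2 * C₀) * exp (2 * C₀) = 1 := by
        rw [← exp_add, show -2 * C₀ + 2 * C₀ = 0 by ring, exp_zero]
      linear_combination B₁ / 2 * this
    linarith
  refine ⟨Real.sqrt_le_iff.2 ⟨hlam.le, hmlam⟩, hpos, ?_⟩
  have hexp : 1 ≤ exp (2 * C₀ * lam) := one_le_exp (by positivity)
  have k1 : I ≤ D / 2 * (B₁ / lam ^ 2 + B₀) := by
    have : D / 2 * (B₁ / lam ^ 2 + B₀) = D * (B₁ + lam ^ 2 * B₀) / (2 * lam ^ 2) := by
      field_simp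
    rw [this, le_div_iff₀ (by positivity)]
    linarith
  have k2 : B₁ / lam ^ 2 ≤ exp (2 * C₀ * lam) * (B₁ / m) := by
    calc B₁ / lam ^ 2 ≤ B₁ / m := by gcongr
      _ = 1 * (B₁ / m) := (one_mul _).symm
      _ ≤ _ := by gcongr
  calc I ≤ D / 2 * (B₁ / lam ^ 2 + B₀) := k1
    _ ≤ D / 2 * (exp (2 * C₀ * lam) * (B₁ / m) + exp (2 * C₀ * lam) * B₁) := by gcongr
    _ = _ := by ring

lemma deriv_pullback (N : NeumannMode Ω Q lam f) (H : Collar Ω ℓ R Q) (x : ℝ) :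
    HasDerivAt (fun s : ℝ => f (Q s)) (dx (fun w => f (Q w)) x) x := by
  have h := hasDerivAt_comp_horizontal (f := fun w => f (Q w)) (x := x) (y := 0)
    (differentiableAt_of_contDiffOn (isOpen_strip _ _) (H.contDiffOn_comp N.smooth)
      (by simpa using ofReal_mem_strip H.width_pos x))
  simpa using h

/-- The number of boundary critical points of a Neumann mode. -/
theorem exists_ncard_le (H : Collar Ω ℓ R Q) {C₀ : ℝ} (hC₀ : 0 < C₀) :
    ∃ C > 0, ∀ (lam : ℝ) (f : ℂ → ℝ), 0 < lam → NeumannMode Ω Q lam f → (∃ p ∈ Ω, f p ≠ 0) →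
      exp (-2 * C₀ * lam) * (∫ s in (0 : ℝ)..ℓ, f (Q s) ^ 2) ≤
        ∫ s in (0 : ℝ)..ℓ, deriv (fun u : ℝ => f (Q u)) s ^ 2 →
      {s ∈ Ico 0 ℓ | deriv (fun u : ℝ => f (Q u)) s = 0}.Finite ∧
      ({s ∈ Ico 0 ℓ | deriv (fun u : ℝ => f (Q u)) s = 0}.ncard : ℝ) ≤ C * lam := by
  have hR := H.width_pos
  have hℓ := H.period_pos
  set R' := min (R / 4) 1 with hR'
  have hR'0 : 0 < R' := by positivity
  have hR'4 : R' ≤ R / 4 := min_le_left _ _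
  obtain ⟨A, hA, hV⟩ := H.exists_dx_iterate_density_le
  obtain ⟨K, hK, hg⟩ := exists_dx_iterate_le (R := R / 2) hℓ hR'0 (min_le_right _ _)
    (by linarith) hA
  obtain ⟨M, hM, hmass⟩ := H.exists_mass_le hR'0.le (show R' < R by linarith)
  obtain ⟨μ, hμ, c, hc, hI⟩ := exists_integral_sq_le H hC₀
  obtain ⟨κ, hκ, hE⟩ := exists_ncard_zeros_le hℓ (show 0 < 1 / (2 * (2 * K)) by positivity)
  set a := 2 * K ^ 2 * √(M * c) * √ℓ with ha
  have ha0 : 0 < a := by positivity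
  refine ⟨(|log a| / μ + (1 + C₀)) / κ, by positivity, fun lam f hlam N hne hS => ?_⟩
  set g : ℂ → ℝ := fun w => f (Q w) with hgdef
  have sg : ContDiffOn ℝ ∞ g (strip (-R) R) := H.contDiffOn_comp N.smooth
  have hder : ∀ x : ℝ, deriv (fun u : ℝ => f (Q u)) x = dx g x := fun x =>
    (N.deriv_pullback H x).deriv
  have hB : ∫ s in (0 : ℝ)..ℓ, deriv (fun u : ℝ => f (Q u)) s ^ 2 =
      ∫ s in (0 : ℝ)..ℓ, gradSq f (Q s) :=
    intervalIntegral.integral_congr fun x _ => by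
      rw [hder, N.gradSq_boundary H]
  rw [hB] at hS
  obtain ⟨hμlam, hBpos, hIle⟩ := hI lam f hlam N hne hS
  rw [← hB] at hBpos hIle
  simp only [hder] at hBpos hIle ⊢
  set B := ∫ s in (0 : ℝ)..ℓ, dx g s ^ 2 with hBdef
  have hmass' : √(mass ℓ g R') ≤ √(M * c) * exp (C₀ * lam) * √B := by
    have h1 : mass ℓ g R' ≤ M * c * exp (C₀ * lam) ^ 2 * B := by
      refine (hmass f N.smooth.continuous).trans ?_
      rw [← exp_nat_mul, show ((2 : ℕ) : ℝ) * (C₀ * lam) = 2 * C₀ * lam by push_cast; ring]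
      calc _ ≤ M * (c * exp (2 * C₀ * lam) * B) := by gcongr
        _ = _ := by ring
    refine (Real.sqrt_le_sqrt h1).trans_eq ?_
    rw [Real.sqrt_mul (by positivity), Real.sqrt_mul (by positivity),
      Real.sqrt_sq (exp_pos _).le]
  have hsub : strip (-R) (R / 2) ⊆ strip (-R) R := strip_mono le_rfl (by linarith)
  have hgn := hg lam R g (fun w => -lam ^ 2 * ‖deriv Q w‖ ^ 2) hlam hR (sg.mono hsub)
    ((contDiffOn_const.mul H.contDiffOn_normSq_deriv).mono hsub)
    (fun z => by rw [hgdef]; simp only [H.periodic]) (N.dy_pullback H)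
    (fun z hz => N.laplacian_pullback H hz.1.le (by linarith [hz.2]))
    (fun j z h0 h1 => by
      have := hV (-lam ^ 2) j z h0 h1
      rwa [abs_neg, abs_of_nonneg (sq_nonneg lam)] at this)
  have hiter : ∀ (n : ℕ) (x : ℝ), iteratedDeriv n (fun t : ℝ => dx g t) x = dx^[n + 1] g x := by
    intro n x
    have := iteratedDeriv_horizontal (contDiffOn_dx (isOpen_strip _ _) sg)
      (y := 0) ⟨by linarith, hR⟩ n x
    simpa using this
  have hTs : ContDiff ℝ ∞ fun t : ℝ => dx g t := by
    have := contDiff_horizontal (contDiffOn_dx (isOpen_strip _ _) sg) (y := 0) ⟨by linarith, hR⟩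
    simpa using this
  set S := K ^ 2 * exp lam * √(mass ℓ g R') with hSdef
  have hvb : ∀ (n : ℕ) (x : ℝ), ‖iteratedDeriv n (fun t : ℝ => ((dx g t : ℝ) : ℂ)) x‖ ≤
      S * (2 * K) ^ n * n.factorial := by
    intro n x
    rw [iteratedDeriv_ofReal hTs]
    simp only [Complex.norm_real, Real.norm_eq_abs, hiter]
    refine (hgn (n + 1) x).trans ?_
    have h2 : ((n + 1 : ℕ) : ℝ) ≤ 2 ^ n := by exact_mod_cast Nat.lt_two_pow_self
    rw [Nat.factorial_succ, Nat.cast_mul, mul_pow]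
    calc K ^ (n + 1 + 1) * (((n + 1 : ℕ) : ℝ) * n.factorial) * exp lam * √(mass ℓ g R')
        ≤ K ^ (n + 1 + 1) * (2 ^ n * n.factorial) * exp lam * √(mass ℓ g R') := by gcongr
      _ = _ := by rw [hSdef]; ring
  obtain ⟨h, hdiff, hreal, hbound, -⟩ := exists_holomorphic_extension
    (v := fun t : ℝ => ((dx g t : ℝ) : ℂ)) (Complex.ofRealCLM.contDiff.comp hTs)
    (show 0 < 2 * K by positivity) hvb
  obtain ⟨x, hx, hxT⟩ := exists_sq_ge_average hℓ hTs.continuous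
  have hTx : √B / √ℓ ≤ |dx g x| := by
    rw [← Real.sqrt_div hBpos.le, ← Real.sqrt_sq_eq_abs]
    exact Real.sqrt_le_sqrt hxT
  have hTpos : 0 < √B / √ℓ := by positivity
  have hnorm : ‖h x‖ = |dx g x| := by rw [hreal, Complex.norm_real, Real.norm_eq_abs]
  have hquart : 1 / (2 * (2 * K)) ≤ 1 / (2 * K) := by gcongr; linarith
  obtain ⟨hfin, hcard⟩ := hE h (2 * S) (hdiff.mono (strip_mono (neg_le_neg hquart) hquart))
    (fun w hw => hbound w (abs_le.2 ⟨hw.1.le, hw.2.le⟩)) x hx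
    (norm_pos_iff.1 (by rw [hnorm]; exact hTpos.trans_le hTx))
  have hset : {s ∈ Ico 0 ℓ | dx g (s : ℝ) = 0} = {s ∈ Ico 0 ℓ | h ((s : ℝ) : ℂ) = 0} := by
    ext s
    simp [hreal]
  rw [hset]
  refine ⟨hfin, ?_⟩
  have hratio : 2 * S / ‖h x‖ ≤ a * exp ((1 + C₀) * lam) := by
    rw [hnorm, div_le_iff₀ (hTpos.trans_le hTx)]
    calc 2 * S ≤ 2 * (K ^ 2 * exp lam * (√(M * c) * exp (C₀ * lam) * √B)) := by
          rw [hSdef]; gcongr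
      _ = a * exp ((1 + C₀) * lam) * (√B / √ℓ) := by
          rw [add_mul, exp_add, one_mul, ha]; field_simp
      _ ≤ _ := by gcongr
  have hlog : log (2 * S / ‖h x‖) ≤ |log a| + (1 + C₀) * lam := by
    by_cases hz : 0 < 2 * S / ‖h x‖
    · refine (Real.log_le_log hz hratio).trans ?_
      rw [Real.log_mul ha0.ne' (exp_pos _).ne', Real.log_exp]
      gcongr
      exact le_abs_self _
    · have : 2 * S / ‖h x‖ = 0 := le_antisymm (not_lt.1 hz) (by positivity)
      rw [this, Real.log_zero]
      positivity
  have hfinal : |log a| ≤ |log a| / μ * lam := by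
    rw [div_mul_eq_mul_div, le_div_iff₀ hμ]
    gcongr
  rw [div_mul_eq_mul_div, le_div_iff₀ hκ]
  linarith

end NeumannMode

lemma exists_contDiff_eventuallyEq {φ : ℂ → ℝ} {K U : Set ℂ} (hK : IsClosed K) (hU : IsOpen U)
    (hKU : K ⊆ U) (hφ : ContDiffOn ℝ ∞ φ U) :
    ∃ f : ℂ → ℝ, ContDiff ℝ ∞ f ∧ ∀ p ∈ K, f =ᶠ[𝓝 p] φ := by
  obtain ⟨ψ, h0, h1, -⟩ := exists_contMDiffMap_zero_one_nhds_of_isClosed (n := ⊤)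
    (modelWithCornersSelf ℝ ℂ) hU.isClosed_compl hK
    (disjoint_compl_left_iff_subset.2 hKU)
  rw [eventually_nhdsSet_iff_forall] at h0 h1
  refine ⟨fun p => ψ p * φ p, contDiff_iff_contDiffAt.2 fun p => ?_, fun p hp => ?_⟩
  · by_cases hp : p ∈ U
    · exact ψ.contMDiff.contDiff.contDiffAt.mul (hφ.contDiffAt (hU.mem_nhds hp))
    · refine (contDiffAt_const (c := (0 : ℝ))).congr_of_eventuallyEq ?_
      filter_upwards [h0 p hp] with z hz
      rw [hz, zero_mul]
  · filter_upwards [h1 p hp] with z hz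
    rw [hz, one_mul]

section Transfer

variable {Ω : Set E2} {B : BoundaryParam Ω} {lam ℓ R : ℝ} {φ : E2 → ℝ} {Q : ℂ → ℂ}

lemma map_deriv_eq (e : ℂ ≃ₗᵢ[ℝ] E2) (H : Collar (e ⁻¹' Ω) ℓ R Q)
    (hQ : ∀ x : ℝ, e (Q x) = B.q x) (x : ℝ) : e (deriv Q x) = B.qd x := by
  have h1 : HasDerivAt (fun s : ℝ => Q s) (deriv Q x) x :=
    ((H.diff.differentiableAt ((isOpen_strip _ _).mem_nhds
      (ofReal_mem_strip H.width_pos x))).hasDerivAt).comp_ofReal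
  have h2 : HasDerivAt (fun s : ℝ => e (Q s)) (e (deriv Q x)) x :=
    (e.toContinuousLinearEquiv.hasFDerivAt).comp_hasDerivAt x h1
  simp only [hQ] at h2
  exact h2.unique (B.hasDerivAt x)

/-- An eigenfunction, extended smoothly to the plane and read in complex coordinates, is a
Neumann mode. -/
lemma exists_neumannMode (e : ℂ ≃ₗᵢ[ℝ] E2) (he1 : e 1 = EuclideanSpace.single 0 1)
    (heI : e Complex.I = EuclideanSpace.single 1 1 ∨ e Complex.I = -EuclideanSpace.single 1 1)
    (H : Collar (e ⁻¹' Ω) ℓ R Q) (hQ : ∀ x : ℝ, e (Q x) = B.q x)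
    (hφ : IsNeumannEigenfunction B lam φ) :
    ∃ f : ℂ → ℝ, NeumannMode (e ⁻¹' Ω) Q lam f ∧ (∃ p ∈ e ⁻¹' Ω, f p ≠ 0) ∧
      ∀ x : ℝ, f (Q x) = φ (B.q x) := by
  obtain ⟨U, hU, hΩU, han⟩ := hφ.analytic
  have hcl : closure (e ⁻¹' Ω) = e ⁻¹' closure Ω := (e.toHomeomorph.preimage_closure Ω).symm
  obtain ⟨f, hf, hfφ⟩ := exists_contDiff_eventuallyEq (φ := fun z => φ (e z))
    (K := closure (e ⁻¹' Ω)) (U := e ⁻¹' U) isClosed_closure (hU.preimage e.continuous)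
    (hcl ▸ preimage_mono hΩU)
    ((han.contDiffOn hU.uniqueDiffOn).comp e.contDiff.contDiffOn fun _ h => h)
  have hfd : ∀ p ∈ closure (e ⁻¹' Ω), ∀ v : ℂ,
      (fun z => fderiv ℝ f z v) =ᶠ[𝓝 p] fun z => fderiv ℝ φ (e z) (e v) := by
    intro p hp v
    filter_upwards [(hfφ p hp).eventually_nhds] with z hz
    rw [EventuallyEq.fderiv_eq hz]
    exact congrArg (fun L : ℂ →L[ℝ] ℝ => L v)
      (e.toContinuousLinearEquiv.comp_right_fderiv (f := φ) (x := z))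
  have hfd2 : ∀ p ∈ closure (e ⁻¹' Ω), ∀ v : ℂ, fderiv ℝ (fun z => fderiv ℝ f z v) p v =
      fderiv ℝ (fun y => fderiv ℝ φ y (e v)) (e p) (e v) := by
    intro p hp v
    rw [EventuallyEq.fderiv_eq (hfd p hp v)]
    exact congrArg (fun L : ℂ →L[ℝ] ℝ => L v)
      (e.toContinuousLinearEquiv.comp_right_fderiv (f := fun y => fderiv ℝ φ y (e v)) (x := p))
  have hmem : ∀ x : ℝ, Q x ∈ closure (e ⁻¹' Ω) := by
    intro x
    rw [hcl, mem_preimage, hQ]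
    exact frontier_subset_closure (B.range_eq ▸ mem_range_self x)
  refine ⟨f, ⟨hf, fun p hp => ?_, fun x => ?_⟩, ?_, fun x => ?_⟩
  · have hp' := subset_closure hp
    rw [(hfφ p hp').self_of_nhds, ← hφ.eigen _ hp, lap, Fin.sum_univ_two]
    refine congrArg₂ (· + ·) ((hfd2 p hp' 1).trans (by rw [he1])) ((hfd2 p hp' Complex.I).trans ?_)
    rcases heI with h | h <;> rw [h]
    simp only [map_neg, fderiv_fun_neg, neg_apply, neg_neg]
  · obtain ⟨n, hn⟩ := e.surjective (B.ν x)
    have h1 : ‖n‖ = 1 := by rw [← e.norm_map, hn, B.ν_unit]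
    have h2 : ⟪n, deriv Q x⟫ = 0 := by
      rw [← e.inner_map_map, hn, map_deriv_eq e H hQ, B.ν_orth]
    have h3 : fderiv ℝ f (Q x) n = 0 := by
      refine (hfd _ (hmem x) n).self_of_nhds.trans ?_
      beta_reduce
      rw [hn, hQ, ← hφ.neumann x, gradient,
        InnerProductSpace.toDual_symm_apply]
    rw [fderiv_apply_eq] at h3
    have h1' : n.re ^ 2 + n.im ^ 2 = 1 := by
      have := Complex.sq_norm n
      rw [h1, Complex.normSq_apply] at this
      linarith
    have h2' : n.re * (deriv Q x).re + n.im * (deriv Q x).im = 0 := by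
      simpa [Complex.inner, mul_comm] using h2
    linear_combination (n.im * (deriv Q x).re - n.re * (deriv Q x).im) * h3
      - ((deriv Q x).re * dy f (Q x) - (deriv Q x).im * dx f (Q x)) * h1'
      + (n.re * dy f (Q x) - n.im * dx f (Q x)) * h2'
  · obtain ⟨y, hy, hne⟩ := hφ.nontrivial
    obtain ⟨p, rfl⟩ := e.surjective y
    exact ⟨p, hy, by rwa [(hfφ p (subset_closure hy)).self_of_nhds]⟩
  · exact (hfφ _ (hmem x)).self_of_nhds.trans (congrArg φ (hQ x))

/-- The boundary of an analytic planar domain has a holomorphic collar. -/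
lemma exists_collar_of_boundaryParam (hΩ : IsPlaneDomain Ω) (hB : B.IsAnalytic) :
    ∃ (e : ℂ ≃ₗᵢ[ℝ] E2) (R : ℝ) (Q : ℂ → ℂ), e 1 = EuclideanSpace.single 0 1 ∧
      (e Complex.I = EuclideanSpace.single 1 1 ∨ e Complex.I = -EuclideanSpace.single 1 1) ∧
      Collar (e ⁻¹' Ω) B.len R Q ∧ ∀ x : ℝ, e (Q x) = B.q x := by
  let e : ℂ ≃ₗᵢ[ℝ] E2 := Complex.orthonormalBasisOneI.repr
  have he1 : e 1 = EuclideanSpace.single 0 1 := by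
    ext i; fin_cases i <;> simp [e]
  have heI : e Complex.I = EuclideanSpace.single 1 1 := by
    ext i; fin_cases i <;> simp [e]
  have hder : ∀ s, HasDerivAt (fun s => e.symm (B.q s)) (e.symm (B.qd s)) s := fun s =>
    (e.symm.toContinuousLinearEquiv.hasFDerivAt).comp_hasDerivAt s (B.hasDerivAt s)
  obtain ⟨R, Q, ⟨hQ, H⟩ | ⟨hQ, H⟩⟩ := exists_collar (Ω := e ⁻¹' Ω)
    (hΩ.isOpen.preimage e.continuous)
    (e.antilipschitz.isBounded_preimage hΩ.isBounded) B.len_pos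
    (γ := fun s => e.symm (B.q s))
    (fun s _ => (e.symm.toContinuousLinearEquiv.analyticAt _).comp (hB s (mem_univ s)))
    (fun s => by simp only [B.periodic s]) (e.symm.injective.comp_injOn B.injOn)
    (fun s => by rw [(hder s).deriv, e.symm.norm_map, B.unitSpeed])
    (by
      rw [show e ⁻¹' Ω = e.toHomeomorph ⁻¹' Ω from rfl, ← e.toHomeomorph.preimage_frontier,
        ← B.range_eq]
      ext z
      simp [e.symm_apply_eq])
  · exact ⟨e, R, Q, he1, Or.inl heI, H, fun x => by rw [hQ, e.apply_symm_apply]⟩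
  · refine ⟨Complex.conjLIE.trans e, R, Q, ?_, Or.inr ?_, H, fun x => ?_⟩
    · simpa using he1
    · simpa using heI
    · simp [hQ]

end Transfer

end NeumannBoundary

/-- Under the asymptotic Schiffer condition, the number of boundary critical points of a
Neumann eigenfunction (zeros of the tangential derivative along the boundary) is at most
`C·λ`. -/
theorem neumann_boundary_critical_points
    (Ω : Set E2) (hΩ : IsPlaneDomain Ω) (B : BoundaryParam Ω) (hB : B.IsAnalytic) :
    ∀ C₀ > (0 : ℝ), ∃ C > 0, ∀ lam : ℝ, 0 < lam → ∀ φ : E2 → ℝ,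
      IsNeumannEigenfunction B lam φ →
      (∫ s in (0 : ℝ)..B.len, (deriv (fun u => φ (B.q u)) s) ^ 2) ≥
        Real.exp (-2 * C₀ * lam) * ∫ s in (0 : ℝ)..B.len, (φ (B.q s)) ^ 2 →
      ({s ∈ Set.Ico (0 : ℝ) B.len | deriv (fun u => φ (B.q u)) s = 0}).Finite ∧
      (({s ∈ Set.Ico (0 : ℝ) B.len | deriv (fun u => φ (B.q u)) s = 0}).ncard : ℝ) ≤
        C * lam := by
  intro C₀ hC₀
  obtain ⟨e, R, Q, he1, heI, H, hQ⟩ := NeumannBoundary.exists_collar_of_boundaryParam hΩ hB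
  obtain ⟨C, hC, h⟩ := NeumannBoundary.NeumannMode.exists_ncard_le H hC₀
  refine ⟨C, hC, fun lam hlam φ hφ hS => ?_⟩
  obtain ⟨f, N, hne, hfQ⟩ := NeumannBoundary.exists_neumannMode e he1 heI H hQ hφ
  have := h lam f hlam N hne
  simp only [hfQ] at this
  exact this hS
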